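/- Let k be an infinite perfect field and let F ∈ k[X₀,X₁,X₂,X₃] be a homogeneous polynomial of degree 3 defining a smooth cubic surface in P³ over k. Let d be a positive integer with d not divisible by 3 and d ∉ {1,4,10}. If F has a nontrivial zero in some finite field extension K/k with [K:k] = d, then there exists a finite field extension L/k with [L:k] = d' for some d' < d not divisible by 3 in which F has a nontrivial zero. -/

import Mathlib

section OddDegreeComponent

open MvPolynomial

theorem exists_isMaximal_not_dvd_finrank (p : ℕ) {k Q : Type*} [Field k] [CommRing Q] [Algebra k Q]
    {N : Type*} [AddCommGroup N] [Module k N] [Module Q N] [IsScalarTower k Q N]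
    [FiniteDimensional k N] (h : ¬ p ∣ Module.finrank k N) :
    ∃ m : Ideal Q, m.IsMaximal ∧ ¬ p ∣ Module.finrank k (Q ⧸ m) ∧
      Module.finrank k (Q ⧸ m) ≤ Module.finrank k N := by
  induction hn : Module.finrank k N using Nat.strong_induction_on generalizing N with
  | _ n ih =>
    subst hn
    have : Nontrivial N := by
      by_contra hN
      rw [not_nontrivial_iff_subsingleton] at hN
      exact h (by simp [Module.finrank_zero_of_subsingleton])
    have : IsArtinian Q N := isArtinian_of_tower k inferInstance
    obtain ⟨S, hS⟩ := IsAtomic.exists_atom (Submodule Q N)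
    have hs : IsSimpleModule Q S := isSimpleModule_iff_isAtom.2 hS
    obtain ⟨m, hm, ⟨e⟩⟩ := isSimpleModule_iff_quot_maximal.1 hs
    have he : Module.finrank k S = Module.finrank k (Q ⧸ m) :=
      LinearEquiv.finrank_eq (e.restrictScalars k)
    have hadd := Submodule.finrank_quotient_add_finrank (S.restrictScalars k)
    have hSle : Module.finrank k S ≤ Module.finrank k N :=
      Submodule.finrank_le (S.restrictScalars k)
    by_cases hd : p ∣ Module.finrank k S
    · have : FiniteDimensional k (N ⧸ S) :=
        inferInstanceAs (FiniteDimensional k (N ⧸ S.restrictScalars k))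
      have hq : Module.finrank k (N ⧸ S) + Module.finrank k S = Module.finrank k N := hadd
      have hpos : 0 < Module.finrank k S := by
        have : Nontrivial S := hs.nontrivial
        have : FiniteDimensional k S :=
          inferInstanceAs (FiniteDimensional k (S.restrictScalars k))
        exact Module.finrank_pos
      obtain ⟨m', h1, h2, h3⟩ := ih (Module.finrank k (N ⧸ S)) (by omega) (N := N ⧸ S)
        (fun hd' => h (hq ▸ dvd_add hd' hd)) rfl
      exact ⟨m', h1, h2, by omega⟩
    · exact ⟨m, hm, he ▸ hd, he ▸ hSle⟩

end OddDegreeComponent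

section ResidueNormalization

open MvPolynomial

theorem exists_map_residue_ne_zero {σ k O k' : Type*} [Field k] [CommRing O] [IsDomain O]
    [UniqueFactorizationMonoid O] [Field k'] [Algebra O k'] [IsFractionRing O k'] (res : O →+* k)
    (ϖ : O) (hres : ∀ r, res r = 0 ↔ ϖ ∣ r) (hϖ : ϖ ≠ 0) (Φ : MvPolynomial σ k') (hΦ : Φ ≠ 0) :
    ∃ (c : k') (Ψ : MvPolynomial σ O), c ≠ 0 ∧ map (algebraMap O k') Ψ = C c * Φ ∧
      map res Ψ ≠ 0 := by
  obtain ⟨b, hb⟩ := IsLocalization.exist_integer_multiples_of_finset (nonZeroDivisors O)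
    (Φ.coeffs)
  have hinj : Function.Injective (algebraMap O k') := IsFractionRing.injective O k'
  obtain ⟨Ψ, hΨ⟩ : ∃ Ψ : MvPolynomial σ O, map (algebraMap O k') Ψ = C (algebraMap O k' b) * Φ := by
    have : C (algebraMap O k' b) * Φ ∈ Set.range (map (σ := σ) (algebraMap O k')) := by
      rw [mem_range_map_iff_coeffs_subset]
      intro c hc
      simp only [Finset.mem_coe, mem_coeffs_iff] at hc
      obtain ⟨n, hn, rfl⟩ := hc
      rw [coeff_C_mul]
      have h0 : coeff n Φ ≠ 0 := by
        intro h0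
        rw [mem_support_iff, coeff_C_mul, h0, mul_zero] at hn
        exact hn rfl
      obtain ⟨y, hy⟩ := hb _ (mem_coeffs_iff.2 ⟨n, mem_support_iff.2 h0, rfl⟩)
      exact ⟨y, by rw [hy, Algebra.smul_def]⟩
    exact this
  have hb0 : algebraMap O k' b ≠ 0 := by
    rw [Ne, map_eq_zero_iff _ hinj]
    exact nonZeroDivisors.ne_zero b.2
  have hΨ0 : Ψ ≠ 0 := by
    rintro rfl
    rw [map_zero] at hΨ
    exact (mul_ne_zero (by simp [hb0]) hΦ) hΨ.symm
  have hpr : Prime ϖ := by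
    refine ⟨hϖ, fun h => ?_, fun a b h => ?_⟩
    · have := (hres 1).2 (h.dvd)
      simp at this
    · rw [← hres, ← hres]
      rw [← hres, map_mul] at h
      exact mul_eq_zero.1 h
  obtain ⟨n, Ψ', hnd, hfac⟩ := WfDvdMonoid.max_power_factor hΨ0
    ((prime_C_iff (σ := σ)).2 hpr).irreducible
  have hϖ' : algebraMap O k' ϖ ≠ 0 := by
    rwa [Ne, map_eq_zero_iff _ hinj]
  refine ⟨(algebraMap O k' ϖ ^ n)⁻¹ * algebraMap O k' b, Ψ', ?_, ?_, ?_⟩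
  · exact mul_ne_zero (inv_ne_zero (pow_ne_zero _ hϖ')) hb0
  · rw [map_mul, mul_assoc, ← hΨ, hfac, map_mul, map_pow, map_C, ← mul_assoc, ← C_pow, ← map_mul,
      inv_mul_cancel₀ (pow_ne_zero _ hϖ'), map_one, one_mul]
  · rwa [Ne, ← C_dvd_iff_map_hom_eq_zero res ϖ (fun r => hres r)]

theorem MvPolynomial.IsHomogeneous.aeval_mul {σ k S : Type*} [CommSemiring k] [CommSemiring S]
    [Algebra k S] {F : MvPolynomial σ k} {n : ℕ} (hF : F.IsHomogeneous n) (c : S) (x : σ → S) :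
    MvPolynomial.aeval (fun i => c * x i) F =
      c ^ n * MvPolynomial.aeval x F := by
  rw [aeval_def, aeval_def, eval₂_eq, eval₂_eq, Finset.mul_sum]
  refine Finset.sum_congr rfl fun e he => ?_
  have h1 : ∏ i ∈ e.support, c ^ e i = c ^ n := by
    rw [Finset.prod_pow_eq_pow_sum, hF.degree_eq_sum_deg_support he]
  simp only [mul_pow, Finset.prod_mul_distrib, h1]
  ring

/-- After an invertible scaling, elements of a finite algebra become integral over a
valuation subring, in such a way that they generate the unit ideal. -/
theorem exists_isIntegral_normalization {σ k O k' R : Type*} [Fintype σ] [Field k] [Infinite k]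
    [CommRing O] [IsDomain O] [UniqueFactorizationMonoid O] [Field k'] [Algebra O k']
    [IsFractionRing O k'] [Algebra k O]
    (res : O →ₐ[k] k) (ϖ : O) (hres : ∀ r, res r = 0 ↔ ϖ ∣ r) (hϖ : ϖ ≠ 0)
    (hunit : ∀ r, res r ≠ 0 → IsUnit r) [CommRing R] [Algebra k' R] [FiniteDimensional k' R]
    [Algebra O R] [IsScalarTower O k' R] [Algebra k R] [IsScalarTower k O R]
    (x : σ → R) (i₀ : σ) (hx : x i₀ = 1) :
    ∃ (h : σ → k) (u : R), u * ∑ i, h i • x i = 1 ∧ ∀ i, IsIntegral O (u * x i) := by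
  classical
  let b := Module.finBasis k' R
  let M : Matrix _ _ (MvPolynomial σ k') := ∑ j, (X j : MvPolynomial σ k') •
    (Algebra.leftMulMatrix b (x j)).map (C (σ := σ))
  have hMeval : ∀ {S : Type _} [CommRing S] (f : MvPolynomial σ k' →+* S), f M.det =
      (∑ j, f (X j) • (Algebra.leftMulMatrix b (x j)).map (fun r => f (C r))).det := by
    intro S _ f
    rw [RingHom.map_det]
    congr 1
    simp only [M, map_sum]
    refine Finset.sum_congr rfl fun j _ => ?_
    ext a c
    simp
  have hM0 : M.det ≠ 0 := by
    intro h
    have h1 := hMeval (eval (Pi.single i₀ (1 : k')))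
    rw [h, map_zero] at h1
    rw [Finset.sum_eq_single i₀ (by
      intro j _ hj
      simp [Pi.single_eq_of_ne hj]) (by simp)] at h1
    simp [hx] at h1
  obtain ⟨c, Ψ, hc, hΨ, hΨr⟩ := exists_map_residue_ne_zero res.toRingHom ϖ hres hϖ _ hM0
  obtain ⟨h, hh⟩ : ∃ h : σ → k, eval h (map res.toRingHom Ψ) ≠ 0 := by
    by_contra! hcon
    exact hΨr (MvPolynomial.funext fun h => by rw [hcon, map_zero])
  have hu : IsUnit (eval (fun i => algebraMap k O (h i)) Ψ) := by
    apply hunit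
    have : eval h (map res.toRingHom Ψ) = res (eval (fun i => algebraMap k O (h i)) Ψ) := by
      rw [eval_map, eval₂_eq, eval_eq, map_sum]
      refine Finset.sum_congr rfl fun e _ => ?_
      simp
    rwa [← this]
  set H : R := ∑ i, h i • x i with hH
  have hHx : H = ∑ i, algebraMap O k' (algebraMap k O (h i)) • x i := by
    rw [hH]
    refine Finset.sum_congr rfl fun i _ => ?_
    rw [algebraMap_smul, algebraMap_smul]
  have hdet : algebraMap O k' (eval (fun i => algebraMap k O (h i)) Ψ) =
      c * (Algebra.leftMulMatrix b H).det := by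
    have h1 : algebraMap O k' (eval (fun i => algebraMap k O (h i)) Ψ) =
        eval (fun i => algebraMap O k' (algebraMap k O (h i))) (map (algebraMap O k') Ψ) := by
      rw [eval_map, eval₂_comp]
      rfl
    rw [h1, hΨ, map_mul, eval_C, hMeval]
    congr 2
    rw [hHx, map_sum]
    refine Finset.sum_congr rfl fun j _ => ?_
    rw [map_smul]
    ext a e
    simp
  have hdetne : (Algebra.leftMulMatrix b H).det ≠ 0 := by
    intro h0
    rw [h0, mul_zero] at hdet
    exact (hu.map (algebraMap O k')).ne_zero hdet
  obtain ⟨u, hu1⟩ : ∃ u, u * H = 1 := by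
    have h1 : LinearMap.det (LinearMap.mulLeft k' H) ≠ 0 := by
      rw [← LinearMap.det_toMatrix b]
      exact hdetne
    have h2 := ((LinearMap.isUnit_iff_isUnit_det _).2 (isUnit_iff_ne_zero.2 h1))
    rw [Module.End.isUnit_iff] at h2
    obtain ⟨u, hu⟩ := h2.2 1
    exact ⟨u, by rw [mul_comm]; exact hu⟩
  refine ⟨h, u, hu1, fun i => ?_⟩
  let P : Polynomial O := eval₂ Polynomial.C (fun j => Polynomial.X * Polynomial.C
    (algebraMap k O (h j)) - (if j = i then 1 else 0)) Ψ
  let N := Algebra.leftMulMatrix b (u * x i)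
  have hP : P.map (algebraMap O k') = Polynomial.C (algebraMap O k' (eval
      (fun i => algebraMap k O (h i)) Ψ)) * N.charpoly := by
    have h1 : P.map (algebraMap O k') = eval₂Hom Polynomial.C (fun j => Polynomial.X * Polynomial.C
        (algebraMap O k' (algebraMap k O (h j))) - (if j = i then 1 else 0))
        (map (algebraMap O k') Ψ) := by
      rw [coe_eval₂Hom, eval₂_map, ← Polynomial.coe_mapRingHom, eval₂_comp_left]
      congr 1
      · ext; simp
      · funext j
        simp only [Function.comp_apply, Polynomial.coe_mapRingHom]
        split_ifs <;> simp
    rw [h1, hΨ, map_mul, hMeval, hdet, coe_eval₂Hom, eval₂_C, map_mul, mul_assoc]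
    congr 1
    have h2 : (Algebra.leftMulMatrix b H) * N = Algebra.leftMulMatrix b (x i) := by
      rw [← map_mul, ← mul_assoc, mul_comm H, hu1, one_mul]
    have h3 : Polynomial.C (Algebra.leftMulMatrix b H).det =
        ((Algebra.leftMulMatrix b H).map Polynomial.C).det := by
      rw [RingHom.map_det]; rfl
    rw [h3, Matrix.charpoly, ← Matrix.det_mul]
    congr 1
    have h4 : N.charmatrix = (Polynomial.X : Polynomial k') • (1 : Matrix (Fin (Module.finrank k' R)) (Fin (Module.finrank k' R)) (Polynomial k')) -
        N.map Polynomial.C := by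
      ext a e
      simp [Matrix.charmatrix, Matrix.one_apply, Matrix.diagonal_apply]
    rw [h4, mul_sub, Matrix.mul_smul, mul_one, ← Matrix.map_mul, h2, hHx, map_sum]
    simp only [map_smul]
    ext a e : 1
    simp only [Matrix.sub_apply, Matrix.smul_apply, Matrix.map_apply, Matrix.sum_apply, smul_eq_mul,
      eval₂_X, eval₂_C, sub_mul, Finset.sum_sub_distrib, ite_mul, one_mul, zero_mul,
      Finset.sum_ite_eq', Finset.mem_univ, if_true, map_sum, map_mul, Finset.mul_sum]
    congr 1
    exact Finset.sum_congr rfl fun j _ => by ring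
  obtain ⟨v, hv⟩ := hu
  have hQ : (Polynomial.C (↑v⁻¹ : O) * P).map (algebraMap O k') = N.charpoly := by
    rw [Polynomial.map_mul, hP, ← mul_assoc, Polynomial.map_C, ← Polynomial.C_mul, ← map_mul, ← hv]
    simp
  refine ⟨Polynomial.C (↑v⁻¹ : O) * P, ?_, ?_⟩
  · refine Polynomial.monic_of_injective (IsFractionRing.injective O k') ?_
    rw [hQ]
    exact Matrix.charpoly_monic N
  · rw [← Polynomial.aeval_def, ← Polynomial.aeval_map_algebraMap k', hQ]
    apply Algebra.leftMulMatrix_injective b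
    rw [← Polynomial.aeval_algHom_apply, map_zero]
    exact Matrix.aeval_self_charpoly N

end ResidueNormalization

section Specialization

open MvPolynomial

/-- Specialization: a module over a finite algebra over the fraction field of a valuation ring
yields points over extensions of the residue field. -/
theorem exists_isMaximal_aeval_eq_zero {σ : Type*} {k O k' R M : Type u} [Fintype σ] [Field k]
    [Infinite k]
    [CommRing O] [IsDomain O] [IsPrincipalIdealRing O] [Field k'] [Algebra O k']
    [IsFractionRing O k'] [Algebra k O]
    (res : O →ₐ[k] k) (ϖ : O) (hres : ∀ r, res r = 0 ↔ ϖ ∣ r) (hϖ : ϖ ≠ 0)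
    (hunit : ∀ r, res r ≠ 0 → IsUnit r) [CommRing R] [Algebra k' R] [FiniteDimensional k' R]
    [Algebra O R] [IsScalarTower O k' R] [Algebra k R] [IsScalarTower k O R]
    [AddCommGroup M] [Module k' M] [Module R M] [IsScalarTower k' R M]
    [FiniteDimensional k' M] (p : ℕ) (hp : ¬ p ∣ Module.finrank k' M)
    {F : MvPolynomial σ k} {n : ℕ} (hF : F.IsHomogeneous n)
    (x : σ → R) (i₀ : σ) (hx : x i₀ = 1) (hFx : aeval x F = 0) :
    ∃ d' : ℕ, d' ≤ Module.finrank k' M ∧ ¬ (p ∣ d') ∧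
      ∃ (L : Type u) (_ : Field L) (_ : Algebra k L),
        Module.finrank k L = d' ∧ ∃ y : σ → L, y ≠ 0 ∧ aeval y F = 0 := by
  classical
  obtain ⟨h, u, hu, hint⟩ := exists_isIntegral_normalization (k' := k') res ϖ hres hϖ hunit x i₀ hx
  let 𝒪 := Algebra.adjoin O (Set.range fun i => u * x i)
  have hfg : Module.Finite O 𝒪 := by
    suffices h : (Subalgebra.toSubmodule 𝒪).FG from Module.Finite.iff_fg.2 h
    exact fg_adjoin_of_finite (Set.finite_range _) (by rintro _ ⟨i, rfl⟩; exact hint i)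
  let : Module O M := Module.compHom M (algebraMap O R)
  have hsOR : IsScalarTower O R M := ⟨fun a r m => by
    rw [Algebra.smul_def, mul_smul]; rfl⟩
  have hsOk : IsScalarTower O k' M := ⟨fun a c m => by
    rw [Algebra.smul_def, mul_smul, ← algebraMap_smul R (algebraMap O k' a),
      ← IsScalarTower.algebraMap_apply]; rfl⟩
  have : Module.IsTorsionFree O M := Module.IsTorsionFree.trans_faithfulSMul O k' M
  let : Module k M := Module.compHom M (algebraMap k R)
  have hskR : IsScalarTower k R M := ⟨fun a r m => by
    rw [Algebra.smul_def, mul_smul]; rfl⟩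
  have hskO : IsScalarTower k O M := ⟨fun a r m => by
    rw [← algebraMap_smul R (a • r) m, Algebra.smul_def, map_mul, mul_smul,
      ← IsScalarTower.algebraMap_apply k O R, algebraMap_smul, algebraMap_smul]⟩
  have hsk𝒪 : IsScalarTower k 𝒪 M := ⟨fun a r m => smul_assoc a (r : R) m⟩
  have hsO𝒪 : IsScalarTower O 𝒪 M := ⟨fun a r m => smul_assoc a (r : R) m⟩
  let b := Module.finBasis k' M
  let N : Submodule 𝒪 M := Submodule.span 𝒪 (Set.range b)
  have hNfin : Module.Finite 𝒪 N := Module.Finite.span_of_finite _ (Set.finite_range _)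
  have hNO : Module.Finite O N := Module.Finite.trans 𝒪 N
  have hlat : Submodule.IsLattice k' (N.restrictScalars O) := by
    refine ⟨Module.Finite.iff_fg.1 hNO, ?_⟩
    rw [eq_top_iff, ← b.span_eq]
    exact Submodule.span_mono Submodule.subset_span
  have hfree : Module.Free O N := inferInstanceAs (Module.Free O (N.restrictScalars O))
  have hrank : Module.finrank O N = Module.finrank k' M :=
    Module.finrank_eq_of_rank_eq ((Submodule.IsLattice.rank' k' (N.restrictScalars O)).trans
      (Module.finrank_eq_rank k' M).symm)
  let e := Module.finBasis O N
  let I : Submodule 𝒪 N := LinearMap.range (LinearMap.lsmul 𝒪 N (algebraMap O 𝒪 ϖ))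
  let φ : N →ₗ[k] (Fin (Module.finrank O N) → k) :=
    { toFun := fun n i => res (e.repr n i)
      map_add' := fun a b => by ext; simp
      map_smul' := fun a b => by
        ext i
        rw [← algebraMap_smul O a b, map_smul]
        simp }
  have hφ : Function.Surjective φ := by
    intro v
    refine ⟨∑ i, algebraMap k O (v i) • e i, ?_⟩
    ext i
    change res (e.repr _ i) = _
    rw [e.repr_sum_self]
    simp
  have hker : LinearMap.ker φ = I.restrictScalars k := by
    ext n
    rw [LinearMap.mem_ker, Submodule.restrictScalars_mem, LinearMap.mem_range]
    constructor
    · intro h0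
      have : ∀ i, ϖ ∣ e.repr n i := fun i => (hres _).1 (congrFun h0 i)
      choose c hc using this
      refine ⟨∑ i, c i • e i, ?_⟩
      rw [LinearMap.lsmul_apply, algebraMap_smul, Finset.smul_sum]
      conv_rhs => rw [← e.sum_repr n]
      exact Finset.sum_congr rfl fun i _ => by rw [hc, mul_smul]
    · rintro ⟨y, rfl⟩
      ext i
      change res (e.repr _ i) = 0
      rw [LinearMap.lsmul_apply, algebraMap_smul, map_smul]
      exact (hres _).2 ⟨_, rfl⟩
  have eqv : (N ⧸ I) ≃ₗ[k] (Fin (Module.finrank O N) → k) :=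
    (Submodule.quotEquivOfEq _ _ hker.symm).trans (φ.quotKerEquivOfSurjective hφ)
  have hfr : Module.finrank k (N ⧸ I) = Module.finrank O N := by
    rw [eqv.finrank_eq, Module.finrank_fin_fun]
  have : FiniteDimensional k (N ⧸ I) := Module.Finite.equiv eqv.symm
  obtain ⟨m, hm, h1, h2⟩ := exists_isMaximal_not_dvd_finrank p (k := k) (Q := 𝒪) (N := N ⧸ I)
    (by rw [hfr, hrank]; exact hp)
  let := Ideal.Quotient.field m
  refine ⟨_, by rwa [hfr, hrank] at h2, h1, 𝒪 ⧸ m, inferInstance, inferInstance, rfl, ?_⟩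
  let S : σ → 𝒪 := fun i => ⟨u * x i, Algebra.subset_adjoin ⟨i, rfl⟩⟩
  have hS : aeval S F = 0 := by
    apply Subtype.ext
    change (𝒪.val.restrictScalars k) (aeval S F) = 0
    rw [MvPolynomial.comp_aeval_apply]
    exact (hF.aeval_mul u x).trans (by rw [hFx, mul_zero])
  have hS1 : ∑ i, h i • S i = 1 := by
    apply Subtype.ext
    change (𝒪.val.restrictScalars k) (∑ i, h i • S i) = 1
    rw [map_sum, ← hu, Finset.mul_sum]
    refine Finset.sum_congr rfl fun i _ => ?_
    rw [map_smul, mul_smul_comm]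
    rfl
  refine ⟨fun i => Ideal.Quotient.mkₐ k m (S i), fun h0 => ?_, ?_⟩
  · have : Ideal.Quotient.mkₐ k m (∑ i, h i • S i) = 0 := by
      rw [map_sum]
      refine Finset.sum_eq_zero fun i _ => ?_
      rw [map_smul, congrFun h0 i]
      simp
    rw [hS1, map_one] at this
    exact one_ne_zero this
  · have := MvPolynomial.comp_aeval_apply S (Ideal.Quotient.mkₐ k m) F
    rw [hS, map_zero] at this
    exact this.symm

end Specialization

/-- The monomial `x ^ i * y ^ j * z ^ l`. -/
def cubicMon {C : Type*} [CommRing C] (x y z : C) (e : ℕ × ℕ × Fin 3) : C :=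
  x ^ e.1 * y ^ e.2.1 * z ^ (e.2.2 : ℕ)

/-- The degree of an exponent. -/
def expDeg (e : ℕ × ℕ × Fin 3) : ℕ := e.1 + e.2.1 + e.2.2

/-- The exponents of degree at most `n`. -/
def expIdx (n : ℕ) : Finset (ℕ × ℕ × Fin 3) :=
  (Finset.range (n + 1) ×ˢ (Finset.range (n + 1) ×ˢ Finset.univ)).filter fun e => expDeg e ≤ n

theorem mem_expIdx {n : ℕ} {e : ℕ × ℕ × Fin 3} : e ∈ expIdx n ↔ expDeg e ≤ n := by
  obtain ⟨i, j, l⟩ := e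
  rw [expIdx, Finset.mem_filter]
  simp only [expDeg, Finset.mem_product, Finset.mem_range,
    Finset.mem_univ, and_true, and_iff_right_iff_imp]
  intro h
  omega

theorem card_filter_add_lt (n q : ℕ) (hq : q ≤ n) :
    2 * ((Finset.range n ×ˢ Finset.range n).filter fun e => e.1 + e.2 < q).card = q * (q + 1) := by
  have : ((Finset.range n ×ˢ Finset.range n).filter fun e => e.1 + e.2 < q) =
      (Finset.range q).biUnion fun s => Finset.HasAntidiagonal.antidiagonal s := by
    ext ⟨i, j⟩
    simp only [Finset.mem_filter, Finset.mem_product, Finset.mem_range, Finset.mem_biUnion,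
      Finset.HasAntidiagonal.mem_antidiagonal, exists_eq_right']
    omega
  rw [this, Finset.card_biUnion]
  · simp only [Finset.Nat.card_antidiagonal]
    rw [Finset.sum_add_distrib, mul_add, mul_comm 2, Finset.sum_range_id_mul_two]
    cases q <;> simp
    ring
  · intro s _ t _ hst
    rw [Function.onFun, Finset.disjoint_left]
    intro e h1 h2
    exact hst ((Finset.HasAntidiagonal.mem_antidiagonal.1 h1).symm.trans (Finset.HasAntidiagonal.mem_antidiagonal.1 h2))

theorem card_expIdx (n : ℕ) : 2 * (expIdx n).card = 3 * n ^ 2 + 3 * n + 2 := by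
  have h : ∀ l : Fin 3, ((expIdx n).filter fun e => e.2.2 = l).card =
      ((Finset.range (n + 1) ×ˢ Finset.range (n + 1)).filter
        fun e => e.1 + e.2 < n + 1 - l).card := by
    intro l
    refine Finset.card_nbij' (fun e => (e.1, e.2.1)) (fun e => (e.1, e.2, l)) ?_ ?_ ?_ ?_
    · rintro ⟨i, j, l'⟩ he
      simp [mem_expIdx, expDeg] at he ⊢
      obtain ⟨he, rfl⟩ := he
      omega
    · rintro ⟨i, j⟩ he
      simp [mem_expIdx, expDeg] at he ⊢
      omega
    · rintro ⟨i, j, l'⟩ he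
      simp at he ⊢
      exact he.2.symm
    · rintro ⟨i, j⟩ _
      rfl
  have h2 : (expIdx n).card = ∑ l : Fin 3, ((expIdx n).filter fun e => e.2.2 = l).card :=
    Finset.card_eq_sum_card_fiberwise (fun _ _ => by simp)
  rw [h2, Finset.mul_sum]
  simp only [h]
  rw [Fin.sum_univ_three, card_filter_add_lt _ _ (by omega), card_filter_add_lt _ _ (by omega),
    card_filter_add_lt _ _ (by omega)]
  rcases n with _ | n
  · simp
  · simp
    ring

section Frame

variable (L : Type*) {C : Type*} [Field L] [CommRing C] [Algebra L C] (x y z : C)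

/-- The span of the monomials of degree at most `n`. -/
def cubicFil (n : ℕ) : Submodule L C := Submodule.span L (cubicMon x y z '' {e | expDeg e ≤ n})

/-- The monomials in `x`, `y`, `z` with exponent of `z` at most two are a basis, and the relation
satisfied by `z` is filtered. -/
structure IsCubicFrame : Prop where
  li : LinearIndependent L (cubicMon x y z)
  span : ⊤ ≤ Submodule.span L (Set.range (cubicMon x y z))
  cube : z ^ 3 ∈ cubicFil L x y z 3

variable {L x y z}

theorem cubicMon_mem_cubicFil {n : ℕ} {e : ℕ × ℕ × Fin 3} (he : expDeg e ≤ n) :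
    cubicMon x y z e ∈ cubicFil L x y z n := Submodule.subset_span ⟨e, he, rfl⟩

theorem cubicFil_mono {m n : ℕ} (h : m ≤ n) : cubicFil L x y z m ≤ cubicFil L x y z n :=
  Submodule.span_mono (Set.image_mono fun _ he => le_trans he h)

theorem cubicFil_le_iff {n : ℕ} {S : Submodule L C} :
    cubicFil L x y z n ≤ S ↔ ∀ e, expDeg e ≤ n → cubicMon x y z e ∈ S := by
  rw [cubicFil, Submodule.span_le, Set.image_subset_iff]
  rfl

theorem mul_mem_of_mem_cubicFil {n : ℕ} {S : Submodule L C} (c : C)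
    (h : ∀ e, expDeg e ≤ n → c * cubicMon x y z e ∈ S) {v : C} (hv : v ∈ cubicFil L x y z n) :
    c * v ∈ S := by
  have : cubicFil L x y z n ≤ S.comap (LinearMap.mulLeft L c) := cubicFil_le_iff.2 h
  exact this hv

theorem pow_mul_mem_cubicFil (i j : ℕ) {n : ℕ} {v : C} (hv : v ∈ cubicFil L x y z n) :
    x ^ i * y ^ j * v ∈ cubicFil L x y z (i + j + n) := by
  refine mul_mem_of_mem_cubicFil _ (fun e he => ?_) hv
  have : x ^ i * y ^ j * cubicMon x y z e = cubicMon x y z (i + e.1, j + e.2.1, e.2.2) := by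
    simp only [cubicMon]; ring
  rw [this]
  apply cubicMon_mem_cubicFil
  simp only [expDeg] at he ⊢
  omega

namespace IsCubicFrame

theorem z_mul_mem (hC : IsCubicFrame L x y z) {n : ℕ} {v : C} (hv : v ∈ cubicFil L x y z n) :
    z * v ∈ cubicFil L x y z (n + 1) := by
  refine mul_mem_of_mem_cubicFil _ (fun e he => ?_) hv
  obtain ⟨i, j, l⟩ := e
  simp only [expDeg] at he
  fin_cases l
  · have : z * cubicMon x y z (i, j, 0) = cubicMon x y z (i, j, 1) := by
      simp [cubicMon]; ring
    exact this ▸ cubicMon_mem_cubicFil (by simp [expDeg] at he ⊢; omega)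
  · have : z * cubicMon x y z (i, j, 1) = cubicMon x y z (i, j, 2) := by
      simp [cubicMon]; ring
    exact this ▸ cubicMon_mem_cubicFil (by simp [expDeg] at he ⊢; omega)
  · have : z * cubicMon x y z (i, j, 2) = x ^ i * y ^ j * z ^ 3 := by
      simp [cubicMon]; ring
    change z * cubicMon x y z (i, j, 2) ∈ _
    rw [this]
    refine cubicFil_mono ?_ (pow_mul_mem_cubicFil i j hC.cube)
    simp at he
    omega

theorem mul_mem (hC : IsCubicFrame L x y z)
    {m n : ℕ} {u v : C} (hu : u ∈ cubicFil L x y z m) (hv : v ∈ cubicFil L x y z n) :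
    u * v ∈ cubicFil L x y z (m + n) := by
  rw [mul_comm]
  refine mul_mem_of_mem_cubicFil _ (fun e he => ?_) hu
  have hz : ∀ l : ℕ, z ^ l * v ∈ cubicFil L x y z (n + l) := by
    intro l
    induction l with
    | zero => simpa using hv
    | succ l ih => rw [pow_succ', mul_assoc, ← add_assoc]; exact hC.z_mul_mem ih
  have : v * cubicMon x y z e = x ^ e.1 * y ^ e.2.1 * (z ^ (e.2.2 : ℕ) * v) := by
    simp only [cubicMon]; ring
  rw [this]
  refine cubicFil_mono ?_ (pow_mul_mem_cubicFil _ _ (hz _))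
  simp only [expDeg] at he
  omega

theorem exists_mem_cubicFil (hC : IsCubicFrame L x y z) (v : C) : ∃ n, v ∈ cubicFil L x y z n := by
  have hv : v ∈ Submodule.span L (Set.range (cubicMon x y z)) := hC.span trivial
  induction hv using Submodule.span_induction with
  | mem v hv =>
    obtain ⟨e, rfl⟩ := hv
    exact ⟨_, cubicMon_mem_cubicFil le_rfl⟩
  | zero => exact ⟨0, zero_mem _⟩
  | add u v _ _ hu hv =>
    obtain ⟨m, hm⟩ := hu
    obtain ⟨n, hn⟩ := hv
    exact ⟨max m n, add_mem (cubicFil_mono (le_max_left _ _) hm)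
      (cubicFil_mono (le_max_right _ _) hn)⟩
  | smul c v _ hv =>
    obtain ⟨n, hn⟩ := hv
    exact ⟨n, Submodule.smul_mem _ _ hn⟩

theorem finrank_span_image (hC : IsCubicFrame L x y z) (s : Finset (ℕ × ℕ × Fin 3)) :
    Module.finrank L (Submodule.span L (cubicMon x y z '' (s : Set (ℕ × ℕ × Fin 3)))) = s.card := by
  have h := finrank_span_eq_card (R := L) (b := fun e : s => cubicMon x y z e)
    (hC.li.comp _ Subtype.val_injective)
  rw [Fintype.card_coe] at h
  rw [← h, Set.image_eq_range]
  rfl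

theorem finrank_cubicFil (hC : IsCubicFrame L x y z)
    (n : ℕ) : Module.finrank L (cubicFil L x y z n) = (expIdx n).card := by
  rw [← hC.finrank_span_image, cubicFil]
  have : {e | expDeg e ≤ n} = (expIdx n : Set (ℕ × ℕ × Fin 3)) := by
    ext e
    simp [mem_expIdx]
  rw [this]

end IsCubicFrame

theorem finiteDimensional_cubicFil (n : ℕ) : FiniteDimensional L (cubicFil L x y z n) := by
  apply FiniteDimensional.span_of_finite
  refine Set.Finite.image _ ((expIdx n).finite_toSet.subset fun e he => mem_expIdx.2 he)

end Frame

section Frame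

variable {L : Type*} {C : Type*} [Field L] [CommRing C] [Algebra L C] {x y z : C}

variable (L x y z) in
/-- The span of the monomials with exponents of `x` and `y` less than `m`. -/
def cubicBox (m : ℕ) : Submodule L C :=
  Submodule.span L (cubicMon x y z '' {e | e.1 < m ∧ e.2.1 < m})

theorem mul_mem_of_mem_span_cubicMon {s : Set (ℕ × ℕ × Fin 3)} {S : Submodule L C} (c : C)
    (h : ∀ e ∈ s, c * cubicMon x y z e ∈ S) {v : C}
    (hv : v ∈ Submodule.span L (cubicMon x y z '' s)) : c * v ∈ S := by
  have : Submodule.span L (cubicMon x y z '' s) ≤ S.comap (LinearMap.mulLeft L c) := by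
    rw [Submodule.span_le, Set.image_subset_iff]
    exact h
  exact this hv

theorem map_mulLeft_mono {S T : Submodule L C} (h : S ≤ T) (A : C) :
    S.map (LinearMap.mulLeft L A) ≤ T.map (LinearMap.mulLeft L A) := Submodule.map_mono h

/-- Reduction of monomials modulo two polynomials with leading terms `x ^ m` and `y ^ m`. -/
theorem cubicMon_mem_of_leading {m : ℕ} {A B : C}
    (hA : A - x ^ m ∈ Submodule.span L
      (cubicMon x y z '' {e | e.1 < m ∧ e.2.1 = 0 ∧ e.2.2 = 0}))
    (hB : B - y ^ m ∈ Submodule.span L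
      (cubicMon x y z '' {e | e.2.1 < m ∧ e.1 + e.2.1 ≤ m ∧ e.2.2 = 0})) (n : ℕ) :
    cubicFil L x y z n ≤ (cubicFil L x y z (n - m)).map (LinearMap.mulLeft L A) ⊔
      (cubicFil L x y z (n - m)).map (LinearMap.mulLeft L B) ⊔ cubicBox L x y z m := by
  rw [cubicFil_le_iff]
  set S := (cubicFil L x y z (n - m)).map (LinearMap.mulLeft L A) ⊔
      (cubicFil L x y z (n - m)).map (LinearMap.mulLeft L B) ⊔ cubicBox L x y z m
  suffices H : ∀ j i l, expDeg (i, j, l) ≤ n → cubicMon x y z (i, j, l) ∈ S from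
    fun e he => H e.2.1 e.1 e.2.2 he
  intro j
  induction j using Nat.strong_induction_on with
  | _ j ihj =>
    intro i
    induction i using Nat.strong_induction_on with
    | _ i ihi =>
      intro l hd
      simp only [expDeg] at hd
      by_cases hj : m ≤ j
      · obtain ⟨j, rfl⟩ := Nat.exists_eq_add_of_le hj
        have h1 : cubicMon x y z (i, m + j, l) = B * cubicMon x y z (i, j, l) -
            cubicMon x y z (i, j, l) * (B - y ^ m) := by
          simp only [cubicMon]; ring
        rw [h1]
        refine sub_mem ?_ ?_
        · refine Submodule.mem_sup_left (Submodule.mem_sup_right ⟨_, ?_, rfl⟩)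
          exact cubicMon_mem_cubicFil (by simp only [expDeg]; omega)
        · refine mul_mem_of_mem_span_cubicMon _ ?_ hB
          rintro ⟨i', j', l'⟩ ⟨h1, h2, rfl⟩
          have h3 : cubicMon x y z (i, j, l) * cubicMon x y z (i', j', 0) =
              cubicMon x y z (i + i', j + j', l) := by
            simp [cubicMon]; ring
          rw [h3]
          simp only at h1 h2
          exact ihj _ (by omega) _ _ (by simp only [expDeg]; omega)
      · by_cases hi : m ≤ i
        · obtain ⟨i, rfl⟩ := Nat.exists_eq_add_of_le hi
          have h1 : cubicMon x y z (m + i, j, l) = A * cubicMon x y z (i, j, l) -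
              cubicMon x y z (i, j, l) * (A - x ^ m) := by
            simp only [cubicMon]; ring
          rw [h1]
          refine sub_mem ?_ ?_
          · refine Submodule.mem_sup_left (Submodule.mem_sup_left ⟨_, ?_, rfl⟩)
            exact cubicMon_mem_cubicFil (by simp only [expDeg]; omega)
          · refine mul_mem_of_mem_span_cubicMon _ ?_ hA
            rintro ⟨i', j', l'⟩ ⟨h1, h2, rfl⟩
            simp only at h1 h2
            subst h2
            have h3 : cubicMon x y z (i, j, l) * cubicMon x y z (i', 0, 0) =
                cubicMon x y z (i + i', j, l) := by
              simp [cubicMon]; ring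
            rw [h3]
            exact ihi _ (by omega) _ (by simp only [expDeg]; omega)
        · exact Submodule.mem_sup_right (Submodule.subset_span ⟨_, ⟨by simp; omega, by simp; omega⟩, rfl⟩)

theorem cubicBox_eq (m : ℕ) : cubicBox L x y z m = Submodule.span L (cubicMon x y z ''
    ((Finset.range m ×ˢ (Finset.range m ×ˢ Finset.univ) : Finset (ℕ × ℕ × Fin 3)) : Set _)) := by
  rw [cubicBox]
  congr! 3
  ext e
  simp

theorem finiteDimensional_cubicBox (m : ℕ) : FiniteDimensional L (cubicBox L x y z m) := by
  rw [cubicBox_eq]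
  exact FiniteDimensional.span_of_finite _ ((Finset.finite_toSet _).image _)

namespace IsCubicFrame

theorem finrank_cubicBox (hC : IsCubicFrame L x y z)
    (m : ℕ) : Module.finrank L (cubicBox L x y z m) = 3 * m ^ 2 := by
  rw [cubicBox_eq, hC.finrank_span_image]
  simp
  ring

theorem cubicFil_le_of_le (hC : IsCubicFrame L x y z) {m : ℕ} {A B : C}
    (hs : cubicFil L x y z (2 * m + 1) ≤
      (cubicFil L x y z (m + 1)).map (LinearMap.mulLeft L A) ⊔
      (cubicFil L x y z (m + 1)).map (LinearMap.mulLeft L B) ⊔ cubicBox L x y z m) (n : ℕ) :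
    cubicFil L x y z (2 * m + 1 + n) ≤
      (cubicFil L x y z (m + 1 + n)).map (LinearMap.mulLeft L A) ⊔
      (cubicFil L x y z (m + 1 + n)).map (LinearMap.mulLeft L B) ⊔ cubicBox L x y z m := by
  induction n with
  | zero => simpa using hs
  | succ n ih =>
    have key : ∀ t ∈ cubicFil L x y z 1, ∀ v ∈ cubicFil L x y z (2 * m + 1 + n), t * v ∈
        (cubicFil L x y z (m + 1 + (n + 1))).map (LinearMap.mulLeft L A) ⊔
        (cubicFil L x y z (m + 1 + (n + 1))).map (LinearMap.mulLeft L B) ⊔ cubicBox L x y z m := by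
      intro t ht v hv
      obtain ⟨w, hw, u, hu, rfl⟩ := Submodule.mem_sup.1 (ih hv)
      obtain ⟨_, ⟨a, ha, rfl⟩, _, ⟨b, hb, rfl⟩, rfl⟩ := Submodule.mem_sup.1 hw
      simp only [LinearMap.mulLeft_apply]
      rw [mul_add, mul_add, mul_left_comm, mul_left_comm t B]
      refine add_mem (Submodule.mem_sup_left (add_mem (Submodule.mem_sup_left ⟨_, ?_, rfl⟩)
        (Submodule.mem_sup_right ⟨_, ?_, rfl⟩))) ?_
      · exact cubicFil_mono (by omega) (hC.mul_mem ht ha)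
      · exact cubicFil_mono (by omega) (hC.mul_mem ht hb)
      · have hu' : u ∈ cubicFil L x y z (2 * m) := by
          refine Submodule.span_mono (Set.image_mono ?_) hu
          rintro ⟨i, j, l⟩ ⟨h1, h2⟩
          simp only [expDeg, Set.mem_ofPred_eq] at h1 h2 ⊢
          omega
        have h3 := hs (cubicFil_mono (by omega) (hC.mul_mem ht hu'))
        have h4 : ∀ D : C, (cubicFil L x y z (m + 1)).map (LinearMap.mulLeft L D) ≤
            (cubicFil L x y z (m + 1 + (n + 1))).map (LinearMap.mulLeft L D) :=
          fun D => map_mulLeft_mono (cubicFil_mono (by omega)) D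
        have h5 := sup_le_sup_right (sup_le_sup (h4 A) (h4 B)) (cubicBox L x y z m)
        exact h5 h3
    have hgen : x ∈ cubicFil L x y z 1 ∧ y ∈ cubicFil L x y z 1 ∧ z ∈ cubicFil L x y z 1 := by
      refine ⟨?_, ?_, ?_⟩
      · simpa [cubicMon] using cubicMon_mem_cubicFil (L := L) (x := x) (y := y) (z := z)
          (e := (1, 0, 0)) (n := 1) (by simp [expDeg])
      · simpa [cubicMon] using cubicMon_mem_cubicFil (L := L) (x := x) (y := y) (z := z)
          (e := (0, 1, 0)) (n := 1) (by simp [expDeg])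
      · simpa [cubicMon] using cubicMon_mem_cubicFil (L := L) (x := x) (y := y) (z := z)
          (e := (0, 0, 1)) (n := 1) (by simp [expDeg])
    rw [cubicFil_le_iff]
    rintro ⟨i, j, l⟩ he
    simp only [expDeg] at he
    rcases i with _ | i
    · rcases j with _ | j
      · obtain rfl | rfl | rfl : l = 0 ∨ l = 1 ∨ l = 2 := by fin_cases l <;> simp
        · have h0 : (1 : C) = cubicMon x y z (0, 0, 0) := by simp [cubicMon]
          have h1 := key 1 (h0 ▸ cubicMon_mem_cubicFil (by simp [expDeg])) 1
            (h0 ▸ cubicMon_mem_cubicFil (by simp [expDeg]))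
          rwa [mul_one, h0] at h1
        · have h1 := key z hgen.2.2 _ (cubicMon_mem_cubicFil (e := (0, 0, 0)) (by simp [expDeg]))
          convert h1 using 1
          simp [cubicMon]
        · have h1 := key z hgen.2.2 _ (cubicMon_mem_cubicFil (e := (0, 0, 1))
            (by simp [expDeg]; omega))
          convert h1 using 1
          simp [cubicMon, pow_two]
      · have h1 := key y hgen.2.1 _ (cubicMon_mem_cubicFil (e := (0, j, l))
            (by simp [expDeg] at he ⊢; omega))
        convert h1 using 1
        simp [cubicMon]; ring
    · have h1 := key x hgen.1 _ (cubicMon_mem_cubicFil (e := (i, j, l))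
            (by simp [expDeg] at he ⊢; omega))
      convert h1 using 1
      simp [cubicMon]; ring

theorem finrank_quotient_span_pair (hC : IsCubicFrame L x y z)
    [IsDomain C] {m : ℕ} (hm : 1 ≤ m) {A B : C}
    (hA : A ∈ cubicFil L x y z m) (hB : B ∈ cubicFil L x y z m) (hA0 : A ≠ 0) (hB0 : B ≠ 0)
    (hs : cubicFil L x y z (2 * m + 1) ≤
      (cubicFil L x y z (m + 1)).map (LinearMap.mulLeft L A) ⊔
      (cubicFil L x y z (m + 1)).map (LinearMap.mulLeft L B) ⊔ cubicBox L x y z m) :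
    Module.finrank L (C ⧸ Ideal.span {A, B}) = 3 * m ^ 2 ∧
      FiniteDimensional L (C ⧸ Ideal.span {A, B}) := by
  let φ : cubicBox L x y z m →ₗ[L] C ⧸ Ideal.span {A, B} :=
    (Ideal.Quotient.mkₐ L (Ideal.span {A, B})).toLinearMap ∘ₗ (cubicBox L x y z m).subtype
  have hfd := fun n => finiteDimensional_cubicFil (L := L) (x := x) (y := y) (z := z) n
  have := finiteDimensional_cubicBox (L := L) (x := x) (y := y) (z := z) m
  have hsurj : Function.Surjective φ := by
    intro v
    obtain ⟨v, rfl⟩ := Ideal.Quotient.mk_surjective v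
    obtain ⟨n, hn⟩ := hC.exists_mem_cubicFil v
    obtain ⟨w, hw, u, hu, rfl⟩ := Submodule.mem_sup.1 (hC.cubicFil_le_of_le hs n
      (cubicFil_mono (by omega) hn))
    obtain ⟨_, ⟨a, ha, rfl⟩, _, ⟨b, hb, rfl⟩, rfl⟩ := Submodule.mem_sup.1 hw
    refine ⟨⟨u, hu⟩, ?_⟩
    change Ideal.Quotient.mk _ u = _
    rw [eq_comm, Ideal.Quotient.eq, add_sub_cancel_right]
    exact Ideal.mem_span_pair.2 ⟨a, b, by simp [mul_comm]⟩
  have hinj : Function.Injective φ := by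
    rw [injective_iff_map_eq_zero]
    rintro ⟨u, hu⟩ h0
    obtain ⟨a, b, hab⟩ := Ideal.mem_span_pair.1 (Ideal.Quotient.eq_zero_iff_mem.1 h0)
    obtain ⟨na, ha⟩ := hC.exists_mem_cubicFil a
    obtain ⟨nb, hb⟩ := hC.exists_mem_cubicFil b
    set n := max na nb
    have ha' : a ∈ cubicFil L x y z (m + 1 + n) := cubicFil_mono (by omega) ha
    have hb' : b ∈ cubicFil L x y z (m + 1 + n) := cubicFil_mono (by omega) hb
    set FA := (cubicFil L x y z (m + 1 + n)).map (LinearMap.mulLeft L A)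
    set FB := (cubicFil L x y z (m + 1 + n)).map (LinearMap.mulLeft L B)
    have hfA : Module.finrank L FA ≤ (expIdx (m + 1 + n)).card := by
      rw [← hC.finrank_cubicFil]; exact Submodule.finrank_map_le _ _
    have hfB : Module.finrank L FB ≤ (expIdx (m + 1 + n)).card := by
      rw [← hC.finrank_cubicFil]; exact Submodule.finrank_map_le _ _
    have hAB : (expIdx (1 + n)).card ≤ Module.finrank L (FA ⊓ FB : Submodule L C) := by
      have h1 : (cubicFil L x y z (1 + n)).map (LinearMap.mulLeft L (A * B)) ≤ FA ⊓ FB := by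
        rintro _ ⟨v, hv, rfl⟩
        refine ⟨⟨B * v, cubicFil_mono (by omega) (hC.mul_mem hB hv), ?_⟩,
          ⟨A * v, cubicFil_mono (by omega) (hC.mul_mem hA hv), ?_⟩⟩ <;>
        simp only [LinearMap.mulLeft_apply] <;> ring
      have h2 : Function.Injective (LinearMap.mulLeft L (A * B)) :=
        fun u v h => mul_left_cancel₀ (mul_ne_zero hA0 hB0) h
      rw [← hC.finrank_cubicFil, (Submodule.equivMapOfInjective _ h2 _).finrank_eq]
      exact Submodule.finrank_mono h1
    have e1 := Submodule.finrank_sup_add_finrank_inf_eq FA FB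
    have e2 := Submodule.finrank_sup_add_finrank_inf_eq (FA ⊔ FB) (cubicBox L x y z m)
    have e3 := Submodule.finrank_mono (hC.cubicFil_le_of_le hs n)
    rw [hC.finrank_cubicFil] at e3
    rw [hC.finrank_cubicBox] at e2
    have c1 := card_expIdx (m + 1 + n)
    have c2 := card_expIdx (1 + n)
    have c3 := card_expIdx (2 * m + 1 + n)
    have e4 : Module.finrank L ((FA ⊔ FB) ⊓ cubicBox L x y z m : Submodule L C) = 0 := by
      change (expIdx (2 * m + 1 + n)).card ≤
        Module.finrank L ((FA ⊔ FB) ⊔ cubicBox L x y z m : Submodule L C) at e3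
      nlinarith
    rw [Submodule.finrank_eq_zero] at e4
    have : u ∈ (FA ⊔ FB) ⊓ cubicBox L x y z m := by
      refine ⟨?_, hu⟩
      change a * A + b * B = u at hab
      rw [← hab]
      exact add_mem (Submodule.mem_sup_left ⟨a, ha', by simp [mul_comm]⟩)
        (Submodule.mem_sup_right ⟨b, hb', by simp [mul_comm]⟩)
    rw [e4] at this
    exact Subtype.ext this
  let e := LinearEquiv.ofBijective φ ⟨hinj, hsurj⟩
  exact ⟨by rw [← e.finrank_eq, hC.finrank_cubicBox], Module.Finite.equiv e⟩

end IsCubicFrame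
end Frame

section MonomialIdeal

variable {L : Type*} {C : Type*} [Field L] [CommRing C] [Algebra L C] {x y z : C}

/-- The exponents lying over a set of pairs. -/
def expOver (T : Set (ℕ × ℕ)) : Set (ℕ × ℕ × Fin 3) := {e | (e.1, e.2.1) ∈ T}

variable (x y) in
/-- The ideal generated by the monomials in `x`, `y` with exponents in `T`. -/
def monIdeal (T : Set (ℕ × ℕ)) : Ideal C :=
  Ideal.span ((fun e : ℕ × ℕ => x ^ e.1 * y ^ e.2) '' T)

theorem cubicMon_mem_monIdeal {T : Set (ℕ × ℕ)} {e : ℕ × ℕ × Fin 3} (he : e ∈ expOver T) :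
    cubicMon x y z e ∈ monIdeal x y T :=
  Ideal.mul_mem_right _ _ (Ideal.subset_span ⟨_, he, rfl⟩)

theorem span_cubicMon_expOver_le (T : Set (ℕ × ℕ)) :
    Submodule.span L (cubicMon x y z '' expOver T) ≤ (monIdeal x y T).restrictScalars L := by
  rw [Submodule.span_le]
  rintro _ ⟨e, he, rfl⟩
  exact cubicMon_mem_monIdeal he

/-- A pair of degrees is in `T` as soon as a smaller one is. -/
def IsUpperPair (T : Set (ℕ × ℕ)) : Prop := ∀ e ∈ T, ∀ i j, (e.1 + i, e.2 + j) ∈ T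

namespace IsCubicFrame

theorem mul_mem_of_forall_cubicMon (hC : IsCubicFrame L x y z) {S : Submodule L C} (c : C)
    (h : ∀ e, c * cubicMon x y z e ∈ S) (v : C) : c * v ∈ S := by
  refine mul_mem_of_mem_span_cubicMon (s := Set.univ) c (fun e _ => h e) ?_
  rw [Set.image_univ]
  exact hC.span trivial

theorem mul_cubicMon_mem (hC : IsCubicFrame L x y z) {S : Submodule L C} (i j : ℕ) (l : Fin 3)
    (hS : ∀ i' j' l', cubicMon x y z (i + i', j + j', l') ∈ S) (v : C) :
    v * cubicMon x y z (i, j, l) ∈ S := by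
  have h1 : v * cubicMon x y z (i, j, l) = x ^ i * y ^ j * (z ^ (l : ℕ) * v) := by
    simp only [cubicMon]; ring
  rw [h1]
  refine hC.mul_mem_of_forall_cubicMon _ (fun e => ?_) _
  have : x ^ i * y ^ j * cubicMon x y z e = cubicMon x y z (i + e.1, j + e.2.1, e.2.2) := by
    simp only [cubicMon]; ring
  rw [this]
  exact hS _ _ _

theorem restrictScalars_monIdeal (hC : IsCubicFrame L x y z)
    {T : Set (ℕ × ℕ)} (hT : IsUpperPair T) :
    (monIdeal x y T).restrictScalars L = Submodule.span L (cubicMon x y z '' expOver T) := by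
  refine le_antisymm ?_ (span_cubicMon_expOver_le T)
  intro v hv
  rw [Submodule.restrictScalars_mem, monIdeal] at hv
  refine Submodule.span_induction ?_ (zero_mem _) (fun _ _ _ _ => add_mem) ?_ hv
  · rintro _ ⟨e, he, rfl⟩
    exact Submodule.subset_span ⟨(e.1, e.2, 0), he, by simp [cubicMon]⟩
  · intro c v _ hv
    refine mul_mem_of_mem_span_cubicMon _ ?_ hv
    rintro ⟨i, j, l⟩ he
    refine hC.mul_cubicMon_mem _ _ _ (fun i' j' l' => ?_) _
    exact Submodule.subset_span ⟨(i + i', j + j', l'), hT _ he i' j', rfl⟩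

theorem isCompl_span (hC : IsCubicFrame L x y z) {s t : Set (ℕ × ℕ × Fin 3)} (h : IsCompl s t) :
    IsCompl (Submodule.span L (cubicMon x y z '' s)) (Submodule.span L (cubicMon x y z '' t)) := by
  refine ⟨hC.li.disjoint_span_image h.disjoint, ?_⟩
  rw [codisjoint_iff, ← Submodule.span_union, ← Set.image_union,
    show s ∪ t = Set.univ from h.sup_eq_top, Set.image_univ, eq_top_iff]
  exact hC.span

theorem finrank_quotient_monIdeal (hC : IsCubicFrame L x y z)
    {T : Set (ℕ × ℕ)} (hT : IsUpperPair T) (t : Finset (ℕ × ℕ))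
    (ht : ∀ e, e ∈ t ↔ e ∉ T) :
    Module.finrank L (C ⧸ (monIdeal x y T).restrictScalars L) = 3 * t.card ∧
      FiniteDimensional L (C ⧸ (monIdeal x y T).restrictScalars L) := by
  let t' : Finset (ℕ × ℕ × Fin 3) :=
    (t ×ˢ (Finset.univ : Finset (Fin 3))).map (Equiv.prodAssoc _ _ _).toEmbedding
  have h1 : IsCompl (expOver T) (t' : Set (ℕ × ℕ × Fin 3)) := by
    have : (t' : Set (ℕ × ℕ × Fin 3)) = (expOver T)ᶜ := by
      ext ⟨i, j, l⟩
      simp [t', expOver, ht]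
    rw [this]
    exact isCompl_compl
  have h2 := hC.isCompl_span h1
  rw [← hC.restrictScalars_monIdeal hT] at h2
  have e := Submodule.quotientEquivOfIsCompl _ _ h2
  refine ⟨?_, ?_⟩
  · rw [e.finrank_eq, hC.finrank_span_image]
    simp [t', mul_comm]
  · have : FiniteDimensional L (Submodule.span L (cubicMon x y z '' (t' : Set (ℕ × ℕ × Fin 3)))) :=
      FiniteDimensional.span_of_finite _ ((Finset.finite_toSet _).image _)
    exact Module.Finite.equiv e.symm

end IsCubicFrame

/-- The exponents of the monomials in `(x ^ a, x * y, y ^ s)`. -/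
def hookSet (a s : ℕ) : Set (ℕ × ℕ) := {e | a ≤ e.1 ∨ s ≤ e.2 ∨ (1 ≤ e.1 ∧ 1 ≤ e.2)}

theorem isUpperPair_hookSet (a s : ℕ) : IsUpperPair (hookSet a s) := by
  rintro ⟨i, j⟩ he i' j'
  simp only [hookSet, Set.mem_ofPred_eq] at he ⊢
  omega

/-- The exponents of the monomials in `(x, y) * (x ^ 2, x * y, y ^ s)`. -/
def hookSet' (s : ℕ) : Set (ℕ × ℕ) := {e | 3 ≤ e.1 ∨ s + 1 ≤ e.2 ∨ (1 ≤ e.1 ∧ 1 ≤ e.2 ∧ 3 ≤ e.1 + e.2)}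

theorem isUpperPair_hookSet' (s : ℕ) : IsUpperPair (hookSet' s) := by
  rintro ⟨i, j⟩ he i' j'
  simp only [hookSet', Set.mem_ofPred_eq] at he ⊢
  omega

theorem exists_compl_hookSet {a s : ℕ} (ha : 1 ≤ a) (hs : 1 ≤ s ∨ a = 1) :
    ∃ t : Finset (ℕ × ℕ), (∀ e, e ∈ t ↔ e ∉ hookSet a s) ∧ t.card = s + a - 1 := by
  refine ⟨{0} ×ˢ Finset.range s ∪ Finset.Ico 1 a ×ˢ {0}, ?_, ?_⟩
  · rintro ⟨i, j⟩
    simp [hookSet]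
    omega
  · rw [Finset.card_union_of_disjoint]
    · simp; omega
    · rw [Finset.disjoint_left]
      rintro ⟨i, j⟩
      simp
      omega

theorem exists_compl_hookSet' {s : ℕ} (hs : 2 ≤ s) :
    ∃ t : Finset (ℕ × ℕ), (∀ e, e ∈ t ↔ e ∉ hookSet' s) ∧ t.card = s + 4 := by
  refine ⟨{0} ×ˢ Finset.range (s + 1) ∪ {(1, 0), (1, 1), (2, 0)}, ?_, ?_⟩
  · rintro ⟨i, j⟩
    simp [hookSet']
    omega
  · rw [Finset.card_union_of_disjoint]
    · simp
    · rw [Finset.disjoint_left]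
      rintro ⟨i, j⟩
      simp
      omega

end MonomialIdeal

section Residual

variable {L : Type*} {C : Type*} [Field L] [CommRing C] [Algebra L C] {x y z : C}

theorem finrank_ideal_add_finrank_quotient {R : Type*} [CommRing R] [Algebra L R]
    [FiniteDimensional L R] (I : Ideal R) :
    Module.finrank L I + Module.finrank L (R ⧸ I) = Module.finrank L R := by
  rw [add_comm]
  exact Submodule.finrank_quotient_add_finrank (I.restrictScalars L)

theorem finrank_inf_of_sup_eq_top {R : Type*} [CommRing R] [Algebra L R]
    [FiniteDimensional L R] (I J : Ideal R) (h : I ⊔ J = ⊤) :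
    Module.finrank L (I ⊓ J : Ideal R) + Module.finrank L (R ⧸ I) + Module.finrank L (R ⧸ J) =
      Module.finrank L R := by
  have h1 := finrank_ideal_add_finrank_quotient (L := L) I
  have h2 := finrank_ideal_add_finrank_quotient (L := L) J
  have h3 := Submodule.finrank_sup_add_finrank_inf_eq (I.restrictScalars L) (J.restrictScalars L)
  have h4 : I.restrictScalars L ⊔ J.restrictScalars L = ⊤ := by
    rw [← Submodule.restrictScalars_sup, h]
    rfl
  rw [h4, finrank_top] at h3
  change Module.finrank L R + Module.finrank L (I ⊓ J : Ideal R) =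
    Module.finrank L I + Module.finrank L J at h3
  omega

theorem finrank_quotient_map (I J : Ideal C) (h : I ≤ J) :
    Module.finrank L ((C ⧸ I) ⧸ J.map (Ideal.Quotient.mk I)) = Module.finrank L (C ⧸ J) :=
  (DoubleQuot.quotQuotEquivQuotOfLEₐ L h).toLinearEquiv.finrank_eq

theorem finrank_quotient_ker {R S : Type*} [CommRing R] [CommRing S] [Algebra L R] [Algebra L S]
    (f : R →ₐ[L] S) :
    Module.finrank L (R ⧸ RingHom.ker f) = Module.finrank L f.range :=
  (Ideal.quotientKerEquivRange f).toLinearEquiv.finrank_eq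

theorem finrank_quotient_mul_finrank {R N : Type*} [CommRing R] [Algebra L R] (q : Ideal R)
    [q.IsMaximal] [AddCommGroup N] [Module L N] [Module (R ⧸ q) N] [IsScalarTower L (R ⧸ q) N] :
    Module.finrank L (R ⧸ q) * Module.finrank (R ⧸ q) N = Module.finrank L N := by
  have : Module.Free (R ⧸ q) N := by
    let := Ideal.Quotient.field q
    infer_instance
  have : Module.Free L (R ⧸ q) := inferInstance
  exact Module.finrank_mul_finrank L (R ⧸ q) N

/-- The codimension of `q J` in `J` is a multiple of the degree of the residue field of `q`. -/
theorem exists_finrank_smul {R : Type*} [CommRing R] [Algebra L R] [FiniteDimensional L R]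
    (q J : Ideal R) [q.IsMaximal] (hJ : (q • ⊤ : Submodule R J) ≠ ⊤) :
    ∃ J' : Ideal R, ∃ ρ, 1 ≤ ρ ∧
      Module.finrank L J' + Module.finrank L (R ⧸ q) * ρ = Module.finrank L J := by
  have hfJ' : Module.finrank L ((q • ⊤ : Submodule R J).map J.subtype) =
      Module.finrank L (q • ⊤ : Submodule R J) :=
    ((Submodule.equivMapOfInjective _ J.injective_subtype _).restrictScalars L).finrank_eq.symm
  have hsum : Module.finrank L (J ⧸ (q • ⊤ : Submodule R J)) +
      Module.finrank L (q • ⊤ : Submodule R J) = Module.finrank L J :=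
    Submodule.finrank_quotient_add_finrank ((q • ⊤ : Submodule R J).restrictScalars L)
  have hst : IsScalarTower L (R ⧸ q) (J ⧸ (q • ⊤ : Submodule R J)) := inferInstance
  have htow := finrank_quotient_mul_finrank (L := L) q (N := J ⧸ (q • ⊤ : Submodule R J))
  refine ⟨(q • ⊤ : Submodule R J).map J.subtype,
    Module.finrank (R ⧸ q) (J ⧸ (q • ⊤ : Submodule R J)), ?_, by rw [hfJ', htow, add_comm, hsum]⟩
  rw [Nat.one_le_iff_ne_zero]
  intro h
  rw [h, mul_zero] at htow
  have : Module.Finite L (J ⧸ (q • ⊤ : Submodule R J)) :=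
    inferInstanceAs (Module.Finite L (J ⧸ (q • ⊤ : Submodule R J).restrictScalars L))
  have h0 : Module.finrank L (J ⧸ (q • ⊤ : Submodule R J)) = 0 := htow.symm
  have hsub : Subsingleton (J ⧸ (q • ⊤ : Submodule R J)) :=
    (Module.finrank_zero_iff (R := L) (M := J ⧸ (q • ⊤ : Submodule R J))).1 h0
  exact hJ (Submodule.Quotient.subsingleton_iff.1 hsub)

namespace IsCubicFrame

/-- The residual of the image of `ev` in the complete intersection `A = B = 0`, inside the ideal
`(x ^ a, x * y, y ^ s)`. -/
theorem exists_residual (hC : IsCubicFrame L x y z)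
    {m a s d : ℕ} (ha : 1 ≤ a) (hs : 1 ≤ s ∨ a = 1) {A B : C}
    [FiniteDimensional L (C ⧸ Ideal.span {A, B})]
    (hAB : Module.finrank L (C ⧸ Ideal.span {A, B}) = 3 * m ^ 2)
    (hA : A ∈ monIdeal x y (hookSet a s)) (hB : B ∈ monIdeal x y (hookSet a s))
    {S : Type*} [CommRing S] [Algebra L S] (ev : C →ₐ[L] S) (evA : ev A = 0) (evB : ev B = 0)
    (hd : Module.finrank L ev.range = d)
    (hev : ∀ c, ∃ w ∈ monIdeal x y (hookSet a s), ev w = ev c) :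
    ∃ P : Ideal (C ⧸ Ideal.span {A, B}),
      (monIdeal x y (hookSet a s)).map (Ideal.Quotient.mk (Ideal.span {A, B})) ⊔ P = ⊤ ∧
      Module.finrank L ((monIdeal x y (hookSet a s)).map
        (Ideal.Quotient.mk (Ideal.span {A, B})) ⊓ P : Ideal _) + 3 * (s + a - 1) + d =
        3 * m ^ 2 := by
  have hle : Ideal.span {A, B} ≤ monIdeal x y (hookSet a s) := by
    rw [Ideal.span_le]
    rintro _ (rfl | rfl)
    exacts [hA, hB]
  have hev0 : ∀ v ∈ Ideal.span {A, B}, ev v = 0 := by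
    intro v hv
    obtain ⟨a, b, rfl⟩ := Ideal.mem_span_pair.1 hv
    simp [evA, evB]
  let ev' : (C ⧸ Ideal.span {A, B}) →ₐ[L] S := Ideal.Quotient.liftₐ _ ev hev0
  have hsup : (monIdeal x y (hookSet a s)).map (Ideal.Quotient.mk (Ideal.span {A, B})) ⊔
      RingHom.ker ev' = ⊤ := by
    rw [eq_top_iff]
    intro v _
    obtain ⟨c, rfl⟩ := Ideal.Quotient.mk_surjective v
    obtain ⟨w, hw, hwc⟩ := hev c
    refine Submodule.mem_sup.2 ⟨Ideal.Quotient.mk _ w, Ideal.mem_map_of_mem _ hw,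
      Ideal.Quotient.mk _ (c - w), ?_, by rw [← map_add, add_sub_cancel]⟩
    change ev (c - w) = 0
    rw [map_sub, hwc, sub_self]
  refine ⟨RingHom.ker ev', hsup, ?_⟩
  have h1 := finrank_inf_of_sup_eq_top (L := L) _ _ hsup
  rw [finrank_quotient_map _ _ hle, finrank_quotient_ker, hAB] at h1
  obtain ⟨t, ht, htc⟩ := exists_compl_hookSet ha hs
  have h2 : Module.finrank L (C ⧸ monIdeal x y (hookSet a s)) = 3 * t.card :=
    (hC.finrank_quotient_monIdeal (isUpperPair_hookSet a s) t ht).1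
  have h3 : ev'.range = ev.range := by
    ext v
    simp only [AlgHom.mem_range]
    constructor
    · rintro ⟨u, rfl⟩
      obtain ⟨c, rfl⟩ := Ideal.Quotient.mk_surjective u
      exact ⟨c, rfl⟩
    · rintro ⟨c, rfl⟩
      exact ⟨Ideal.Quotient.mk _ c, rfl⟩
  rw [h3, hd, h2, htc] at h1
  exact h1

/-- The minimal number of generators of `(x ^ 2, x * y, y ^ s)` at the origin is three. -/
theorem not_monIdeal_le (hC : IsCubicFrame L x y z) {s : ℕ} (hs : 2 ≤ s) {A B : C}
    (hA : A ∈ monIdeal x y (hookSet 2 s)) (hB : B ∈ monIdeal x y (hookSet 2 s)) :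
    ¬ monIdeal x y (hookSet 2 s) ≤ Ideal.span {x, y} * monIdeal x y (hookSet 2 s) ⊔
      Ideal.span {A, B} := by
  intro hle
  set N := (monIdeal x y (hookSet 2 s)).restrictScalars L
  set N' := (monIdeal x y (hookSet' s)).restrictScalars L
  obtain ⟨t, ht, htc⟩ := exists_compl_hookSet (a := 2) (s := s) (by omega) (by omega)
  obtain ⟨t', ht', htc'⟩ := exists_compl_hookSet' hs
  obtain ⟨f1, -⟩ := hC.finrank_quotient_monIdeal (isUpperPair_hookSet 2 s) t ht
  obtain ⟨f2, f3⟩ := hC.finrank_quotient_monIdeal (isUpperPair_hookSet' s) t' ht'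
  have hNN : N = Submodule.span L (cubicMon x y z '' expOver (hookSet 2 s)) :=
    hC.restrictScalars_monIdeal (isUpperPair_hookSet 2 s)
  have hcorner : ∀ v ∈ N, ∀ i j : ℕ, 1 ≤ i + j → x ^ i * y ^ j * v ∈ N' := by
    intro v hv i j hij
    rw [hNN] at hv
    refine mul_mem_of_mem_span_cubicMon _ ?_ hv
    intro e he
    have h1 : x ^ i * y ^ j * cubicMon x y z e = cubicMon x y z (i + e.1, j + e.2.1, e.2.2) := by
      simp only [cubicMon]; ring
    rw [h1]
    apply cubicMon_mem_monIdeal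
    simp only [expOver, hookSet, hookSet', Set.mem_ofPred_eq] at he ⊢
    omega
  let g : Fin 3 ⊕ Fin 3 → C := Sum.elim (fun l => z ^ (l : ℕ) * A) (fun l => z ^ (l : ℕ) * B)
  set G := Submodule.span L (Set.range g)
  have hmul : ∀ v ∈ N, (∀ l : Fin 3, z ^ (l : ℕ) * v ∈ G) → ∀ u, u * v ∈ N' ⊔ G := by
    intro v hv hl u
    rw [mul_comm]
    refine hC.mul_mem_of_forall_cubicMon _ ?_ u
    rintro ⟨i, j, l⟩
    have h1 : v * cubicMon x y z (i, j, l) = z ^ (l : ℕ) * (x ^ i * y ^ j * v) := by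
      simp only [cubicMon]; ring
    rw [h1]
    by_cases hij : 1 ≤ i + j
    · exact Submodule.mem_sup_left (Ideal.mul_mem_left _ _ (hcorner v hv i j hij))
    · obtain ⟨rfl, rfl⟩ : i = 0 ∧ j = 0 := by omega
      simpa using Submodule.mem_sup_right (hl l)
  have hle' : N ≤ N' ⊔ G := by
    intro v hv
    obtain ⟨q, hq, r, hr, rfl⟩ := Submodule.mem_sup.1 (hle hv)
    refine add_mem ?_ ?_
    · refine Submodule.mem_sup_left ?_
      have : Ideal.span {x, y} * monIdeal x y (hookSet 2 s) ≤ monIdeal x y (hookSet' s) := by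
        rw [Ideal.mul_le]
        intro p hp w hw
        obtain ⟨a, b, rfl⟩ := Ideal.mem_span_pair.1 hp
        have e1 := hcorner w hw 1 0 le_rfl
        have e2 := hcorner w hw 0 1 le_rfl
        simp only [pow_one, pow_zero, mul_one, one_mul] at e1 e2
        rw [add_mul, mul_assoc, mul_assoc]
        exact add_mem (Ideal.mul_mem_left _ _ e1) (Ideal.mul_mem_left _ _ e2)
      exact this hq
    · obtain ⟨a, b, rfl⟩ := Ideal.mem_span_pair.1 hr
      exact add_mem (hmul A hA (fun l => Submodule.subset_span ⟨Sum.inl l, rfl⟩) a)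
        (hmul B hB (fun l => Submodule.subset_span ⟨Sum.inr l, rfl⟩) b)
  have hN' : N' ≤ N := by
    have h0 := hC.restrictScalars_monIdeal (isUpperPair_hookSet' s)
    rw [hNN]
    refine h0.le.trans (Submodule.span_mono (Set.image_mono ?_))
    intro e he
    simp only [expOver, hookSet, hookSet', Set.mem_ofPred_eq] at he ⊢
    omega
  have h1 : Module.finrank L (N.map N'.mkQ) ≤ 6 := by
    have e1 : N.map N'.mkQ ≤ G.map N'.mkQ := by
      refine (Submodule.map_mono hle').trans ?_
      rw [Submodule.map_sup, Submodule.mkQ_map_self, bot_sup_eq]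
    have : FiniteDimensional L G := FiniteDimensional.span_of_finite _ (Set.finite_range _)
    refine (Submodule.finrank_mono e1).trans ((Submodule.finrank_map_le _ _).trans ?_)
    exact (finrank_range_le_card g).trans (by simp)
  have h2 := Submodule.finrank_quotient_add_finrank (N.map N'.mkQ)
  rw [(Submodule.quotientQuotientEquivQuotient N' N hN').finrank_eq, f1, f2, htc, htc'] at h2
  omega

theorem exists_residual' (hC : IsCubicFrame L x y z) {m s d : ℕ} (hs : 2 ≤ s) {A B : C}
    [FiniteDimensional L (C ⧸ Ideal.span {A, B})]
    (hAB : Module.finrank L (C ⧸ Ideal.span {A, B}) = 3 * m ^ 2)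
    (hA : A ∈ monIdeal x y (hookSet 2 s)) (hB : B ∈ monIdeal x y (hookSet 2 s))
    (hmax : (Ideal.span {x, y}).IsMaximal)
    {S : Type*} [CommRing S] [Algebra L S] (ev : C →ₐ[L] S) (evA : ev A = 0) (evB : ev B = 0)
    (hd : Module.finrank L ev.range = d)
    (hev : ∀ c, ∃ w ∈ monIdeal x y (hookSet 2 s), ev w = ev c) :
    ∃ J : Ideal (C ⧸ Ideal.span {A, B}), ∃ ρ, 1 ≤ ρ ∧
      Module.finrank L J + 3 * ρ + 3 * (s + 1) + d = 3 * m ^ 2 := by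
  obtain ⟨P, hP, hfin⟩ := hC.exists_residual (by omega) (by omega) hAB hA hB ev evA evB hd hev
  set R := C ⧸ Ideal.span {A, B}
  set π := Ideal.Quotient.mk (Ideal.span {A, B})
  set W := (monIdeal x y (hookSet 2 s)).map π
  set q := (Ideal.span {x, y}).map π
  have hIq : monIdeal x y (hookSet 2 s) ≤ Ideal.span {x, y} := by
    rw [monIdeal, Ideal.span_le]
    rintro _ ⟨⟨i, j⟩, he, rfl⟩
    simp only [hookSet, Set.mem_ofPred_eq] at he
    have hx : x ∈ Ideal.span {x, y} := Ideal.subset_span (by simp)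
    have hy : y ∈ Ideal.span {x, y} := Ideal.subset_span (by simp)
    by_cases hi : i = 0
    · exact Ideal.mul_mem_left _ _ (Ideal.pow_mem_of_mem _ hy _ (by omega))
    · exact Ideal.mul_mem_right _ _ (Ideal.pow_mem_of_mem _ hx _ (by omega))
  have hker : Ideal.span {A, B} ≤ Ideal.span {x, y} := by
    rw [Ideal.span_le]
    rintro _ (rfl | rfl)
    exacts [hIq hA, hIq hB]
  have hWq : W ≤ q := Ideal.map_mono hIq
  have hfq : Module.finrank L (R ⧸ q) = 3 := by
    rw [finrank_quotient_map _ _ hker]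
    have h1 : Ideal.span {x, y} = monIdeal x y (hookSet 1 1) := by
      refine le_antisymm ?_ ?_
      · rw [Ideal.span_le]
        rintro _ (rfl | rfl)
        · exact Ideal.subset_span ⟨(1, 0), by simp [hookSet], by simp⟩
        · exact Ideal.subset_span ⟨(0, 1), by simp [hookSet], by simp⟩
      · rw [monIdeal, Ideal.span_le]
        rintro _ ⟨⟨i, j⟩, he, rfl⟩
        simp only [hookSet, Set.mem_ofPred_eq] at he
        have hx : x ∈ Ideal.span {x, y} := Ideal.subset_span (by simp)
        have hy : y ∈ Ideal.span {x, y} := Ideal.subset_span (by simp)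
        by_cases hi : i = 0
        · exact Ideal.mul_mem_left _ _ (Ideal.pow_mem_of_mem _ hy _ (by omega))
        · exact Ideal.mul_mem_right _ _ (Ideal.pow_mem_of_mem _ hx _ (by omega))
    obtain ⟨t, ht, htc⟩ := exists_compl_hookSet (a := 1) (s := 1) (by omega) (by omega)
    have h2 := (hC.finrank_quotient_monIdeal (isUpperPair_hookSet 1 1) t ht).1
    rw [h1]
    rw [htc] at h2
    exact h2
  have hqmax : q.IsMaximal := by
    refine (Ideal.map_eq_top_or_isMaximal_of_surjective π Ideal.Quotient.mk_surjective
      hmax).resolve_left fun h => ?_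
    have : Subsingleton (R ⧸ q) := Ideal.Quotient.subsingleton_iff.2 h
    rw [Module.finrank_zero_of_subsingleton] at hfq
    omega
  have hne : W ≠ q * W := by
    intro h
    refine hC.not_monIdeal_le hs hA hB ?_
    rw [← Ideal.map_mul] at h
    have h1 : monIdeal x y (hookSet 2 s) ≤ Ideal.comap π W := Ideal.le_comap_map
    rw [h, Ideal.comap_map_of_surjective _ Ideal.Quotient.mk_surjective] at h1
    have h2 : Ideal.comap π ⊥ = Ideal.span {A, B} := Ideal.mk_ker
    rwa [h2] at h1
  set J := W ⊓ P
  have hJ : (q • ⊤ : Submodule R J) ≠ ⊤ := by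
    intro h
    have h1 : q * J = J := by
      have h2 := congrArg (Submodule.map J.subtype) h
      rwa [Submodule.map_smul'', Submodule.map_top, Submodule.range_subtype] at h2
    refine hne (le_antisymm ?_ Ideal.mul_le_right)
    have htop : q ⊔ P = ⊤ := top_le_iff.1 (hP ▸ sup_le_sup_right hWq P)
    intro w hw
    obtain ⟨a, ha, p, hp, hap⟩ := Submodule.mem_sup.1
      ((Ideal.eq_top_iff_one _).1 htop)
    rw [← one_mul w, ← hap, add_mul]
    refine add_mem (Ideal.mul_mem_mul ha hw) ?_
    have h3 : p * w ∈ J := ⟨Ideal.mul_mem_left _ _ hw, Ideal.mul_mem_right _ _ hp⟩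
    rw [← h1] at h3
    exact Ideal.mul_mono_right inf_le_left h3
  obtain ⟨J', ρ, hρ, h⟩ := exists_finrank_smul (L := L) q J hJ
  refine ⟨J', ρ, hρ, ?_⟩
  rw [hfq] at h
  simp only [show s + 2 - 1 = s + 1 by omega] at hfin
  omega

end IsCubicFrame

end Residual

section CubicRing

open MvPolynomial

theorem sum_apply_of_isHomogeneous {k : Type*} [CommRing k] {F : MvPolynomial (Fin 4) k}
    (hF : F.IsHomogeneous 3) {m : Fin 4 →₀ ℕ} (hm : m ∈ F.support) :
    m 0 + m 1 + m 2 + m 3 = 3 := by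
  have h := hF (mem_support_iff.1 hm)
  rw [Finsupp.weight_apply, Finsupp.sum_fintype _ _ (by simp)] at h
  simpa [Fin.sum_univ_four] using h

/-- The terms of a cubic form other than the cube of the last variable. -/
noncomputable def lowerSupport {k : Type*} [CommRing k] (F : MvPolynomial (Fin 4) k) : Finset (Fin 4 →₀ ℕ) :=
  F.support.erase (Finsupp.single 3 3)

theorem le_of_mem_lowerSupport {k : Type*} [CommRing k] {F : MvPolynomial (Fin 4) k}
    (hF : F.IsHomogeneous 3) {m : Fin 4 →₀ ℕ} (hm : m ∈ lowerSupport F) :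
    m 1 + m 2 + m 3 ≤ 3 ∧ m 3 < 3 := by
  rw [lowerSupport, Finset.mem_erase] at hm
  have h := sum_apply_of_isHomogeneous hF hm.2
  refine ⟨by omega, ?_⟩
  by_contra h3
  refine hm.1 ?_
  ext i
  fin_cases i <;> simp <;> omega

theorem aeval_eq_pow_add_sum {k : Type*} [CommRing k] {F : MvPolynomial (Fin 4) k}
    (h1 : coeff (Finsupp.single 3 3) F = 1) {S : Type*} [CommRing S] [Algebra k S] (x y z : S) :
    aeval ![1, x, y, z] F =
      z ^ 3 + ∑ m ∈ lowerSupport F, coeff m F • (x ^ m 1 * y ^ m 2 * z ^ m 3) := by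
  by_cases hk : Nontrivial k
  · have hmem : Finsupp.single 3 3 ∈ F.support := by
      rw [mem_support_iff, h1]; exact one_ne_zero
    rw [aeval_def, eval₂_eq', ← Finset.add_sum_erase _ _ hmem, lowerSupport]
    congr 1
    · simp [h1, Fin.prod_univ_four]
    · refine Finset.sum_congr rfl fun m _ => ?_
      simp [Fin.prod_univ_four, Algebra.smul_def, mul_assoc]
  · rw [not_nontrivial_iff_subsingleton] at hk
    have : Subsingleton S := by
      refine subsingleton_of_zero_eq_one ?_
      rw [← map_one (algebraMap k S), Subsingleton.elim (1 : k) 0, map_zero]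
    exact Subsingleton.elim _ _

variable {k : Type*} [Field k] (F : MvPolynomial (Fin 4) k) (L : Type*) [Field L] [Algebra k L]

/-- The polynomial `F (1, x, y, Z)` in one variable `Z`. -/
noncomputable def cubicPoly : Polynomial (MvPolynomial (Fin 2) L) :=
  aeval ![1, Polynomial.C (X 0), Polynomial.C (X 1), Polynomial.X] F

/-- The coordinate ring of the affine part of the cubic surface. -/
abbrev CubicRing : Type _ := AdjoinRoot (cubicPoly F L)

namespace CubicRing

/-- The first coordinate function. -/
noncomputable def x : CubicRing F L := algebraMap (MvPolynomial (Fin 2) L) _ (X 0)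

/-- The second coordinate function. -/
noncomputable def y : CubicRing F L := algebraMap (MvPolynomial (Fin 2) L) _ (X 1)

/-- The third coordinate function. -/
noncomputable def z : CubicRing F L := AdjoinRoot.root _

theorem aeval_eq_zero : aeval ![1, x F L, y F L, z F L] F = 0 := by
  let φ : Polynomial (MvPolynomial (Fin 2) L) →ₐ[k] CubicRing F L :=
    { AdjoinRoot.mk (cubicPoly F L) with
      commutes' := fun r => rfl }
  have h : φ (aeval ![1, Polynomial.C (X 0), Polynomial.C (X 1), Polynomial.X] F) = 0 :=
    AdjoinRoot.mk_self
  rw [comp_aeval_apply] at h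
  rw [← h]
  congr 2
  ext i
  fin_cases i
  · exact (map_one φ).symm
  · rfl
  · rfl
  · rfl

variable {F L}

section Lift

variable {S : Type*} [CommRing S] [Algebra L S] [Algebra k S] [IsScalarTower k L S]

theorem exists_lift (a b c : S) (h : aeval ![1, a, b, c] F = 0) :
    ∃ f : CubicRing F L →ₐ[L] S, f (x F L) = a ∧ f (y F L) = b ∧ f (z F L) = c := by
  let i : MvPolynomial (Fin 2) L →ₐ[L] S := aeval ![a, b]
  have hi : (cubicPoly F L).eval₂ (i : MvPolynomial (Fin 2) L →+* S) c = 0 := by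
    let φ : Polynomial (MvPolynomial (Fin 2) L) →ₐ[k] S :=
      { Polynomial.eval₂RingHom (i : MvPolynomial (Fin 2) L →+* S) c with
        commutes' := fun r => by
          rw [IsScalarTower.algebraMap_apply k L S]
          change Polynomial.eval₂ _ _ (Polynomial.C (MvPolynomial.C (algebraMap k L r))) = _
          rw [Polynomial.eval₂_C]
          exact aeval_C _ _ }
    change φ (cubicPoly F L) = 0
    rw [cubicPoly, comp_aeval_apply, ← h]
    congr 2
    ext j
    fin_cases j
    · exact map_one φ
    · change Polynomial.eval₂ _ _ _ = _
      simp [i]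
    · change Polynomial.eval₂ _ _ _ = _
      simp [i]
    · change Polynomial.eval₂ _ _ _ = _
      simp
  refine ⟨AdjoinRoot.liftAlgHom _ i c hi, ?_, ?_, ?_⟩
  · exact (AdjoinRoot.lift_of hi).trans (by simp [i])
  · exact (AdjoinRoot.lift_of hi).trans (by simp [i])
  · exact AdjoinRoot.lift_root hi

end Lift

theorem cubicPoly_eq (h1 : coeff (Finsupp.single 3 3) F = 1) :
    cubicPoly F L = Polynomial.X ^ 3 + ∑ m ∈ lowerSupport F, coeff m F •
      (Polynomial.C (X 0) ^ m 1 * Polynomial.C (X 1) ^ m 2 * Polynomial.X ^ m 3) :=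
  aeval_eq_pow_add_sum h1 _ _ _

theorem monic_natDegree (hF : F.IsHomogeneous 3) (h1 : coeff (Finsupp.single 3 3) F = 1) :
    (cubicPoly F L).Monic ∧ (cubicPoly F L).natDegree = 3 := by
  have hdeg : (∑ m ∈ lowerSupport F, coeff m F •
      (Polynomial.C (X 0 : MvPolynomial (Fin 2) L) ^ m 1 * Polynomial.C (X 1) ^ m 2 *
        Polynomial.X ^ m 3)).degree < ((3 : ℕ) : WithBot ℕ) := by
    rw [← Polynomial.mem_degreeLT]
    refine sum_mem fun m hm => ?_
    have h2 : coeff m F • (Polynomial.C (X 0 : MvPolynomial (Fin 2) L) ^ m 1 *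
        Polynomial.C (X 1) ^ m 2 * Polynomial.X ^ m 3) =
        Polynomial.C (coeff m F • (X 0 ^ m 1 * X 1 ^ m 2)) * Polynomial.X ^ m 3 := by
      rw [← Polynomial.smul_C, smul_mul_assoc]
      simp
    rw [Polynomial.mem_degreeLT, h2]
    refine (Polynomial.degree_C_mul_X_pow_le _ _).trans_lt ?_
    exact_mod_cast (le_of_mem_lowerSupport hF hm).2
  rw [cubicPoly_eq h1]
  refine ⟨Polynomial.monic_X_pow_add hdeg, ?_⟩
  rw [Polynomial.natDegree_add_eq_left_of_degree_lt (by rwa [Polynomial.degree_X_pow]),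
    Polynomial.natDegree_X_pow]

theorem isCubicFrame (hF : F.IsHomogeneous 3) (h1 : coeff (Finsupp.single 3 3) F = 1) :
    IsCubicFrame L (x F L) (y F L) (z F L) := by
  obtain ⟨hm, hd⟩ := monic_natDegree (L := L) hF h1
  let b1 := MvPolynomial.basisMonomials (Fin 2) L
  let b2 := (AdjoinRoot.powerBasis' hm).basis
  let e1 : (Fin 2 →₀ ℕ) ≃ ℕ × ℕ := Finsupp.equivFunOnFinite.trans (finTwoArrowEquiv ℕ)
  let e2 : Fin (AdjoinRoot.powerBasis' hm).dim ≃ Fin 3 := finCongr hd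
  let e : (Fin 2 →₀ ℕ) × Fin (AdjoinRoot.powerBasis' hm).dim ≃ ℕ × ℕ × Fin 3 :=
    (e1.prodCongr e2).trans (Equiv.prodAssoc _ _ _)
  let b := (b1.smulTower b2).reindex e
  have hb : ⇑b = cubicMon (x F L) (y F L) (z F L) := by
    ext ⟨i, j, l⟩
    have : e.symm (i, j, l) = (e1.symm (i, j), e2.symm l) := rfl
    simp only [b, Module.Basis.reindex_apply, this, Module.Basis.smulTower_apply]
    have h3 : b1 (e1.symm (i, j)) = X 0 ^ i * X 1 ^ j := by
      simp only [b1, coe_basisMonomials]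
      rw [monomial_eq, Finsupp.prod_fintype _ _ (by simp)]
      simp [e1, finTwoArrowEquiv, Fin.prod_univ_two]
    have h4 : b2 (e2.symm l) = z F L ^ (l : ℕ) := by
      simp only [b2, PowerBasis.basis_eq_pow]
      rfl
    rw [h3, h4, Algebra.smul_def, map_mul, map_pow, map_pow]
    rfl
  refine ⟨hb ▸ b.linearIndependent, hb ▸ b.span_eq.ge, ?_⟩
  have h := aeval_eq_zero F L
  rw [aeval_eq_pow_add_sum h1] at h
  rw [eq_neg_of_add_eq_zero_left h]
  refine neg_mem (sum_mem fun m hm => ?_)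
  obtain ⟨h3, h4⟩ := le_of_mem_lowerSupport hF hm
  rw [← algebraMap_smul L]
  exact Submodule.smul_mem _ _ (cubicMon_mem_cubicFil (e := (m 1, m 2, ⟨m 3, h4⟩)) h3)

theorem isDomain (hF : F.IsHomogeneous 3) (h1 : coeff (Finsupp.single 3 3) F = 1)
    (h : ∀ a : MvPolynomial (Fin 2) L, aeval ![1, X 0, X 1, a] F ≠ 0) :
    IsDomain (CubicRing F L) := by
  obtain ⟨hm, hd⟩ := monic_natDegree (L := L) hF h1
  have hirr : Irreducible (cubicPoly F L) := by
    rw [hm.irreducible_iff_roots_eq_zero_of_degree_le_three (by omega) (by omega),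
      Multiset.eq_zero_iff_forall_notMem]
    intro a ha
    rw [Polynomial.mem_roots hm.ne_zero, Polynomial.IsRoot.def] at ha
    refine h a ?_
    rw [← ha]
    let φ : Polynomial (MvPolynomial (Fin 2) L) →ₐ[k] MvPolynomial (Fin 2) L :=
      (Polynomial.aeval a).restrictScalars k
    have h2 : φ (cubicPoly F L) = (cubicPoly F L).eval a := by
      simp [φ, Polynomial.aeval_def, Polynomial.eval₂_eq_eval_map]
    rw [← h2, cubicPoly, comp_aeval_apply]
    congr 2
    ext j
    fin_cases j <;> simp [φ]
  have : Fact (Irreducible (cubicPoly F L)) := ⟨hirr⟩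
  exact AdjoinRoot.isDomain_of_prime hirr.prime

end CubicRing

end CubicRing

section Generic

set_option linter.unusedSectionVars false

open Matrix

/-- The combinatorial data from which two curves through a given set of points are constructed:
a choice of columns, two linear combinations of monomials, structure constants, and a right inverse
of the matrix expressing that the two curves meet properly. -/
structure GenericData (k ι μ N X R : Type*) where
  /-- A choice of columns. -/
  c : ι → μ
  /-- The first linear combination. -/
  gA : μ → k
  /-- The second linear combination. -/
  gB : μ → k
  /-- Structure constants. -/
  T : N → μ → R → k
  /-- Coefficients of the remainders. -/
  J : X → R → k
  /-- A right inverse. -/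
  Y : Matrix (N ⊕ N ⊕ X) R k

variable {k ι μ N X R : Type*} [Field k] [Fintype ι] [DecidableEq ι] [Fintype μ] [DecidableEq μ]
  [Fintype N] [Fintype X] [Fintype R] [DecidableEq R]
  {S : Type*} [CommRing S] [Algebra k S] {S' : Type*} [CommRing S'] [Algebra k S']

namespace GenericData

variable (G : GenericData k ι μ N X R)

/-- The minor on the chosen columns. -/
def minor (E : Matrix ι μ S) : S := (E.submatrix id G.c).det

/-- The inclusion of the chosen columns. -/
def incl (S : Type*) [CommRing S] : Matrix μ ι S := fun j i => if j = G.c i then 1 else 0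

/-- A vector in the kernel of `E`, equal to `g` up to a scalar and up to the chosen columns. -/
def kerVec (g : μ → k) (E : Matrix ι μ S) : μ → S :=
  G.minor E • (fun j => algebraMap k S (g j)) -
    G.incl S *ᵥ ((E.submatrix id G.c).adjugate *ᵥ (E *ᵥ fun j => algebraMap k S (g j)))

/-- The matrix of the multiples of two combinations of monomials, and of remainders. -/
def syz (A B : μ → S) (D : S) : Matrix R (N ⊕ N ⊕ X) S := fun ρ =>
  Sum.elim (fun ν => ∑ j, A j * algebraMap k S (G.T ν j ρ))
    (Sum.elim (fun ν => ∑ j, B j * algebraMap k S (G.T ν j ρ))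
      (fun υ => D * algebraMap k S (G.J υ ρ)))

/-- The determinant whose nonvanishing ensures that the construction works. -/
def det (E : Matrix ι μ S) : S :=
  G.minor E * (G.syz (G.kerVec G.gA E) (G.kerVec G.gB E) (G.minor E) *
    G.Y.map (algebraMap k S)).det

theorem mul_incl (E : Matrix ι μ S) : E * G.incl S = E.submatrix id G.c := by
  ext i j
  simp [Matrix.mul_apply, incl]

theorem mulVec_kerVec (g : μ → k) (E : Matrix ι μ S) : E *ᵥ G.kerVec g E = 0 := by
  rw [kerVec, mulVec_sub, mulVec_mulVec, mul_incl, mulVec_mulVec, mul_adjugate, mulVec_smul,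
    smul_mulVec, one_mulVec, minor, sub_self]

theorem kerVec_of_mulVec_eq_zero (g : μ → k) (E : Matrix ι μ S)
    (h : (E *ᵥ fun j => algebraMap k S (g j)) = 0) :
    G.kerVec g E = G.minor E • fun j => algebraMap k S (g j) := by
  rw [kerVec, h, mulVec_zero, mulVec_zero, sub_zero]

section Map

variable (f : S →ₐ[k] S')

theorem map_minor (E : Matrix ι μ S) : f (G.minor E) = G.minor (E.map f) := by
  rw [minor, AlgHom.map_det]
  rfl

theorem map_kerVec (g : μ → k) (E : Matrix ι μ S) (j : μ) :
    f (G.kerVec g E j) = G.kerVec g (E.map f) j := by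
  have h1 : (fun i => f ((E *ᵥ fun j => algebraMap k S (g j)) i)) =
      (E.map f *ᵥ fun j => algebraMap k S' (g j)) := by
    ext i
    simp [mulVec, dotProduct]
  have h2 : ((E.submatrix id G.c).adjugate).map f = ((E.map f).submatrix id G.c).adjugate := by
    have := RingHom.map_adjugate (f : S →+* S') (E.submatrix id G.c)
    exact this
  simp only [kerVec, Pi.sub_apply, Pi.smul_apply, map_sub, smul_eq_mul, map_mul, map_minor,
    AlgHom.commutes]
  congr 1
  rw [← h1, ← h2]
  simp only [mulVec, dotProduct, incl, map_sum, map_mul, Matrix.map_apply]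
  refine Finset.sum_congr rfl fun i _ => ?_
  split_ifs <;> simp

theorem map_det (E : Matrix ι μ S) : f (G.det E) = G.det (E.map f) := by
  rw [det, map_mul, map_minor, AlgHom.map_det, det]
  congr 2
  ext ρ n
  simp only [AlgHom.mapMatrix_apply, Matrix.map_apply, Matrix.mul_apply, map_sum, map_mul,
    AlgHom.commutes]
  refine Finset.sum_congr rfl fun n _ => ?_
  congr 1
  rcases n with n | n | n <;> simp [syz, map_kerVec, map_minor]

end Map

section Mul

variable (V : Matrix ι ι S) (E : Matrix ι μ S)

theorem minor_mul : G.minor (V * E) = V.det * G.minor E := by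
  rw [minor, ← mul_incl, Matrix.mul_assoc, det_mul, mul_incl, minor]

theorem kerVec_mul (g : μ → k) : G.kerVec g (V * E) = V.det • G.kerVec g E := by
  rw [kerVec, kerVec, smul_sub, minor_mul, smul_smul]
  congr 1
  rw [← mul_incl, Matrix.mul_assoc, mul_incl, adjugate_mul_distrib, ← mulVec_mulVec,
    mulVec_mulVec _ V.adjugate, ← Matrix.mul_assoc, adjugate_mul, smul_mul, Matrix.one_mul,
    smul_mulVec, mulVec_smul, mulVec_smul]

theorem syz_smul (A B : μ → S) (D t : S) :
    G.syz (t • A) (t • B) (t * D) = t • G.syz A B D := by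
  ext ρ n
  rcases n with n | n | n <;> simp [syz, Finset.mul_sum, mul_assoc]

theorem det_mul : G.det (V * E) = V.det ^ (Fintype.card R + 1) * G.det E := by
  rw [det, kerVec_mul, kerVec_mul, minor_mul, syz_smul, smul_mul, det_smul, det]
  ring

end Mul

/-- The determinant is nonzero at the initial configuration. -/
theorem det_ne_zero {K : Type*} [Field K] [Algebra k K] (E : Matrix ι μ K)
    (hA : (E *ᵥ fun j => algebraMap k K (G.gA j)) = 0)
    (hB : (E *ᵥ fun j => algebraMap k K (G.gB j)) = 0) (hm : G.minor E ≠ 0)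
    (hY : G.syz G.gA G.gB 1 * G.Y = 1) : G.det E ≠ 0 := by
  rw [det, kerVec_of_mulVec_eq_zero _ _ _ hA, kerVec_of_mulVec_eq_zero _ _ _ hB]
  have h1 := G.syz_smul (fun j => algebraMap k K (G.gA j)) (fun j => algebraMap k K (G.gB j))
    1 (G.minor E)
  rw [mul_one] at h1
  have h2 : G.syz (fun j => algebraMap k K (G.gA j)) (fun j => algebraMap k K (G.gB j)) 1 *
      G.Y.map (algebraMap k K) = 1 := by
    have h3 := congrArg (fun M : Matrix R R k => M.map (algebraMap k K)) hY
    simp only [Matrix.map_mul] at h3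
    rw [Matrix.map_one _ (map_zero _) (map_one _)] at h3
    rw [← h3]
    congr 1
    ext ρ n
    rcases n with n | n | n <;> simp [syz]
  rw [h1, smul_mul, h2, det_smul, Matrix.det_one, mul_one]
  exact mul_ne_zero hm (pow_ne_zero _ hm)

theorem minor_ne_zero {E : Matrix ι μ S} (h : G.det E ≠ 0) : G.minor E ≠ 0 :=
  left_ne_zero_of_mul h

/-- If the determinant is nonzero, then the multiples and the remainders span. -/
theorem mem_of_det_ne_zero {K C : Type*} [Field K] [Algebra k K] [CommRing C] [Algebra K C]
    [Algebra k C] [IsScalarTower k K C] {E : Matrix ι μ K} (h : G.det E ≠ 0)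
    {mμ : μ → C} {mN : N → C} {mX : X → C} {mR : R → C}
    (hT : ∀ ν j, mN ν * mμ j = ∑ ρ, G.T ν j ρ • mR ρ) (hJ : ∀ υ, mX υ = ∑ ρ, G.J υ ρ • mR ρ)
    {W : Submodule K C} (hA : ∀ ν, mN ν * ∑ j, G.kerVec G.gA E j • mμ j ∈ W)
    (hB : ∀ ν, mN ν * ∑ j, G.kerVec G.gB E j • mμ j ∈ W) (hX : ∀ υ, mX υ ∈ W) (ρ : R) :
    mR ρ ∈ W := by
  have hdet := right_ne_zero_of_mul h
  set Q := G.syz (G.kerVec G.gA E) (G.kerVec G.gB E) (G.minor E)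
  set Y := G.Y.map (algebraMap k K)
  have hcol : ∀ n, ∑ ρ, Q ρ n • mR ρ ∈ W := by
    have key : ∀ (A : μ → K) (ν : N), ∑ ρ, (∑ j, A j * algebraMap k K (G.T ν j ρ)) • mR ρ =
        mN ν * ∑ j, A j • mμ j := by
      intro A ν
      simp only [Finset.sum_smul, Finset.mul_sum, mul_smul_comm, hT, Finset.smul_sum, mul_smul,
        algebraMap_smul]
      exact Finset.sum_comm
    rintro (ν | ν | υ)
    · exact (key _ ν).symm ▸ hA ν
    · exact (key _ ν).symm ▸ hB ν
    · have : ∑ ρ, Q ρ (Sum.inr (Sum.inr υ)) • mR ρ = G.minor E • mX υ := by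
        simp [Q, syz, hJ, Finset.smul_sum, mul_smul]
      rw [this]
      exact Submodule.smul_mem _ _ (hX υ)
  have hinv : Q * (Y * (Q * Y)⁻¹) = 1 := by
    rw [← Matrix.mul_assoc]
    exact Matrix.mul_nonsing_inv _ (isUnit_iff_ne_zero.2 hdet)
  have h1 : mR ρ = ∑ n, (Y * (Q * Y)⁻¹) n ρ • ∑ ρ', Q ρ' n • mR ρ' := by
    simp only [Finset.smul_sum]
    rw [Finset.sum_comm]
    simp only [smul_smul, mul_comm _ (Q _ _), ← Finset.sum_smul]
    simp only [← Matrix.mul_apply, hinv, Matrix.one_apply, ite_smul, one_smul, zero_smul]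
    simp
  rw [h1]
  exact sum_mem fun n _ => Submodule.smul_mem _ _ (hcol n)

end GenericData

end Generic

section Grid

variable {K : Type*} [Field K]

/-- A polynomial with at most `n` consecutive monomials vanishing at `n` nonzero points is zero. -/
theorem eq_zero_of_sum_pow_eq_zero {b n N : ℕ} {h : ℕ → K} (hN : ∀ i, N ≤ i → h i = 0)
    (hsupp : ∀ i, h i ≠ 0 → b ≤ i ∧ i < b + n) {t : ℕ → K}
    (ht : ∀ i < n, ∀ j < n, t i = t j → i = j) (ht0 : ∀ i < n, t i ≠ 0)
    (hsum : ∀ i < n, ∑ j ∈ Finset.range N, h j * t i ^ j = 0) (i : ℕ) : h i = 0 := by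
  have hinj : Function.Injective fun i : Fin n => t i :=
    fun i j hij => Fin.ext (ht i i.2 j j.2 hij)
  have h1 : ∀ i : Fin n, ∑ j : Fin n, t i ^ (j : ℕ) * h (b + j) = 0 := by
    intro i
    have h2 : t i ^ b * ∑ j : Fin n, t i ^ (j : ℕ) * h (b + j) =
        ∑ j ∈ Finset.range N, h j * t i ^ j := by
      rw [Finset.mul_sum, Finset.sum_congr (g := fun j : Fin n => h (b + j) * t i ^ (b + j)) rfl
        (fun j _ => by ring)]
      rw [Fin.sum_univ_eq_sum_range (fun j => h (b + j) * t i ^ (b + j)) n,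
        Finset.range_eq_Ico, Finset.sum_Ico_add (fun j => h j * t i ^ j) 0 n b, zero_add,
        Finset.range_eq_Ico]
      have h3 : ∀ s : Finset ℕ, (∀ j, h j ≠ 0 → j ∈ s) → ∑ j ∈ s, h j * t i ^ j =
          ∑ᶠ j, h j * t i ^ j := by
        intro s hs
        refine (finsum_eq_sum_of_support_subset _ ?_).symm
        intro j hj
        exact hs j (left_ne_zero_of_mul hj)
      rw [h3, h3]
      · intro j hj
        rw [Finset.mem_Ico]
        exact ⟨Nat.zero_le _, not_le.1 fun h => hj (hN j h)⟩
      · intro j hj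
        rw [Finset.mem_Ico]
        have := hsupp j hj
        omega
    rw [hsum i i.2] at h2
    exact (mul_eq_zero.1 h2).resolve_left (pow_ne_zero _ (ht0 i i.2))
  by_contra hi
  obtain ⟨h2, h3⟩ := hsupp i hi
  obtain ⟨j, rfl⟩ := Nat.exists_eq_add_of_le h2
  have h4 : (Matrix.vandermonde fun i : Fin n => t i).mulVec (fun j => h (b + j)) = 0 := by
    ext i
    exact h1 i
  have h5 := Matrix.eq_zero_of_mulVec_eq_zero (Matrix.det_vandermonde_ne_zero_iff.2 hinj) h4
  exact hi (congrFun h5 ⟨j, by omega⟩)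

/-- The second coordinates of the nodes over the point `α`. -/
def nodeVal (s : ℕ) (lam β : ℕ → K) (α : K) (j : ℕ) : K := if j < s then lam j * α else β j

theorem eq_zero_of_vanish_on_grid {m a s : ℕ} (ha : a = 1 ∨ a = 2) (hs : a = 2 → 2 ≤ s)
    (ham : a ≤ m) (hsm : s ≤ m)
    {α lam β : ℕ → K}
    (hα : ∀ i < m - a, ∀ j < m - a, α i = α j → i = j) (hα0 : ∀ i < m - a, α i ≠ 0)
    (hβ : ∀ i < m, ∀ j < m, β i = β j → i = j) (hβ0 : ∀ i < m, β i ≠ 0)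
    (hn : ∀ r < m - a, ∀ i < m, ∀ j < m, nodeVal s lam β (α r) i = nodeVal s lam β (α r) j → i = j)
    (hn0 : ∀ r < m - a, ∀ i < m, nodeVal s lam β (α r) i ≠ 0)
    {g : ℕ × ℕ → K} (hsupp : ∀ e, g e ≠ 0 → e.1 + e.2 ≤ m ∧ e ∈ hookSet a s)
    (hg1 : g (0, m) = 0) (hg2 : g (m, 0) = 0) (hg3 : a = 2 → g (m - 1, 1) = 0)
    (hz : ∀ r < m - a, ∀ j < m, ∑ i' ∈ Finset.range (m + 1), ∑ j' ∈ Finset.range (m + 1),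
      g (i', j') * α r ^ i' * nodeVal s lam β (α r) j ^ j' = 0)
    (hz0 : ∀ j < m, s ≤ j → ∑ j' ∈ Finset.range (m + 1), g (0, j') * β j ^ j' = 0)
    (e : ℕ × ℕ) : g e = 0 := by
  have hbig : ∀ i j, m + 1 ≤ i + j → g (i, j) = 0 := by
    intro i j hij
    by_contra h
    have := (hsupp _ h).1
    simp only at this
    omega
  have hrow : ∀ r < m - a, ∀ j, ∑ i' ∈ Finset.range (m + 1), g (i', j) * α r ^ i' = 0 := by
    intro r hr
    refine eq_zero_of_sum_pow_eq_zero (b := 0) (n := m) (N := m + 1)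
      (t := nodeVal s lam β (α r)) ?_ ?_ (hn r hr) (hn0 r hr) ?_
    · intro j hj
      exact Finset.sum_eq_zero fun i _ => by rw [hbig _ _ (by omega), zero_mul]
    · intro j hj
      refine ⟨Nat.zero_le _, ?_⟩
      by_contra hjm
      refine hj (Finset.sum_eq_zero fun i _ => ?_)
      by_cases h : i = 0 ∧ j = m
      · rw [h.1, h.2, hg1, zero_mul]
      · rw [hbig _ _ (by omega), zero_mul]
    · intro j hj
      rw [← hz r hr j hj, Finset.sum_comm]
      simp only [Finset.sum_mul]
  have hcol0 : ∀ j, g (0, j) = 0 := by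
    refine eq_zero_of_sum_pow_eq_zero (b := s) (n := m - s) (N := m + 1)
      (t := fun j => β (s + j)) (fun j hj => hbig _ _ (by omega)) ?_ ?_ ?_ ?_
    · intro j hj
      obtain ⟨h1, h2⟩ := hsupp _ hj
      simp only [hookSet, Set.mem_ofPred_eq] at h1 h2
      have : j ≠ m := fun h => hj (h ▸ hg1)
      omega
    · intro i hi j hj h
      have := hβ _ (by omega) _ (by omega) h
      omega
    · intro i hi
      exact hβ0 _ (by omega)
    · intro i hi
      exact hz0 _ (by omega) (by omega)
  obtain ⟨i, j⟩ := e
  refine eq_zero_of_sum_pow_eq_zero (b := if a = 2 ∧ j = 0 then 2 else 1) (n := m - a)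
    (N := m + 1) (t := α) (h := fun i => g (i, j)) (fun i hi => hbig _ _ (by omega)) ?_ hα hα0
    (fun r hr => hrow r hr j) i
  intro i hi
  obtain ⟨h1, h2⟩ := hsupp _ hi
  simp only [hookSet, Set.mem_ofPred_eq] at h1 h2
  have h3 : i ≠ 0 := fun h => hi (h ▸ hcol0 j)
  have h4 : ¬ (i = m ∧ j = 0) := fun h => hi (h.1 ▸ h.2 ▸ hg2)
  have h5 : ¬ (a = 2 ∧ i = m - 1 ∧ j = 1) := fun h => hi (h.2.1 ▸ h.2.2 ▸ hg3 h.1)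
  split_ifs <;> omega

end Grid

section Configuration

theorem exists_linearIndependent_rows {K Γ ι μ : Type*} [Field K] [Finite Γ] [Fintype ι]
    [Fintype μ] (M : Matrix Γ μ K) (h : Fintype.card ι ≤ M.rank) :
    ∃ p : ι → Γ, LinearIndependent K (M.submatrix p id).row := by
  rw [Matrix.rank_eq_finrank_span_row] at h
  obtain ⟨f, hf, -, hli⟩ := Submodule.exists_fun_fin_finrank_span_eq K (Set.range M.row)
  obtain ⟨g⟩ : Nonempty (ι ↪ Fin (Module.finrank K (Submodule.span K (Set.range M.row)))) :=
    Function.Embedding.nonempty_of_card_le (by simpa using h)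
  choose p hp using hf
  refine ⟨fun i => p (g i), ?_⟩
  have : (M.submatrix (fun i => p (g i)) id).row = f ∘ g := by
    ext1 i
    exact hp _
  rw [this]
  exact hli.comp _ g.injective

/-- A matrix of large rank has a nonzero minor. -/
theorem exists_det_ne_zero_of_card_le {K Γ ι μ : Type*} [Field K] [Finite Γ] [Fintype ι]
    [DecidableEq ι] [Fintype μ] (M : Matrix Γ μ K) (h : Fintype.card ι ≤ M.rank) :
    ∃ (p : ι → Γ) (c : ι → μ), (M.submatrix p c).det ≠ 0 := by
  obtain ⟨p, hp⟩ := exists_linearIndependent_rows M h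
  obtain ⟨c, hc⟩ := exists_linearIndependent_rows (ι := ι) (M.submatrix p id).transpose (by
    rw [Matrix.rank_transpose, hp.rank_matrix])
  refine ⟨p, c, ?_⟩
  have h3 := Matrix.linearIndependent_rows_iff_isUnit.1 hc
  rw [Matrix.isUnit_iff_isUnit_det, isUnit_iff_ne_zero] at h3
  rw [← Matrix.det_transpose]
  exact h3

open Classical in
/-- The exponents of degree at most `m` lying over `hookSet a s`. -/
noncomputable def hookIdx (m a s : ℕ) : Finset (ℕ × ℕ × Fin 3) :=
  (expIdx m).filter (· ∈ expOver (hookSet a s))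

theorem mem_hookIdx {m a s : ℕ} {e : ℕ × ℕ × Fin 3} :
    e ∈ hookIdx m a s ↔ expDeg e ≤ m ∧ e ∈ expOver (hookSet a s) := by
  classical
  rw [hookIdx, Finset.mem_filter, mem_expIdx]

theorem card_hookIdx {m a s : ℕ} (ha : 1 ≤ a) (hs : 1 ≤ s ∨ a = 1) :
    3 * m ^ 2 + 3 * m + 2 ≤ 2 * (hookIdx m a s).card + 6 * (s + a - 1) := by
  classical
  obtain ⟨t, ht, htc⟩ := exists_compl_hookSet ha hs
  have h1 := Finset.card_filter_add_card_filter_not (s := expIdx m)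
    (· ∈ expOver (hookSet a s))
  have h2 : ((expIdx m).filter (fun e => e ∉ expOver (hookSet a s))).card ≤
      (t ×ˢ (Finset.univ : Finset (Fin 3))).card := by
    refine Finset.card_le_card_of_injOn (fun e => ((e.1, e.2.1), e.2.2)) ?_ ?_
    · intro e he
      rw [Finset.mem_coe, Finset.mem_filter] at he
      rw [Finset.mem_coe, Finset.mem_product, ht]
      exact ⟨he.2, Finset.mem_univ _⟩
    · rintro ⟨i, j, l⟩ _ ⟨i', j', l'⟩ _ h
      simpa [and_assoc] using h
  rw [Finset.card_product, htc, Finset.card_univ, Fintype.card_fin] at h2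
  have h3 := card_expIdx m
  rw [hookIdx]
  omega

variable {K : Type*} [Field K]

open Classical in
/-- Extension by zero of a coefficient function. -/
noncomputable def extZero {I : Finset (ℕ × ℕ × Fin 3)} (g : I → K) (e : ℕ × ℕ × Fin 3) : K :=
  if h : e ∈ I then g ⟨e, h⟩ else 0

theorem sum_extZero {m a s : ℕ} (g : hookIdx m a s → K) (x y z : K) :
    ∑ e : hookIdx m a s, g e * cubicMon x y z e = ∑ l : Fin 3, (∑ i ∈ Finset.range (m + 1),
      ∑ j ∈ Finset.range (m + 1), extZero g (i, j, l) * x ^ i * y ^ j) * z ^ (l : ℕ) := by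
  classical
  have h1 : ∑ e : hookIdx m a s, g e * cubicMon x y z e =
      ∑ e ∈ hookIdx m a s, extZero g e * cubicMon x y z e := by
    rw [← Finset.sum_coe_sort (hookIdx m a s) fun e => extZero g e * cubicMon x y z e]
    refine Finset.sum_congr rfl fun e _ => ?_
    rw [extZero, dif_pos e.2]
  rw [h1, Finset.sum_subset (s₂ := Finset.range (m + 1) ×ˢ
    (Finset.range (m + 1) ×ˢ (Finset.univ : Finset (Fin 3)))),
    Finset.sum_product]
  · simp only [Finset.sum_product, Finset.sum_mul]
    symm
    rw [Finset.sum_comm]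
    refine Finset.sum_congr rfl fun i _ => ?_
    rw [Finset.sum_comm]
    refine Finset.sum_congr rfl fun j _ => Finset.sum_congr rfl fun l _ => ?_
    simp only [cubicMon]
    ring
  · rintro ⟨i, j, l⟩ he
    have := (mem_hookIdx.1 he).1
    simp [expDeg] at this ⊢
    omega
  · intro e _ he
    rw [extZero, dif_neg he, zero_mul]

theorem extZero_ne_zero {m a s : ℕ} {g : hookIdx m a s → K} {e : ℕ × ℕ × Fin 3}
    (h : extZero g e ≠ 0) : expDeg e ≤ m ∧ e ∈ expOver (hookSet a s) := by
  rw [← mem_hookIdx]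
  by_contra h2
  exact h (dif_neg h2)

/-- A lower bound for the number of conditions imposed by a grid of points. -/
theorem le_rank_grid {m a s : ℕ} (ha : a = 1 ∨ a = 2) (hs : a = 2 → 2 ≤ s)
    (ham : a ≤ m) (hsm : s ≤ m) {α lam β : ℕ → K}
    (hα : ∀ i < m - a, ∀ j < m - a, α i = α j → i = j) (hα0 : ∀ i < m - a, α i ≠ 0)
    (hβ : ∀ i < m, ∀ j < m, β i = β j → i = j) (hβ0 : ∀ i < m, β i ≠ 0)
    (hn : ∀ r < m - a, ∀ i < m, ∀ j < m, nodeVal s lam β (α r) i = nodeVal s lam β (α r) j → i = j)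
    (hn0 : ∀ r < m - a, ∀ i < m, nodeVal s lam β (α r) i ≠ 0)
    {Γ : Type*} [Finite Γ] (q : Γ → K × K × K)
    (hq : ∀ r < m - a, ∀ j < m, ∃ z : Fin 3 → K, Function.Injective z ∧
      ∀ l, (α r, nodeVal s lam β (α r) j, z l) ∈ Set.range q)
    (hq0 : ∀ j < m, s ≤ j → ∃ z : Fin 3 → K, Function.Injective z ∧
      ∀ l, (0, β j, z l) ∈ Set.range q) {d : ℕ}
    (hd : 2 * d + 6 * (s + a - 1) + 2 * (1 + a) ≤ 3 * m ^ 2 + 3 * m + 2) :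
    d ≤ (Matrix.of fun (γ : Γ) (e : hookIdx m a s) =>
      cubicMon (q γ).1 (q γ).2.1 (q γ).2.2 e).rank := by
  set M := Matrix.of fun (γ : Γ) (e : hookIdx m a s) =>
      cubicMon (q γ).1 (q γ).2.1 (q γ).2.2 (e : ℕ × ℕ × Fin 3) with hM
  have hcard := card_hookIdx (m := m) (a := a) (s := s) (by omega) (by omega)
  have hrk := M.mulVecLin.finrank_range_add_finrank_ker
  rw [Module.finrank_pi, Fintype.card_coe] at hrk
  have hker : Module.finrank K M.mulVecLin.ker ≤ 1 + a := by
    let e : Fin (1 + a) → ℕ × ℕ × Fin 3 := fun i =>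
      if (i : ℕ) = 0 then (0, m, 0) else if (i : ℕ) = 1 then (m, 0, 0) else (m - 1, 1, 0)
    let Φ : (hookIdx m a s → K) →ₗ[K] (Fin (1 + a) → K) :=
      { toFun := fun g i => extZero g (e i)
        map_add' := fun g g' => by
          ext i
          simp only [extZero, Pi.add_apply]
          split_ifs <;> simp
        map_smul' := fun c g => by
          ext i
          simp only [extZero, Pi.smul_apply, RingHom.id_apply]
          split_ifs <;> simp }
    have hinj : Function.Injective (Φ ∘ₗ M.mulVecLin.ker.subtype) := by
      rw [← LinearMap.ker_eq_bot, eq_bot_iff]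
      rintro ⟨g, hg⟩ h0
      rw [LinearMap.mem_ker] at h0 hg
      have h0' : ∀ i, extZero g (e i) = 0 := fun i => congrFun h0 i
      have hgM : ∀ γ, ∑ e : hookIdx m a s, g e * cubicMon (q γ).1 (q γ).2.1 (q γ).2.2 e = 0 := by
        intro γ
        have := congrFun hg γ
        rw [Matrix.mulVecLin_apply] at this
        simpa [Matrix.mulVec, dotProduct, hM, mul_comm] using this
      have hv : ∀ x y : K, (∃ z : Fin 3 → K, Function.Injective z ∧
          ∀ l, (x, y, z l) ∈ Set.range q) → ∀ l : Fin 3, ∑ i ∈ Finset.range (m + 1),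
            ∑ j ∈ Finset.range (m + 1), extZero g (i, j, l) * x ^ i * y ^ j = 0 := by
        rintro x y ⟨z, hz, hzq⟩
        have h1 : (Matrix.vandermonde z).mulVec (fun l => ∑ i ∈ Finset.range (m + 1),
            ∑ j ∈ Finset.range (m + 1), extZero g (i, j, l) * x ^ i * y ^ j) = 0 := by
          ext l
          obtain ⟨γ, hγ⟩ := hzq l
          have h2 := hgM γ
          rw [hγ, sum_extZero] at h2
          simp only [Matrix.mulVec, dotProduct, Matrix.vandermonde_apply, Pi.zero_apply]
          rw [← h2]
          exact Finset.sum_congr rfl fun _ _ => mul_comm _ _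
        exact congrFun (Matrix.eq_zero_of_mulVec_eq_zero
          (Matrix.det_vandermonde_ne_zero_iff.2 hz) h1)
      have hall : ∀ l : Fin 3, ∀ p : ℕ × ℕ, extZero g (p.1, p.2, l) = 0 := by
        intro l
        have hl0 : ∀ i j : ℕ, i + j = m → (l = 0 → extZero g (i, j, (0 : Fin 3)) = 0) →
            extZero g (i, j, l) = 0 := by
          intro i j hij h
          by_cases hl : l = 0
          · rw [hl]; exact h hl
          · by_contra h3
            have h4 := (extZero_ne_zero h3).1
            simp only [expDeg] at h4
            have : (l : ℕ) ≠ 0 := fun h => hl (Fin.ext h)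
            omega
        refine eq_zero_of_vanish_on_grid (g := fun p => extZero g (p.1, p.2, l)) ha hs ham hsm hα
          hα0 hβ hβ0 hn hn0 ?_ ?_ ?_ ?_ ?_ ?_
        · intro p hp
          obtain ⟨h3, h4⟩ := extZero_ne_zero hp
          simp only [expDeg] at h3
          exact ⟨by omega, h4⟩
        · exact hl0 _ _ (by omega) fun _ => h0' ⟨0, by omega⟩
        · exact hl0 _ _ (by omega) fun _ => h0' ⟨1, by omega⟩
        · intro ha2
          exact hl0 _ _ (by omega) fun _ => h0' ⟨2, by omega⟩
        · intro r hr j hj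
          exact hv _ _ (hq r hr j hj) l
        · intro j hj hsj
          have := hv _ _ (hq0 j hj hsj) l
          rw [Finset.sum_eq_single 0] at this
          · simpa using this
          · intro i _ hi
            simp [hi]
          · simp
      rw [Submodule.mem_bot]
      ext ⟨⟨i, j, l⟩, he⟩
      have := hall l (i, j)
      rw [extZero, dif_pos he] at this
      exact this
    have := LinearMap.finrank_le_finrank_of_injective hinj
    simpa using this
  rw [Matrix.rank]
  omega

end Configuration

section GenericDataExists

/-- The exponents less than `m` in the first two variables. -/
def boxIdx (m : ℕ) : Finset (ℕ × ℕ × Fin 3) :=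
  Finset.range m ×ˢ (Finset.range m ×ˢ Finset.univ)

variable {k C : Type*} [Field k] [CommRing C] [Algebra k C] {x y z : C}

theorem exists_sum_smul_of_mem_span_image {E : Type*} {b : E → C} {I : Finset E} {v : C}
    (hv : v ∈ Submodule.span k (b '' (I : Set E))) : ∃ g : I → k, ∑ e, g e • b e = v := by
  rw [Set.image_eq_range] at hv
  exact (Submodule.mem_span_range_iff_exists_fun k).1 hv

theorem coe_expIdx (n : ℕ) : (expIdx n : Set (ℕ × ℕ × Fin 3)) = {e | expDeg e ≤ n} := by
  ext e
  exact mem_expIdx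

theorem cubicFil_eq (n : ℕ) : cubicFil k x y z n =
    Submodule.span k (cubicMon x y z '' (expIdx n : Set (ℕ × ℕ × Fin 3))) := by
  rw [cubicFil, coe_expIdx]

theorem IsCubicFrame.exists_genericData (hC : IsCubicFrame k x y z) {m : ℕ} {A B : C}
    {I : Finset (ℕ × ℕ × Fin 3)} (hI : ∀ e ∈ I, expDeg e ≤ m)
    (hAI : A ∈ Submodule.span k (cubicMon x y z '' (I : Set (ℕ × ℕ × Fin 3))))
    (hBI : B ∈ Submodule.span k (cubicMon x y z '' (I : Set (ℕ × ℕ × Fin 3))))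
    (hA : A - x ^ m ∈ Submodule.span k
      (cubicMon x y z '' {e | e.1 < m ∧ e.2.1 = 0 ∧ e.2.2 = 0}))
    (hB : B - y ^ m ∈ Submodule.span k
      (cubicMon x y z '' {e | e.2.1 < m ∧ e.1 + e.2.1 ≤ m ∧ e.2.2 = 0}))
    {ι : Type*} (c : ι → I) :
    ∃ G : GenericData k ι I (expIdx (m + 1)) (boxIdx m) (expIdx (2 * m + 1)),
      G.c = c ∧ ∑ e, G.gA e • cubicMon x y z e = A ∧ ∑ e, G.gB e • cubicMon x y z e = B ∧
      (∀ (ν : expIdx (m + 1)) (j : I), cubicMon x y z ν * cubicMon x y z j = ∑ ρ, G.T ν j ρ • cubicMon x y z ρ) ∧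
      (∀ υ : boxIdx m, cubicMon x y z υ = ∑ ρ, G.J υ ρ • cubicMon x y z ρ) ∧
      G.syz G.gA G.gB 1 * G.Y = 1 := by
  obtain ⟨gA, hgA⟩ := exists_sum_smul_of_mem_span_image hAI
  obtain ⟨gB, hgB⟩ := exists_sum_smul_of_mem_span_image hBI
  have hT : ∀ (ν : expIdx (m + 1)) (j : I), ∃ g : expIdx (2 * m + 1) → k,
      ∑ ρ, g ρ • cubicMon x y z ρ = cubicMon x y z ν * cubicMon x y z j := by
    intro ν j
    refine exists_sum_smul_of_mem_span_image ?_
    rw [← cubicFil_eq]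
    have := hC.mul_mem (cubicMon_mem_cubicFil (mem_expIdx.1 ν.2))
      (cubicMon_mem_cubicFil (hI _ j.2))
    exact cubicFil_mono (by omega) this
  choose T hT using hT
  have hJ : ∀ υ : boxIdx m, ∃ g : expIdx (2 * m + 1) → k,
      ∑ ρ, g ρ • cubicMon x y z ρ = cubicMon x y z υ := by
    intro υ
    refine exists_sum_smul_of_mem_span_image ?_
    rw [← cubicFil_eq]
    refine cubicMon_mem_cubicFil ?_
    have := υ.2
    simp only [boxIdx, Finset.mem_product, Finset.mem_range] at this
    simp only [expDeg]
    omega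
  choose J hJ using hJ
  let col : expIdx (m + 1) ⊕ expIdx (m + 1) ⊕ boxIdx m → C :=
    Sum.elim (fun ν => A * cubicMon x y z ν)
      (Sum.elim (fun ν => B * cubicMon x y z ν) (fun υ => cubicMon x y z υ))
  have hY : ∀ ρ : expIdx (2 * m + 1), ∃ g : expIdx (m + 1) ⊕ expIdx (m + 1) ⊕ boxIdx m → k,
      ∑ n, g n • col n = cubicMon x y z ρ := by
    intro ρ
    rw [← Submodule.mem_span_range_iff_exists_fun]
    have h1 := cubicMon_mem_of_leading hA hB (2 * m + 1)
      (cubicMon_mem_cubicFil (mem_expIdx.1 ρ.2))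
    rw [show 2 * m + 1 - m = m + 1 by omega] at h1
    revert h1
    refine fun h1 => SetLike.le_def.1 (sup_le (sup_le ?_ ?_) ?_) h1
    · rw [cubicFil_eq, Submodule.map_span_le]
      rintro _ ⟨ν, hν, rfl⟩
      exact Submodule.subset_span ⟨Sum.inl ⟨ν, hν⟩, rfl⟩
    · rw [cubicFil_eq, Submodule.map_span_le]
      rintro _ ⟨ν, hν, rfl⟩
      exact Submodule.subset_span ⟨Sum.inr (Sum.inl ⟨ν, hν⟩), rfl⟩
    · rw [cubicBox_eq, Submodule.span_le]
      rintro _ ⟨ν, hν, rfl⟩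
      exact Submodule.subset_span ⟨Sum.inr (Sum.inr ⟨ν, hν⟩), rfl⟩
  choose Y hY using hY
  let G : GenericData k ι I (expIdx (m + 1)) (boxIdx m) (expIdx (2 * m + 1)) :=
    ⟨c, gA, gB, T, J, fun n ρ => Y ρ n⟩
  refine ⟨G, rfl, hgA, hgB, fun ν j => (hT ν j).symm, fun υ => (hJ υ).symm, ?_⟩
  have hcol : ∀ n, col n = ∑ ρ, G.syz G.gA G.gB 1 ρ n • cubicMon x y z ρ := by
    have key : ∀ (g : I → k) (ν : expIdx (m + 1)),
        (∑ e, g e • cubicMon x y z e) * cubicMon x y z ν =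
          ∑ ρ, (∑ j, g j * T ν j ρ) • cubicMon x y z ρ := by
      intro g ν
      rw [mul_comm, Finset.mul_sum]
      simp only [Finset.sum_smul, mul_smul_comm, ← hT ν, Finset.smul_sum, mul_smul]
      exact Finset.sum_comm
    rintro (ν | ν | υ)
    · change A * cubicMon x y z ν = _
      rw [← hgA, key gA ν]
      rfl
    · change B * cubicMon x y z ν = _
      rw [← hgB, key gB ν]
      rfl
    · change cubicMon x y z υ = _
      rw [← hJ υ]
      exact Finset.sum_congr rfl fun ρ _ => by simp [G, GenericData.syz]
  have hli : LinearIndependent k (fun ρ : expIdx (2 * m + 1) => cubicMon x y z ρ) :=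
    hC.li.comp _ Subtype.val_injective
  ext ρ' ρ
  have h1 : ∑ ρ', (G.syz G.gA G.gB 1 * G.Y) ρ' ρ • cubicMon x y z ρ' =
      ∑ ρ', (1 : Matrix (expIdx (2 * m + 1)) _ k) ρ' ρ • cubicMon x y z ρ' := by
    have h2 : ∑ ρ', (1 : Matrix (expIdx (2 * m + 1)) _ k) ρ' ρ • cubicMon x y z ρ' =
        cubicMon x y z ρ := by
      simp [Matrix.one_apply]
    rw [h2, ← hY ρ]
    simp only [hcol, Matrix.mul_apply, Finset.sum_smul, Finset.smul_sum, smul_smul]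
    rw [Finset.sum_comm]
    refine Finset.sum_congr rfl fun n _ => Finset.sum_congr rfl fun ρ' _ => ?_
    rw [mul_comm]
  have h3 := Fintype.linearIndependent_iff.1 hli
    (fun ρ' => (G.syz G.gA G.gB 1 * G.Y) ρ' ρ - (1 : Matrix _ _ k) ρ' ρ) (by
      simp only [sub_smul, Finset.sum_sub_distrib]
      exact sub_eq_zero.2 h1) ρ'
  exact sub_eq_zero.1 h3

/-- A product of linear factors, up to its leading term. -/
theorem prod_sub_smul_sub_pow_mem (γ : ℕ → k) (w u : C) (n : ℕ) :
    ∏ i ∈ Finset.range n, (u - γ i • w) - u ^ n ∈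
      Submodule.span k {v | ∃ i j, i + j = n ∧ j < n ∧ v = w ^ i * u ^ j} := by
  induction n with
  | zero => simp
  | succ n ih =>
    rw [Finset.prod_range_succ]
    set P := ∏ i ∈ Finset.range n, (u - γ i • w)
    have h1 : P * (u - γ n • w) - u ^ (n + 1) =
        (u - γ n • w) * (P - u ^ n) - γ n • (w ^ 1 * u ^ n) := by
      simp only [Algebra.smul_def]
      ring
    rw [h1]
    refine sub_mem ?_ (Submodule.smul_mem _ _ (Submodule.subset_span ⟨1, n, by omega, by omega, rfl⟩))
    have h2 : ∀ v ∈ Submodule.span k {v | ∃ i j, i + j = n ∧ j < n ∧ v = w ^ i * u ^ j},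
        (u - γ n • w) * v ∈
          Submodule.span k {v | ∃ i j, i + j = n + 1 ∧ j < n + 1 ∧ v = w ^ i * u ^ j} := by
      intro v hv
      induction hv using Submodule.span_induction with
      | mem v hv =>
        obtain ⟨i, j, hij, hj, rfl⟩ := hv
        have : (u - γ n • w) * (w ^ i * u ^ j) =
            w ^ i * u ^ (j + 1) - γ n • (w ^ (i + 1) * u ^ j) := by
          simp only [Algebra.smul_def]
          ring
        rw [this]
        exact sub_mem (Submodule.subset_span ⟨i, j + 1, by omega, by omega, rfl⟩)
          (Submodule.smul_mem _ _ (Submodule.subset_span ⟨i + 1, j, by omega, by omega, rfl⟩))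
      | zero => simp
      | add v v' _ _ h h' => rw [mul_add]; exact add_mem h h'
      | smul c v _ h => rw [mul_smul_comm]; exact Submodule.smul_mem _ _ h
    exact h2 _ ih

/-- The union of lines parallel to the second axis. -/
def gridA (a n : ℕ) (α : ℕ → k) (x : C) : C := x ^ a * ∏ i ∈ Finset.range n, (x - α i • 1)

/-- The union of lines through the origin, and of lines parallel to the first axis. -/
def gridB (s n : ℕ) (lam β : ℕ → k) (x y : C) : C :=
  (∏ j ∈ Finset.range s, (y - lam j • x)) * ∏ j ∈ Finset.range n, (y - β (s + j) • 1)

theorem gridA_sub_pow_mem (z : C) (y : C) (a n : ℕ) (α : ℕ → k) : gridA a n α x - x ^ (a + n) ∈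
    Submodule.span k (cubicMon x y z '' {e | a ≤ e.1 ∧ e.1 < a + n ∧ e.2.1 = 0 ∧ e.2.2 = 0}) := by
  have h1 : gridA a n α x - x ^ (a + n) =
      x ^ a * (∏ i ∈ Finset.range n, (x - α i • 1) - x ^ n) := by
    rw [gridA]; ring
  rw [h1]
  have h2 := prod_sub_smul_sub_pow_mem α 1 x n
  generalize ∏ i ∈ Finset.range n, (x - α i • 1) - x ^ n = v at h2 ⊢
  induction h2 using Submodule.span_induction with
  | mem v hv =>
    obtain ⟨i, j, hij, hj, rfl⟩ := hv
    refine Submodule.subset_span ⟨(a + j, 0, 0), ⟨by simp, by simp; omega, rfl, rfl⟩, ?_⟩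
    simp [cubicMon, pow_add]
  | zero => simp
  | add v v' _ _ h h' => rw [mul_add]; exact add_mem h h'
  | smul c v _ h => rw [mul_smul_comm]; exact Submodule.smul_mem _ _ h

theorem gridB_sub_pow_mem (z : C) (s n : ℕ) (lam β : ℕ → k) :
    gridB s n lam β x y - y ^ (s + n) ∈ Submodule.span k (cubicMon x y z ''
      {e | e.2.1 < s + n ∧ e.1 + e.2.1 ≤ s + n ∧ e.2.2 = 0 ∧
        (s ≤ e.2.1 ∨ 1 ≤ e.1 ∧ s ≤ e.1 + e.2.1)}) := by
  set P := ∏ j ∈ Finset.range s, (y - lam j • x) with hP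
  set Q := ∏ j ∈ Finset.range n, (y - β (s + j) • (1 : C)) with hQ
  have h1 : gridB s n lam β x y - y ^ (s + n) =
      (P - y ^ s) * (Q - y ^ n) + (P - y ^ s) * y ^ n + y ^ s * (Q - y ^ n) := by
    rw [gridB, ← hP, ← hQ]; ring
  have hP' := prod_sub_smul_sub_pow_mem lam x y s
  have hQ' := prod_sub_smul_sub_pow_mem (fun j => β (s + j)) 1 y n
  rw [← hP] at hP'
  rw [← hQ] at hQ'
  rw [h1]
  refine add_mem (add_mem ?_ ?_) ?_
  · have := Submodule.mul_mem_mul hP' hQ'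
    rw [Submodule.span_mul_span] at this
    refine Submodule.span_mono ?_ this
    rintro _ ⟨_, ⟨i, j, hij, hj, rfl⟩, _, ⟨i', j', hij', hj', rfl⟩, rfl⟩
    refine ⟨(i, j + j', 0), ⟨?_, ?_, rfl, ?_⟩, ?_⟩
    · simp only; omega
    · simp only; omega
    · simp only; omega
    · simp [cubicMon]; ring
  · have := Submodule.mul_mem_mul hP' (Submodule.mem_span_singleton_self (R := k) (y ^ n))
    rw [Submodule.span_mul_span] at this
    refine Submodule.span_mono ?_ this
    rintro _ ⟨_, ⟨i, j, hij, hj, rfl⟩, _, rfl, rfl⟩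
    refine ⟨(i, j + n, 0), ⟨?_, ?_, rfl, ?_⟩, ?_⟩
    · simp only; omega
    · simp only; omega
    · simp only; omega
    · simp [cubicMon]; ring
  · have := Submodule.mul_mem_mul (Submodule.mem_span_singleton_self (R := k) (y ^ s)) hQ'
    rw [Submodule.span_mul_span] at this
    refine Submodule.span_mono ?_ this
    rintro _ ⟨_, rfl, _, ⟨i', j', hij', hj', rfl⟩, rfl⟩
    refine ⟨(0, s + j', 0), ⟨?_, ?_, rfl, ?_⟩, ?_⟩
    · simp only; omega
    · simp only; omega
    · simp only; omega
    · simp [cubicMon]; ring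

end GenericDataExists

section PointConfiguration

open MvPolynomial

theorem map_cubicMon {C C' Φ : Type*} [CommRing C] [CommRing C'] [FunLike Φ C C']
    [RingHomClass Φ C C'] (f : Φ) (x y z : C) (e : ℕ × ℕ × Fin 3) :
    f (cubicMon x y z e) = cubicMon (f x) (f y) (f z) e := by
  simp [cubicMon]

theorem map_gridA {k C C' : Type*} [Field k] [CommRing C] [CommRing C'] [Algebra k C]
    [Algebra k C'] (f : C →ₐ[k] C') (a n : ℕ) (α : ℕ → k) (x : C) :
    f (gridA a n α x) = gridA a n α (f x) := by
  simp [gridA]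

theorem map_gridB {k C C' : Type*} [Field k] [CommRing C] [CommRing C'] [Algebra k C]
    [Algebra k C'] (f : C →ₐ[k] C') (s n : ℕ) (lam β : ℕ → k) (x y : C) :
    f (gridB s n lam β x y) = gridB s n lam β (f x) (f y) := by
  simp [gridB]

variable {k : Type*} [Field k]

/-- Parameters for a grid of points. -/
theorem exists_grid_parameters [Infinite k] (s m n : ℕ) : ∃ α lam β : ℕ → k,
    Function.Injective α ∧ (∀ i, α i ≠ 0) ∧ Function.Injective β ∧ (∀ i, β i ≠ 0) ∧
    (∀ r < n, ∀ i < m, ∀ j < m, nodeVal s lam β (α r) i = nodeVal s lam β (α r) j → i = j) ∧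
    (∀ r < n, ∀ i < m, nodeVal s lam β (α r) i ≠ 0) := by
  have h0 : Infinite ({0}ᶜ : Set k) := (Set.finite_singleton (0 : k)).infinite_compl.to_subtype
  let e := Infinite.natEmbedding ({0}ᶜ : Set k)
  let α : ℕ → k := fun i => e i
  have hα : Function.Injective α := Subtype.val_injective.comp e.injective
  have hα0 : ∀ i, α i ≠ 0 := fun i => (e i).2
  let S : Set k := insert 0 ((fun p : ℕ × ℕ => α p.1 * α p.2) '' (Set.Iio s ×ˢ Set.Iio n))
  have hS : S.Finite := (((Set.finite_Iio s).prod (Set.finite_Iio n)).image _).insert 0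
  have h1 : Infinite (Sᶜ : Set k) := hS.infinite_compl.to_subtype
  let e' := Infinite.natEmbedding (Sᶜ : Set k)
  let β : ℕ → k := fun i => e' i
  have hβ : Function.Injective β := Subtype.val_injective.comp e'.injective
  have hβS : ∀ i, β i ∉ S := fun i => (e' i).2
  have hne : ∀ i < s, ∀ r < n, ∀ j, α i * α r ≠ β j := fun i hi r hr j h =>
    hβS j (Set.mem_insert_of_mem _ ⟨(i, r), ⟨hi, hr⟩, h⟩)
  have hβ0 : ∀ i, β i ≠ 0 := fun i h => hβS i (h ▸ Set.mem_insert _ _)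
  refine ⟨α, α, β, hα, hα0, hβ, hβ0, ?_, ?_⟩
  · intro r hr i _ j _ h
    rw [nodeVal, nodeVal] at h
    split_ifs at h with h2 h3 h3
    · exact hα (mul_right_cancel₀ (hα0 r) h)
    · exact absurd h (hne _ h2 _ hr _)
    · exact absurd h.symm (hne _ h3 _ hr _)
    · exact hβ h
  · intro r hr i _
    rw [nodeVal]
    split_ifs
    · exact mul_ne_zero (hα0 _) (hα0 _)
    · exact hβ0 _

theorem CubicRing.exists_genericData [Infinite k] {F : MvPolynomial (Fin 4) k}
    (hF : F.IsHomogeneous 3) (h1 : coeff (Finsupp.single 3 3) F = 1) {Ω : Type*} [Field Ω]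
    [Algebra k Ω] (hroots : ∀ α β : k, ∃ z : Fin 3 → Ω, Function.Injective z ∧
      ∀ l, aeval ![1, algebraMap k Ω α, algebraMap k Ω β, z l] F = 0)
    {m a s : ℕ} (ha : a = 1 ∨ a = 2) (hs : a = 2 → 2 ≤ s) (ham : a ≤ m) (hsm : s ≤ m)
    {ι : Type*} [Fintype ι] [DecidableEq ι]
    (hι : 2 * Fintype.card ι + 6 * (s + a - 1) + 2 * (1 + a) ≤ 3 * m ^ 2 + 3 * m + 2) :
    ∃ (G : GenericData k ι (hookIdx m a s) (expIdx (m + 1)) (boxIdx m) (expIdx (2 * m + 1)))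
      (p : ι → Ω × Ω × Ω),
      (∀ (ν : expIdx (m + 1)) (j : hookIdx m a s),
        cubicMon (x F k) (y F k) (z F k) ν * cubicMon (x F k) (y F k) (z F k) j =
          ∑ ρ, G.T ν j ρ • cubicMon (x F k) (y F k) (z F k) ρ) ∧
      (∀ υ : boxIdx m, cubicMon (x F k) (y F k) (z F k) υ =
        ∑ ρ, G.J υ ρ • cubicMon (x F k) (y F k) (z F k) ρ) ∧
      (∀ i, aeval ![1, (p i).1, (p i).2.1, (p i).2.2] F = 0) ∧
      G.det (Matrix.of fun i (e : hookIdx m a s) =>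
        cubicMon (p i).1 (p i).2.1 (p i).2.2 e) ≠ 0 := by
  obtain ⟨α, lam, β, hα, hα0, hβ, hβ0, hn, hn0⟩ := exists_grid_parameters (k := k) s m (m - a)
  have hC := isCubicFrame (L := k) hF h1
  have hinj := (algebraMap k Ω).injective
  choose zz hzz hzzF using hroots
  let nd : ℕ → ℕ → k := fun r j => nodeVal s lam β (α r) j
  have hnode : ∀ r j, nodeVal s (fun j => algebraMap k Ω (lam j)) (fun j => algebraMap k Ω (β j))
      (algebraMap k Ω (α r)) j = algebraMap k Ω (nd r j) := by
    intro r j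
    simp only [nd, nodeVal]
    split_ifs <;> simp
  let q : (Fin (m - a) × Fin m × Fin 3) ⊕ ({j : Fin m // s ≤ j} × Fin 3) → Ω × Ω × Ω :=
    Sum.elim (fun γ => (algebraMap k Ω (α γ.1), algebraMap k Ω (nd γ.1 γ.2.1),
        zz (α γ.1) (nd γ.1 γ.2.1) γ.2.2))
      (fun γ => (algebraMap k Ω 0, algebraMap k Ω (β γ.1), zz 0 (β γ.1) γ.2))
  have hqF : ∀ γ, aeval ![1, (q γ).1, (q γ).2.1, (q γ).2.2] F = 0 := by
    rintro (γ | γ) <;> exact hzzF _ _ _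
  have hrank := le_rank_grid (K := Ω) (m := m) (a := a) (s := s)
    (α := fun j => algebraMap k Ω (α j)) (lam := fun j => algebraMap k Ω (lam j))
    (β := fun j => algebraMap k Ω (β j)) ha hs ham hsm
    (fun i _ j _ h => hα (hinj h)) (fun i _ => by simpa using hα0 i)
    (fun i _ j _ h => hβ (hinj h)) (fun i _ => by simpa using hβ0 i)
    (fun r hr i hi j hj h => by
      rw [hnode, hnode] at h
      exact hn r hr i hi j hj (hinj h))
    (fun r hr i hi => by
      rw [hnode]
      simpa using hn0 r hr i hi)
    q
    (fun r hr j hj => ⟨zz (α r) (nd r j), hzz _ _, fun l => by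
      rw [hnode]
      exact ⟨Sum.inl (⟨r, hr⟩, ⟨j, hj⟩, l), rfl⟩⟩)
    (fun j hj hsj => ⟨zz 0 (β j), hzz _ _, fun l =>
      ⟨Sum.inr (⟨⟨j, hj⟩, hsj⟩, l), by simp [q]⟩⟩) hι
  obtain ⟨pγ, c, hdet⟩ := exists_det_ne_zero_of_card_le _ hrank
  have hsub : ∀ {T : Set (ℕ × ℕ × Fin 3)}, (∀ e ∈ T, e ∈ hookIdx m a s) →
      Submodule.span k (cubicMon (x F k) (y F k) (z F k) '' T) ≤
      Submodule.span k (cubicMon (x F k) (y F k) (z F k) ''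
        (hookIdx m a s : Set (ℕ × ℕ × Fin 3))) :=
    fun h => Submodule.span_mono (Set.image_mono h)
  have hA := gridA_sub_pow_mem (x := x F k) (z F k) (y F k) a (m - a) α
  have hB := gridB_sub_pow_mem (x := x F k) (y := y F k) (z F k) s (m - s) lam β
  rw [Nat.add_sub_cancel' ham] at hA
  rw [Nat.add_sub_cancel' hsm] at hB
  set A := gridA a (m - a) α (x F k) with hAdef
  set B := gridB s (m - s) lam β (x F k) (y F k) with hBdef
  obtain ⟨G, hGc, hGA, hGB, hT, hJ, hY⟩ := hC.exists_genericData (A := A) (B := B)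
    (I := hookIdx m a s) (fun e he => (mem_hookIdx.1 he).1)
    (by
      rw [← sub_add_cancel A (x F k ^ m)]
      refine add_mem (hsub ?_ hA) (Submodule.subset_span ⟨(m, 0, 0), ?_, by simp [cubicMon]⟩)
      · rintro ⟨i, j, l⟩ ⟨h2, h3, h4, h5⟩
        simp only at h2 h3 h4 h5
        rw [mem_hookIdx, h4, h5]
        refine ⟨?_, Or.inl h2⟩
        simp [expDeg]; omega
      · rw [Finset.mem_coe, mem_hookIdx]
        exact ⟨by simp [expDeg], Or.inl ham⟩)
    (by
      rw [← sub_add_cancel B (y F k ^ m)]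
      refine add_mem (hsub ?_ hB) (Submodule.subset_span ⟨(0, m, 0), ?_, by simp [cubicMon]⟩)
      · rintro ⟨i, j, l⟩ ⟨h2, h3, h4, h5⟩
        simp only at h2 h3 h4 h5
        rw [mem_hookIdx, h4]
        refine ⟨?_, ?_⟩
        · simp [expDeg]; omega
        · change a ≤ i ∨ s ≤ j ∨ (1 ≤ i ∧ 1 ≤ j)
          omega
      · rw [Finset.mem_coe, mem_hookIdx]
        exact ⟨by simp [expDeg], Or.inr (Or.inl hsm)⟩)
    (Submodule.span_mono (Set.image_mono fun e he => And.intro he.2.1 he.2.2) hA)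
    (Submodule.span_mono (Set.image_mono fun e he => And.intro he.1 (And.intro he.2.1 he.2.2.1))
      hB) c
  refine ⟨G, fun i => q (pγ i), hT, hJ, fun i => hqF _, ?_⟩
  have hev : ∀ (g : hookIdx m a s → k) (D : CubicRing F k),
      ∑ e, g e • cubicMon (x F k) (y F k) (z F k) e = D →
      (∀ (γ) (f : CubicRing F k →ₐ[k] Ω), f (x F k) = (q γ).1 → f (y F k) = (q γ).2.1 →
        f (z F k) = (q γ).2.2 → f D = 0) →
      Matrix.mulVec (Matrix.of fun i (e : hookIdx m a s) => cubicMon (q (pγ i)).1 (q (pγ i)).2.1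
        (q (pγ i)).2.2 e) (fun j => algebraMap k Ω (g j)) = 0 := by
    intro g D hD h
    ext i
    obtain ⟨f, hx, hy, hz⟩ := exists_lift (F := F) (L := k) _ _ _ (hqF (pγ i))
    rw [Pi.zero_apply, ← h (pγ i) f hx hy hz, ← hD, map_sum]
    simp only [Matrix.mulVec, dotProduct, Matrix.of_apply]
    refine Finset.sum_congr rfl fun e _ => ?_
    rw [map_smul, map_cubicMon, hx, hy, hz, Algebra.smul_def, mul_comm]
  refine G.det_ne_zero _ (hev _ _ hGA ?_) (hev _ _ hGB ?_) ?_ hY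
  · intro γ f hx _ _
    rw [hAdef, map_gridA, hx, gridA]
    rcases γ with γ | γ
    · refine mul_eq_zero_of_right _ (Finset.prod_eq_zero (Finset.mem_range.2 γ.1.2) ?_)
      simp [q, Algebra.smul_def]
    · refine mul_eq_zero_of_left ?_ _
      have : a ≠ 0 := by omega
      simp [q, this]
  · intro γ f hx hy _
    rw [hBdef, map_gridB, hx, hy, gridB]
    have hbig : ∀ (u v : Ω) (j : ℕ), s ≤ j → j < m → v = algebraMap k Ω (β j) →
        ∏ j ∈ Finset.range (m - s), (v - β (s + j) • 1) = 0 := by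
      intro u v j hj hjm hv
      refine Finset.prod_eq_zero (i := j - s) (Finset.mem_range.2 (by omega)) ?_
      rw [hv, Nat.add_sub_cancel' hj, Algebra.smul_def, mul_one, sub_self]
    rcases γ with γ | γ
    · by_cases h : (γ.2.1 : ℕ) < s
      · refine mul_eq_zero_of_left (Finset.prod_eq_zero (Finset.mem_range.2 h) ?_) _
        simp [q, nd, nodeVal, h, Algebra.smul_def]
      · refine mul_eq_zero_of_right _ (hbig 0 _ γ.2.1 (not_lt.1 h) γ.2.1.2 ?_)
        simp [q, nd, nodeVal, h]
    · exact mul_eq_zero_of_right _ (hbig 0 _ γ.1.1 γ.1.2 γ.1.1.2 rfl)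
  · rw [GenericData.minor, hGc]
    exact hdet

end PointConfiguration

section Construction

open MvPolynomial

theorem IsCubicFrame.ne_zero_of_le {L C : Type*} [Field L] [CommRing C] [Algebra L C] {x y z : C}
    (hC : IsCubicFrame L x y z) {m : ℕ} (hm : 1 ≤ m) {A B : C}
    (hs : cubicFil L x y z (2 * m + 1) ≤ (cubicFil L x y z (m + 1)).map (LinearMap.mulLeft L A) ⊔
      (cubicFil L x y z (m + 1)).map (LinearMap.mulLeft L B) ⊔ cubicBox L x y z m) :
    A ≠ 0 := by
  rintro rfl
  have hmap : (cubicFil L x y z (m + 1)).map (LinearMap.mulLeft L (0 : C)) = ⊥ := by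
    rw [eq_bot_iff]
    rintro _ ⟨v, _, rfl⟩
    simp
  rw [hmap, bot_sup_eq] at hs
  have h1 := finiteDimensional_cubicFil (L := L) (x := x) (y := y) (z := z) (m + 1)
  have h2 := finiteDimensional_cubicBox (L := L) (x := x) (y := y) (z := z) m
  have h3 := Submodule.finrank_mono hs
  have h4 := Submodule.finrank_add_le_finrank_add_finrank
    ((cubicFil L x y z (m + 1)).map (LinearMap.mulLeft L B)) (cubicBox L x y z m)
  have h5 := Submodule.finrank_map_le (LinearMap.mulLeft L B) (cubicFil L x y z (m + 1))
  rw [hC.finrank_cubicFil] at h3 h5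
  rw [hC.finrank_cubicBox] at h4
  have h6 := card_expIdx (2 * m + 1)
  have h7 := card_expIdx (m + 1)
  nlinarith

theorem CubicRing.finrank_quotient_of_det_ne_zero {k : Type*} [Field k] {F : MvPolynomial (Fin 4) k}
    (hF : F.IsHomogeneous 3) (h1 : coeff (Finsupp.single 3 3) F = 1) {L : Type*} [Field L]
    [Algebra k L] [IsDomain (CubicRing F L)] {m a s : ℕ} (hm : 1 ≤ m) {ι : Type*} [Fintype ι]
    [DecidableEq ι]
    (G : GenericData k ι (hookIdx m a s) (expIdx (m + 1)) (boxIdx m) (expIdx (2 * m + 1)))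
    (hT : ∀ (ν : expIdx (m + 1)) (j : hookIdx m a s),
        cubicMon (x F k) (y F k) (z F k) ν * cubicMon (x F k) (y F k) (z F k) j =
          ∑ ρ, G.T ν j ρ • cubicMon (x F k) (y F k) (z F k) ρ)
    (hJ : ∀ υ : boxIdx m, cubicMon (x F k) (y F k) (z F k) υ =
        ∑ ρ, G.J υ ρ • cubicMon (x F k) (y F k) (z F k) ρ)
    (E : Matrix ι (hookIdx m a s) L) (hE : G.det E ≠ 0) {A B : CubicRing F L}
    (hA : A = ∑ e, G.kerVec G.gA E e • cubicMon (x F L) (y F L) (z F L) e)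
    (hB : B = ∑ e, G.kerVec G.gB E e • cubicMon (x F L) (y F L) (z F L) e) :
    (Module.finrank L (CubicRing F L ⧸ Ideal.span {A, B}) = 3 * m ^ 2 ∧
      FiniteDimensional L (CubicRing F L ⧸ Ideal.span {A, B})) ∧
      A ∈ monIdeal (x F L) (y F L) (hookSet a s) ∧ B ∈ monIdeal (x F L) (y F L) (hookSet a s) := by
  have hC := isCubicFrame (L := L) hF h1
  obtain ⟨f, hx, hy, hz⟩ := exists_lift (F := F) (L := k) (x F L) (y F L) (z F L)
    (aeval_eq_zero F L)
  have hmon : ∀ e, f (cubicMon (x F k) (y F k) (z F k) e) =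
      cubicMon (x F L) (y F L) (z F L) e := fun e => by rw [map_cubicMon, hx, hy, hz]
  have hmem : ∀ g : hookIdx m a s → L, ∑ e, g e • cubicMon (x F L) (y F L) (z F L) e ∈
      cubicFil L (x F L) (y F L) (z F L) m := fun g => sum_mem fun e _ =>
    Submodule.smul_mem _ _ (cubicMon_mem_cubicFil (mem_hookIdx.1 e.2).1)
  have hmem' : ∀ g : hookIdx m a s → L, ∑ e, g e • cubicMon (x F L) (y F L) (z F L) e ∈
      monIdeal (x F L) (y F L) (hookSet a s) := fun g => sum_mem fun e _ => by
    rw [Algebra.smul_def]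
    exact Ideal.mul_mem_left _ _ (cubicMon_mem_monIdeal (mem_hookIdx.1 e.2).2)
  have hs : cubicFil L (x F L) (y F L) (z F L) (2 * m + 1) ≤
      (cubicFil L (x F L) (y F L) (z F L) (m + 1)).map (LinearMap.mulLeft L A) ⊔
      (cubicFil L (x F L) (y F L) (z F L) (m + 1)).map (LinearMap.mulLeft L B) ⊔
        cubicBox L (x F L) (y F L) (z F L) m := by
    rw [cubicFil_le_iff]
    intro e he
    have hmul : ∀ (D : CubicRing F L) (ν : expIdx (m + 1)),
        cubicMon (x F L) (y F L) (z F L) ν * D ∈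
          (cubicFil L (x F L) (y F L) (z F L) (m + 1)).map (LinearMap.mulLeft L D) :=
      fun D ν => ⟨_, cubicMon_mem_cubicFil (mem_expIdx.1 ν.2), mul_comm _ _⟩
    refine G.mem_of_det_ne_zero hE (mμ := fun e => cubicMon (x F L) (y F L) (z F L) e)
      (mN := fun e => cubicMon (x F L) (y F L) (z F L) e)
      (mX := fun e => cubicMon (x F L) (y F L) (z F L) e)
      (mR := fun e => cubicMon (x F L) (y F L) (z F L) e) ?_ ?_ ?_ ?_ ?_ ⟨e, mem_expIdx.2 he⟩
    · intro ν j
      simpa [hmon] using congrArg f (hT ν j)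
    · intro υ
      simpa [hmon] using congrArg f (hJ υ)
    · intro ν
      rw [← hA]
      exact Submodule.mem_sup_left (Submodule.mem_sup_left (hmul A ν))
    · intro ν
      rw [← hB]
      exact Submodule.mem_sup_left (Submodule.mem_sup_right (hmul B ν))
    · intro υ
      refine Submodule.mem_sup_right (Submodule.subset_span ⟨_, ?_, rfl⟩)
      have := υ.2
      simp only [boxIdx, Finset.mem_product, Finset.mem_range] at this
      exact ⟨this.1, this.2.1⟩
  have hA0 := hC.ne_zero_of_le hm hs
  have hB0 := hC.ne_zero_of_le hm (A := B) (B := A) (hs.trans (sup_le_sup_right (sup_comm _ _).le _))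
  exact ⟨hC.finrank_quotient_span_pair hm (hA ▸ hmem _) (hB ▸ hmem _) hA0 hB0 hs,
    hA ▸ hmem' _, hB ▸ hmem' _⟩

end Construction

section Sections

open MvPolynomial

theorem derivation_aeval {σ k S : Type*} [Fintype σ] [CommRing k] [CommRing S] [Algebra k S]
    (D : Derivation k S S) (f : σ → S) (F : MvPolynomial σ k) :
    D (aeval f F) = ∑ i, aeval f (pderiv i F) * D (f i) := by
  classical
  induction F using MvPolynomial.induction_on with
  | C a => simp
  | add p q hp hq => simp [hp, hq, add_mul, Finset.sum_add_distrib]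
  | mul_X p j hp =>
    have h : ∀ i, aeval f (pderiv i (p * X j)) * D (f i) =
        f j * (aeval f (pderiv i p) * D (f i)) +
          aeval f p * (if i = j then D (f i) else 0) := by
      intro i
      rw [Derivation.leibniz, pderiv_X]
      by_cases hij : i = j
      · subst hij; simp; ring
      · simp [hij, Ne.symm hij]; ring
    simp only [h, Finset.sum_add_distrib, ← Finset.mul_sum, ← hp]
    simp; ring

theorem exists_aeval_eq_zero_of_isHomogeneous {k : Type*} [Field k] [IsAlgClosed k]
    {n : ℕ} {Q : MvPolynomial (Fin 2) k} (hQ : Q.IsHomogeneous n) (hn : n ≠ 0) :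
    ∃ u : Fin 2 → k, u ≠ 0 ∧ aeval u Q = 0 := by
  let p : Polynomial k := aeval ![1, Polynomial.X] Q
  let q : Polynomial k := aeval ![Polynomial.X, 1] Q
  have hp : ∀ w, p.eval w = aeval ![1, w] Q := by
    intro w
    rw [← Polynomial.coe_aeval_eq_eval]
    change Polynomial.aeval w (aeval ![1, Polynomial.X] Q) = _
    rw [comp_aeval_apply]
    congr 2
    ext j
    fin_cases j <;> simp
  have hq : ∀ w, q.eval w = aeval ![w, 1] Q := by
    intro w
    rw [← Polynomial.coe_aeval_eq_eval]
    change Polynomial.aeval w (aeval ![Polynomial.X, 1] Q) = _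
    rw [comp_aeval_apply]
    congr 2
    ext j
    fin_cases j <;> simp
  by_cases hroot : ∃ w, p.eval w = 0
  · obtain ⟨w, hw⟩ := hroot
    exact ⟨![1, w], fun h => one_ne_zero (congrFun h 0), (hp w).symm.trans hw⟩
  · have hdeg : p.degree = 0 := by
      by_contra h
      exact hroot (IsAlgClosed.exists_root p h)
    obtain ⟨c, hc⟩ : ∃ c, p = Polynomial.C c :=
      ⟨_, Polynomial.eq_C_of_degree_le_zero hdeg.le⟩
    have hqc : q * Polynomial.X = Polynomial.C c * Polynomial.X ^ n * Polynomial.X := by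
      refine Polynomial.funext fun v => ?_
      by_cases hv : v = 0
      · simp [hv]
      · have h := hQ.aeval_mul v ![1, v⁻¹]
        have h2 : (fun i => v * ![1, v⁻¹] i) = ![v, 1] := by
          ext i
          fin_cases i <;> simp [hv]
        rw [h2, ← hq, ← hp, hc] at h
        simp only [Polynomial.eval_mul, h]
        simp [mul_comm]
    have hq' := mul_right_cancel₀ Polynomial.X_ne_zero hqc
    refine ⟨![0, 1], fun h => one_ne_zero (congrFun h 1), ?_⟩
    rw [← hq, hq']
    simp [hn]

theorem totalDegree_le_one_of_aeval_eq_zero {k : Type*} [Field k] {F : MvPolynomial (Fin 4) k}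
    (hF : F.IsHomogeneous 3) (h1 : coeff (Finsupp.single 3 3) F = 1)
    {L : Type*} [Field L] [Algebra k L] {a : MvPolynomial (Fin 2) L}
    (ha : aeval ![1, X 0, X 1, a] F = 0) : a.totalDegree ≤ 1 := by
  rw [aeval_eq_pow_add_sum h1] at ha
  by_contra! h
  have h3 : (a ^ 3).totalDegree = 3 * a.totalDegree := by
    have h0 : a ≠ 0 := by rintro rfl; simp at h
    rw [pow_succ, pow_two, totalDegree_mul_of_isDomain (mul_ne_zero h0 h0) h0,
      totalDegree_mul_of_isDomain h0 h0]
    ring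
  rw [eq_neg_of_add_eq_zero_left ha, totalDegree_neg] at h3
  have h4 : (∑ m ∈ lowerSupport F, coeff m F •
      ((X 0 : MvPolynomial (Fin 2) L) ^ m 1 * X 1 ^ m 2 * a ^ m 3)).totalDegree ≤
        2 * a.totalDegree + 1 := by
    refine totalDegree_finsetSum_le fun m hm => ?_
    obtain ⟨h5, h6⟩ := le_of_mem_lowerSupport hF hm
    rw [← algebraMap_smul L]
    refine (totalDegree_smul_le _ _).trans ?_
    refine (totalDegree_mul _ _).trans ?_
    have h7 := totalDegree_mul ((X 0 : MvPolynomial (Fin 2) L) ^ m 1) (X 1 ^ m 2)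
    rw [totalDegree_X_pow, totalDegree_X_pow] at h7
    have h8 := totalDegree_pow a (m 3)
    have h9 : m 3 = 0 ∨ m 3 = 1 ∨ m 3 = 2 := by omega
    rcases h9 with h9 | h9 | h9 <;> rw [h9] at h8 ⊢ <;> omega
  omega

theorem eq_of_totalDegree_le_one {L : Type*} [Field L] {a : MvPolynomial (Fin 2) L}
    (ha : a.totalDegree ≤ 1) :
    a = C (coeff 0 a) + C (coeff (Finsupp.single 0 1) a) * X 0 +
      C (coeff (Finsupp.single 1 1) a) * X 1 := by
  ext m
  simp only [coeff_add, coeff_C, coeff_C_mul, coeff_X]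
  by_cases hm : m 0 + m 1 ≤ 1
  · have h : m = 0 ∨ m = Finsupp.single 0 1 ∨ m = Finsupp.single 1 1 := by
      have : (m 0 = 0 ∧ m 1 = 0) ∨ (m 0 = 1 ∧ m 1 = 0) ∨ (m 0 = 0 ∧ m 1 = 1) := by omega
      rcases this with h | h | h
      · left; ext i; fin_cases i <;> simp [h]
      · right; left; ext i; fin_cases i <;> simp [h]
      · right; right; ext i; fin_cases i <;> simp [h]
    have e1 : (0 : Fin 2 →₀ ℕ) ≠ Finsupp.single 0 1 := fun h => by simpa using DFunLike.congr_fun h 0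
    have e2 : (0 : Fin 2 →₀ ℕ) ≠ Finsupp.single 1 1 := fun h => by simpa using DFunLike.congr_fun h 1
    have e3 : (Finsupp.single 0 1 : Fin 2 →₀ ℕ) ≠ Finsupp.single 1 1 :=
      fun h => by simpa using DFunLike.congr_fun h 0
    rcases h with rfl | rfl | rfl <;> simp [e1, e2, e3, e1.symm, e2.symm, e3.symm]
  · have h0 : coeff m a = 0 := by
      by_contra h
      have := le_totalDegree (mem_support_iff.2 h)
      rw [Finsupp.sum_fintype _ _ (by simp), Fin.sum_univ_two] at this
      omega
    have e1 : (0 : Fin 2 →₀ ℕ) ≠ m := by rintro rfl; simp at hm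
    have e2 : Finsupp.single (0 : Fin 2) 1 ≠ m := by rintro rfl; simp at hm
    have e3 : Finsupp.single (1 : Fin 2) 1 ≠ m := by rintro rfl; simp at hm
    simp [h0, e1, e2, e3]

/-- A smooth cubic surface contains no plane curve component: no affine-linear function solves
its equation. -/
theorem aeval_linear_ne_zero {K : Type*} [Field K] [IsAlgClosed K] {k : Type*} [Field k]
    [Algebra k K] {F : MvPolynomial (Fin 4) k} (hF : F.IsHomogeneous 3)
    (hsmooth : ∀ a : Fin 4 → K, aeval a F = 0 → (∀ i, aeval a (pderiv i F) = 0) → a = 0)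
    (a b c : K) : aeval ![1, X 0, X 1, C a + C b * X 0 + C c * (X 1 : MvPolynomial (Fin 2) K)] F ≠ 0 := by
  intro h
  let u : Fin 4 → MvPolynomial (Fin 3) K := ![X 0, X 1, X 2, C a * X 0 + C b * X 1 + C c * X 2]
  have hu : ∀ (w : Fin 3 → K) (G : MvPolynomial (Fin 4) k), aeval w (aeval u G) =
      aeval ![w 0, w 1, w 2, a * w 0 + b * w 1 + c * w 2] G := by
    intro w G
    have := comp_aeval_apply (R := k) (f := u) ((aeval w : MvPolynomial (Fin 3) K →ₐ[K] K).restrictScalars k) G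
    refine this.trans ?_
    congr 2
    ext j
    fin_cases j <;> simp [u]
  have hg : aeval u F = 0 := by
    refine (mul_eq_zero.1 (?_ : aeval u F * X 0 = 0)).resolve_right (X_ne_zero 0)
    refine MvPolynomial.funext fun w => ?_
    rw [← coe_aeval_eq_eval]
    by_cases hw : w 0 = 0
    · simp [hw]
    · have h2 := congrArg ((aeval ![(w 0)⁻¹ * w 1, (w 0)⁻¹ * w 2] :
        MvPolynomial (Fin 2) K →ₐ[K] K).restrictScalars k) h
      rw [comp_aeval_apply, map_zero] at h2
      have h3 := hF.aeval_mul (w 0) (fun i => ((aeval ![(w 0)⁻¹ * w 1, (w 0)⁻¹ * w 2] :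
        MvPolynomial (Fin 2) K →ₐ[K] K).restrictScalars k)
          (![1, X 0, X 1, C a + C b * X 0 + C c * (X 1 : MvPolynomial (Fin 2) K)] i))
      rw [h2, mul_zero] at h3
      change aeval w _ = aeval w 0
      rw [map_mul, hu, map_zero]
      refine mul_eq_zero_of_left ?_ _
      rw [← h3]
      congr 2
      ext j
      fin_cases j
      · simp
      · simp [hw]
      · simp [hw]
      · simp; field_simp
  have hder : ∀ j : Fin 3, aeval u (pderiv j.castSucc F) + C (![a, b, c] j) * aeval u (pderiv 3 F) = 0 := by
    intro j
    have h2 := derivation_aeval ((pderiv j : Derivation K (MvPolynomial (Fin 3) K) _).restrictScalars k) u F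
    rw [hg, map_zero, Fin.sum_univ_four] at h2
    rw [h2]
    fin_cases j <;> simp [u, pderiv_X, Derivation.leibniz] <;> ring
  have hQ : IsHomogeneous (aeval ![X 0, X 1, 0, C a * X 0 + C b * (X 1 : MvPolynomial (Fin 2) K)]
      (pderiv 3 F)) (1 * 2) := by
    refine IsHomogeneous.aeval (R := k) (S := K) (hF.pderiv (i := 3)) (n := 1) _ fun i => ?_
    fin_cases i
    · exact isHomogeneous_X _ _
    · exact isHomogeneous_X _ _
    · exact isHomogeneous_zero _ _ _
    · exact (isHomogeneous_C_mul_X _ _).add (isHomogeneous_C_mul_X _ _)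
  obtain ⟨v, hv, hv0⟩ := exists_aeval_eq_zero_of_isHomogeneous hQ (by norm_num)
  let w : Fin 3 → K := ![v 0, v 1, 0]
  have hw : aeval w (aeval u (pderiv 3 F)) = 0 := by
    rw [hu, ← hv0]
    have := comp_aeval_apply (R := k)
      (f := ![X 0, X 1, 0, C a * X 0 + C b * (X 1 : MvPolynomial (Fin 2) K)])
      ((aeval v : MvPolynomial (Fin 2) K →ₐ[K] K).restrictScalars k) (pderiv 3 F)
    refine Eq.trans ?_ this.symm
    congr 2
    ext j
    fin_cases j <;> simp [w]
  have h4 := hsmooth ![w 0, w 1, w 2, a * w 0 + b * w 1 + c * w 2]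
    (by rw [← hu, hg, map_zero]) (by
      have h5 : ∀ j : Fin 3, aeval w (aeval u (pderiv j.castSucc F)) = 0 := by
        intro j
        have := congrArg (aeval w) (hder j)
        rwa [map_add, map_mul, hw, mul_zero, add_zero, map_zero] at this
      intro i
      rw [← hu]
      refine Fin.lastCases ?_ (fun j => ?_) i
      · exact hw
      · exact h5 j)
  refine hv ?_
  ext i
  fin_cases i
  · exact congrFun h4 0
  · exact congrFun h4 1

end Sections

section Fibers

open MvPolynomial

/-- The polynomial `F (1, α, β, Z)` in one variable `Z`. -/
noncomputable def fiberPoly {k : Type*} [CommRing k] (F : MvPolynomial (Fin 4) k) {L : Type*}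
    [CommRing L] [Algebra k L] (α β : L) : Polynomial L :=
  aeval ![1, Polynomial.C α, Polynomial.C β, Polynomial.X] F

theorem aeval_fiberPoly {k : Type*} [CommRing k] (F : MvPolynomial (Fin 4) k) {L : Type*}
    [CommRing L] [Algebra k L] (α β : L) {S : Type*} [CommRing S] [Algebra L S] [Algebra k S]
    [IsScalarTower k L S] (c : S) : Polynomial.aeval c (fiberPoly F α β) =
      aeval ![1, algebraMap L S α, algebraMap L S β, c] F := by
  have := comp_aeval_apply (R := k) (f := ![1, Polynomial.C α, Polynomial.C β, Polynomial.X])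
    ((Polynomial.aeval c : Polynomial L →ₐ[L] S).restrictScalars k) F
  refine this.trans ?_
  congr 2
  ext j
  fin_cases j <;> simp

theorem map_aeval_one {k : Type*} [CommRing k] (F : MvPolynomial (Fin 4) k) {S S' : Type*}
    [CommRing S] [CommRing S'] [Algebra k S] [Algebra k S'] (f : S →ₐ[k] S') (a b c : S) :
    f (aeval ![1, a, b, c] F) = aeval ![1, f a, f b, f c] F := by
  rw [comp_aeval_apply]
  congr 2
  ext1 j
  fin_cases j <;> simp

variable {k : Type*} [Field k] {F : MvPolynomial (Fin 4) k}

theorem fiberPoly_monic_natDegree (hF : F.IsHomogeneous 3)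
    (h1 : coeff (Finsupp.single 3 3) F = 1) {L : Type*} [CommRing L] [Nontrivial L] [Algebra k L]
    (α β : L) : (fiberPoly F α β).Monic ∧ (fiberPoly F α β).natDegree = 3 := by
  obtain ⟨hm, hd⟩ := CubicRing.monic_natDegree (L := k) hF h1
  have h : fiberPoly F α β = (cubicPoly F k).map
      (aeval ![α, β] : MvPolynomial (Fin 2) k →ₐ[k] L).toRingHom := by
    have := map_aeval_one F
      (Polynomial.mapAlgHom (aeval ![α, β] : MvPolynomial (Fin 2) k →ₐ[k] L))
      (Polynomial.C (X 0)) (Polynomial.C (X 1)) Polynomial.X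
    refine Eq.trans ?_ this.symm
    rw [fiberPoly]
    congr 2
    ext1 j
    fin_cases j <;> simp
  rw [h]
  exact ⟨hm.map _, by rw [hm.natDegree_map, hd]⟩

theorem irreducible_fiberPoly (hF : F.IsHomogeneous 3)
    (h1 : coeff (Finsupp.single 3 3) F = 1) {L : Type*} [Field L] [Algebra k L] {α β : L}
    (h : ∀ c : L, aeval ![1, α, β, c] F ≠ 0) : Irreducible (fiberPoly F α β) := by
  obtain ⟨hm, hd⟩ := fiberPoly_monic_natDegree hF h1 α β
  rw [hm.irreducible_iff_roots_eq_zero_of_degree_le_three (by omega) (by omega),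
    Multiset.eq_zero_iff_forall_notMem]
  intro c hc
  rw [Polynomial.mem_roots hm.ne_zero, Polynomial.IsRoot.def, ← Polynomial.coe_aeval_eq_eval] at hc
  exact h c ((aeval_fiberPoly F α β c).symm.trans hc)

theorem exists_injective_aeval_eq_zero [PerfectField k] (hF : F.IsHomogeneous 3)
    (h1 : coeff (Finsupp.single 3 3) F = 1) {Ω : Type*} [Field Ω] [IsAlgClosed Ω] [Algebra k Ω]
    {α β : k} (h : ∀ c : k, aeval ![1, α, β, c] F ≠ 0) :
    ∃ z : Fin 3 → Ω, Function.Injective z ∧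
      ∀ l, aeval ![1, algebraMap k Ω α, algebraMap k Ω β, z l] F = 0 := by
  obtain ⟨hm, hd⟩ := fiberPoly_monic_natDegree hF h1 α β
  have hsep := PerfectField.separable_of_irreducible (irreducible_fiberPoly hF h1 h)
  have hcard := Polynomial.card_rootSet_eq_natDegree (K := Ω) hsep (IsAlgClosed.splits _)
  rw [hd] at hcard
  let e := (Fintype.equivFinOfCardEq hcard).symm
  refine ⟨fun l => e l, Subtype.val_injective.comp e.injective, fun l => ?_⟩
  have h2 := (e l).2
  rw [Polynomial.mem_rootSet, aeval_fiberPoly] at h2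
  exact h2.2

theorem aeval_ne_zero_of_isIntegrallyClosed (hF : F.IsHomogeneous 3)
    (h1 : coeff (Finsupp.single 3 3) F = 1) {O k' : Type*} [CommRing O] [IsDomain O]
    [IsIntegrallyClosed O] [Algebra k O] [Field k'] [Algebra O k'] [IsFractionRing O k']
    [Algebra k k'] [IsScalarTower k O k'] (res : O →ₐ[k] k)
    (h : ∀ c : k, aeval ![1, 0, 0, c] F ≠ 0) (c : k') : aeval ![1, 0, 0, c] F ≠ 0 := by
  intro hc
  have hint : IsIntegral O c := by
    obtain ⟨hm, -⟩ := fiberPoly_monic_natDegree hF h1 (0 : k) 0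
    have : IsIntegral k c := ⟨_, hm, by
      have := aeval_fiberPoly F (0 : k) 0 c
      rw [map_zero, hc] at this
      exact this⟩
    exact this.tower_top
  obtain ⟨b, rfl⟩ := IsIntegrallyClosed.isIntegral_iff.1 hint
  have hb : aeval ![1, 0, 0, b] F = 0 := by
    apply IsFractionRing.injective O k'
    have := map_aeval_one F (IsScalarTower.toAlgHom k O k') 0 0 b
    rw [map_zero, IsScalarTower.coe_toAlgHom', hc] at this
    rw [this, map_zero]
  refine h (res b) ?_
  have := map_aeval_one F res 0 0 b
  rwa [hb, map_zero, eq_comm] at this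

namespace CubicRing

theorem algHom_ext (hF : F.IsHomogeneous 3) (h1 : coeff (Finsupp.single 3 3) F = 1)
    {L : Type*} [Field L] [Algebra k L] {S : Type*} [CommRing S] [Algebra L S]
    {f g : CubicRing F L →ₐ[L] S} (hx : f (x F L) = g (x F L)) (hy : f (y F L) = g (y F L))
    (hz : f (z F L) = g (z F L)) : f = g := by
  have h : f.toLinearMap = g.toLinearMap := by
    refine LinearMap.ext_on_range (top_le_iff.1 (isCubicFrame (L := L) hF h1).span) fun e => ?_
    simp [map_cubicMon, hx, hy, hz]
  exact AlgHom.toLinearMap_injective h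

theorem isMaximal_span_x_y (hF : F.IsHomogeneous 3) (h1 : coeff (Finsupp.single 3 3) F = 1)
    {L : Type*} [Field L] [Algebra k L] (h : ∀ c : L, aeval ![1, 0, 0, c] F ≠ 0) :
    (Ideal.span {x F L, y F L}).IsMaximal := by
  have : Fact (Irreducible (fiberPoly F (0 : L) 0)) := ⟨irreducible_fiberPoly hF h1 h⟩
  let κ := AdjoinRoot (fiberPoly F (0 : L) 0)
  let Q := CubicRing F L ⧸ Ideal.span {x F L, y F L}
  let q : CubicRing F L →ₐ[L] Q := Ideal.Quotient.mkₐ L _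
  have hqx : q (x F L) = 0 := Ideal.Quotient.eq_zero_iff_mem.2 (Ideal.subset_span (by simp))
  have hqy : q (y F L) = 0 := Ideal.Quotient.eq_zero_iff_mem.2 (Ideal.subset_span (by simp))
  have hκ : aeval ![1, 0, 0, (AdjoinRoot.root _ : κ)] F = 0 := by
    have := aeval_fiberPoly F (0 : L) 0 (AdjoinRoot.root _ : κ)
    rw [map_zero] at this
    rw [← this]
    simp
  obtain ⟨ev, evx, evy, evz⟩ := exists_lift (F := F) (L := L) _ _ _ hκ
  have hQ : Polynomial.aeval (q (z F L)) (fiberPoly F (0 : L) 0) = 0 := by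
    rw [aeval_fiberPoly, map_zero]
    have := map_aeval_one F (q.restrictScalars k) (x F L) (y F L) (z F L)
    rw [aeval_eq_zero, map_zero] at this
    simp only [AlgHom.restrictScalars_apply, hqx, hqy] at this
    exact this.symm
  let ψ : κ →ₐ[L] Q := AdjoinRoot.liftAlgHom _ (Algebra.ofId L Q) (q (z F L)) hQ
  have hψ : ψ.comp ev = q := by
    apply algHom_ext hF h1
    · simp [evx, hqx]
    · simp [evy, hqy]
    · rw [AlgHom.comp_apply, evz]
      exact AdjoinRoot.lift_root hQ
  have hne : Ideal.span {x F L, y F L} ≠ ⊤ := by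
    intro htop
    have hle : Ideal.span {x F L, y F L} ≤ RingHom.ker ev := by
      rw [Ideal.span_le]
      rintro _ (rfl | rfl) <;> simp [RingHom.mem_ker, evx, evy]
    rw [htop] at hle
    exact one_ne_zero ((map_one ev).symm.trans (hle (Submodule.mem_top : (1 : CubicRing F L) ∈ _)))
  have : Nontrivial Q := Ideal.Quotient.nontrivial_iff.2 hne
  have hsurj : Function.Surjective ψ := by
    intro c
    obtain ⟨c, rfl⟩ := Ideal.Quotient.mk_surjective c
    exact ⟨ev c, DFunLike.congr_fun hψ c⟩
  have hbij : Function.Bijective ψ := ⟨ψ.toRingHom.injective, hsurj⟩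
  refine Ideal.Quotient.maximal_of_isField _ ?_
  exact MulEquiv.isField (Field.toIsField κ) (RingEquiv.ofBijective ψ hbij).symm.toMulEquiv

theorem isDomain_of_aeval_ne_zero (hF : F.IsHomogeneous 3)
    (h1 : coeff (Finsupp.single 3 3) F = 1) {L : Type*} [Field L] [Algebra k L]
    (h : ∀ c : L, aeval ![1, 0, 0, c] F ≠ 0) : IsDomain (CubicRing F L) := by
  refine isDomain hF h1 fun a ha => h (aeval ![0, 0] a) ?_
  have := map_aeval_one F
    ((aeval ![0, 0] : MvPolynomial (Fin 2) L →ₐ[L] L).restrictScalars k) (X 0) (X 1) a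
  rw [ha, map_zero] at this
  simpa using this.symm

theorem isDomain_of_smooth {K : Type*} [Field K] [IsAlgClosed K] [Algebra k K]
    (hF : F.IsHomogeneous 3) (h1 : coeff (Finsupp.single 3 3) F = 1)
    (hsmooth : ∀ a : Fin 4 → K, aeval a F = 0 → (∀ i, aeval a (pderiv i F) = 0) → a = 0)
    {L : Type*} [Field L] [Algebra k L] [Algebra K L] [IsScalarTower k K L] :
    IsDomain (CubicRing F L) := by
  refine isDomain hF h1 fun a ha => ?_
  have hval : ∀ α β : K, ∃ c : K, algebraMap K L c =
      aeval ![algebraMap K L α, algebraMap K L β] a := by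
    intro α β
    obtain ⟨hm, -⟩ := fiberPoly_monic_natDegree hF h1 α β
    have h2 : Polynomial.aeval (aeval ![algebraMap K L α, algebraMap K L β] a)
        (fiberPoly F α β) = 0 := by
      rw [aeval_fiberPoly]
      have := map_aeval_one F ((aeval ![algebraMap K L α, algebraMap K L β] :
        MvPolynomial (Fin 2) L →ₐ[L] L).restrictScalars k) (X 0) (X 1) a
      rw [ha, map_zero] at this
      simpa using this.symm
    have h3 : IsIntegral K (aeval ![algebraMap K L α, algebraMap K L β] a) := ⟨_, hm, h2⟩
    exact minpoly.mem_range_of_degree_eq_one K _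
      (IsAlgClosed.degree_eq_one_of_irreducible K (minpoly.irreducible h3))
  have ha1 := eq_of_totalDegree_le_one (totalDegree_le_one_of_aeval_eq_zero hF h1 ha)
  set A := coeff 0 a
  set B := coeff (Finsupp.single 0 1) a
  set B' := coeff (Finsupp.single 1 1) a
  obtain ⟨c0, hc0⟩ := hval 0 0
  obtain ⟨c1, hc1⟩ := hval 1 0
  obtain ⟨c2, hc2⟩ := hval 0 1
  rw [ha1] at hc0 hc1 hc2
  simp only [map_add, map_mul, aeval_X, aeval_C, Algebra.algebraMap_self, RingHom.id_apply,
    map_zero, map_one, Matrix.cons_val_zero, Matrix.cons_val_one, mul_zero, mul_one,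
    add_zero] at hc0 hc1 hc2
  refine aeval_linear_ne_zero hF hsmooth c0 (c1 - c0) (c2 - c0) ?_
  apply map_injective (σ := Fin 2) _ (algebraMap K L).injective
  have := map_aeval_one F ((mapAlgHom (σ := Fin 2) (Algebra.ofId K L)).restrictScalars k)
    (X 0) (X 1) (C c0 + C (c1 - c0) * X 0 + C (c2 - c0) * (X 1 : MvPolynomial (Fin 2) K))
  rw [map_zero]
  refine this.trans (Eq.trans ?_ ha)
  congr 2
  ext1 j
  rw [ha1]
  fin_cases j <;> simp [hc0, hc1, hc2]

end CubicRing

end Fibers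

section Density

open MvPolynomial

theorem exists_basis_det_embeddings_ne_zero {k K Ω : Type*} [Field k] [Field K] [Algebra k K]
    [FiniteDimensional k K] [Algebra.IsSeparable k K] [Field Ω] [IsAlgClosed Ω] [Algebra k Ω]
    [DecidableEq (K →ₐ[k] Ω)] :
    ∃ b : Module.Basis (K →ₐ[k] Ω) k K,
      (Matrix.of fun i j : K →ₐ[k] Ω => i (b j)).det ≠ 0 := by
  have hc : Module.finrank k K = Fintype.card (K →ₐ[k] Ω) := (AlgHom.card k K Ω).symm
  let b := (Module.finBasis k K).reindex (Fintype.equivFinOfCardEq hc.symm).symm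
  refine ⟨b, fun h => ?_⟩
  obtain ⟨v, hv, hv0⟩ := Matrix.exists_vecMul_eq_zero_iff.2 h
  have hli := linearIndependent_toLinearMap k K Ω
  rw [Fintype.linearIndependent_iff] at hli
  refine hv (funext (hli v ?_))
  refine b.ext fun j => ?_
  simpa [Matrix.vecMul, dotProduct] using congrFun hv0 j

theorem eq_zero_of_vanish_on_conjugates {k K Ω : Type*} [Field k] [Infinite k] [Field K]
    [Algebra k K] [FiniteDimensional k K] [Algebra.IsSeparable k K] [Field Ω] [IsAlgClosed Ω]
    [Algebra k Ω] {τ : Type*} {γ : MvPolynomial ((K →ₐ[k] Ω) × τ) Ω}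
    (h : ∀ u : τ → K, aeval (fun e : (K →ₐ[k] Ω) × τ => e.1 (u e.2)) γ = 0) : γ = 0 := by
  classical
  obtain ⟨b, hb⟩ := exists_basis_det_embeddings_ne_zero (k := k) (K := K) (Ω := Ω)
  set V : Matrix (K →ₐ[k] Ω) (K →ₐ[k] Ω) Ω := Matrix.of fun i j => i (b j) with hV
  let φ : MvPolynomial ((K →ₐ[k] Ω) × τ) Ω :=
    aeval (fun e : (K →ₐ[k] Ω) × τ => ∑ j, C (V e.1 j) * X (j, e.2)) γ
  have hφ : ∀ c : (K →ₐ[k] Ω) × τ → Ω, aeval c φ =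
      aeval (fun e : (K →ₐ[k] Ω) × τ => ∑ j, V e.1 j * c (j, e.2)) γ := by
    intro c
    simp only [φ, comp_aeval_apply]
    simp
  have hφ0 : φ = 0 := by
    refine funext_set (fun _ => Set.range (algebraMap k Ω))
      (fun _ => Set.infinite_range_of_injective (algebraMap k Ω).injective) fun c hc => ?_
    have hc' : ∀ e, ∃ a : k, algebraMap k Ω a = c e := fun e => hc e trivial
    choose a ha using hc'
    rw [map_zero]
    refine (hφ c).trans ?_
    rw [← h (fun l => ∑ j, a (j, l) • b j)]
    congr 2
    ext e
    rw [map_sum]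
    refine Finset.sum_congr rfl fun j _ => ?_
    rw [map_smul, ← ha, hV, Matrix.of_apply, Algebra.smul_def, mul_comm]
  refine MvPolynomial.funext fun P => ?_
  rw [map_zero]
  have h2 := hφ (fun e => (V⁻¹.mulVec fun j => P (j, e.2)) e.1)
  rw [hφ0, map_zero] at h2
  change aeval P γ = 0
  rw [h2]
  congr 2
  ext e
  have h3 : V.mulVec (V⁻¹.mulVec fun j => P (j, e.2)) = fun j => P (j, e.2) := by
    rw [Matrix.mulVec_mulVec, Matrix.mul_nonsing_inv _ (isUnit_iff_ne_zero.2 hb), Matrix.one_mulVec]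
  exact (congrFun h3 e.1).symm

theorem CubicRing.eq_zero_of_vanish_on_sections {k Ω : Type*} [Field k]
    {F : MvPolynomial (Fin 4) k} (hF : F.IsHomogeneous 3)
    (h1 : coeff (Finsupp.single 3 3) F = 1) [Field Ω] [Algebra k Ω] [IsDomain (CubicRing F Ω)]
    {s : Fin 2 → Set Ω} (hs : ∀ i, (s i).Infinite) {H : MvPolynomial (Fin 3) Ω}
    (h : ∀ α ∈ s 0, ∀ β ∈ s 1, ∃ γ, aeval ![1, α, β, γ] F = 0 ∧ aeval ![α, β, γ] H = 0)
    {P : Fin 3 → Ω} (hP : aeval ![1, P 0, P 1, P 2] F = 0) : aeval P H = 0 := by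
  obtain ⟨hm, -⟩ := monic_natDegree (L := Ω) hF h1
  set η : CubicRing F Ω := aeval ![x F Ω, y F Ω, z F Ω] H
  have hlift : ∀ (f : CubicRing F Ω →ₐ[Ω] Ω),
      f η = aeval ![f (x F Ω), f (y F Ω), f (z F Ω)] H := by
    intro f
    rw [comp_aeval_apply]
    congr 2
    ext1 j
    fin_cases j <;> simp
  by_cases hη : η = 0
  · obtain ⟨f, h2, h3, h4⟩ := exists_lift (F := F) (L := Ω) _ _ _ hP
    have h5 := hlift f
    rw [hη, map_zero, h2, h3, h4] at h5
    rw [h5]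
    congr 2
    ext1 j
    fin_cases j <;> simp
  exfalso
  have := hm.finite_adjoinRoot
  have hint : IsIntegral (MvPolynomial (Fin 2) Ω) η := Algebra.IsIntegral.isIntegral η
  have hne := Ideal.comap_ne_bot_of_integral_mem hη (Ideal.mem_span_singleton_self η) hint
  obtain ⟨ρ, hρ, hρ0⟩ := Submodule.exists_mem_ne_zero_of_ne_bot hne
  refine hρ0 (funext_set s hs fun w hw => ?_)
  obtain ⟨γ, hγ, hγ'⟩ := h (w 0) (hw 0 trivial) (w 1) (hw 1 trivial)
  obtain ⟨f, h2, h3, h4⟩ := exists_lift (F := F) (L := Ω) _ _ _ hγ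
  have h5 : f η = 0 := by rw [hlift, h2, h3, h4, hγ']
  obtain ⟨c, hc⟩ := Ideal.mem_span_singleton.1 (Ideal.mem_comap.1 hρ)
  have h6 : (f.comp (IsScalarTower.toAlgHom Ω (MvPolynomial (Fin 2) Ω) (CubicRing F Ω))) =
      aeval w := by
    ext j
    fin_cases j
    · exact h2.trans (aeval_X _ _).symm
    · exact h3.trans (aeval_X _ _).symm
  have h7 := DFunLike.congr_fun h6 ρ
  rw [AlgHom.comp_apply, IsScalarTower.coe_toAlgHom', hc, map_mul, h5, zero_mul] at h7
  rw [map_zero]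
  exact h7.symm

theorem aeval_eq_zero_of_coordinatewise {k Ω ι σ : Type*} [Field k] [Field Ω] [Algebra k Ω]
    [Fintype ι] {G : MvPolynomial (ι × σ) k} {V : Set (σ → Ω)} {S : ι → Set (σ → Ω)}
    (hS : ∀ i, ∀ H : MvPolynomial σ Ω, (∀ z ∈ S i, aeval z H = 0) → ∀ z ∈ V, aeval z H = 0)
    (hG : ∀ P : ι → σ → Ω, (∀ i, P i ∈ S i) → aeval (fun e : ι × σ => P e.1 e.2) G = 0)
    {P : ι → σ → Ω} (hP : ∀ i, P i ∈ V) : aeval (fun e : ι × σ => P e.1 e.2) G = 0 := by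
  classical
  suffices ∀ (T : Finset ι) (P : ι → σ → Ω), (∀ i ∈ T, P i ∈ V) → (∀ i ∉ T, P i ∈ S i) →
      aeval (fun e : ι × σ => P e.1 e.2) G = 0 from
    this Finset.univ P (fun i _ => hP i) (fun i hi => absurd (Finset.mem_univ i) hi)
  intro T
  induction T using Finset.induction_on with
  | empty => exact fun P _ h2 => hG P fun i => h2 i (by simp)
  | insert i T hi ih =>
    intro P h2 h3
    let H : MvPolynomial σ Ω :=
      aeval (fun e : ι × σ => if e.1 = i then X e.2 else C (P e.1 e.2)) G
    have hH : ∀ w, aeval w H = aeval (fun e : ι × σ => Function.update P i w e.1 e.2) G := by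
      intro w
      have := comp_aeval_apply (R := k)
        (f := fun e : ι × σ => if e.1 = i then X e.2 else C (P e.1 e.2))
        ((aeval w : MvPolynomial σ Ω →ₐ[Ω] Ω).restrictScalars k) G
      refine this.trans ?_
      congr 2
      ext e
      by_cases he : e.1 = i
      · obtain ⟨e1, e2⟩ := e; subst he; simp
      · simp [he]
    have h4 := hS i H (fun w hw => by
      rw [hH]
      refine ih _ (fun j hj => ?_) (fun j hj => ?_)
      · have : j ≠ i := fun h => hi (h ▸ hj)
        simpa [this] using h2 j (Finset.mem_insert_of_mem hj)
      · by_cases hji : j = i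
        · subst hji; simpa using hw
        · simpa [hji] using h3 j (by simp [hji, hj])) (P i) (h2 i (Finset.mem_insert_self _ _))
    rw [hH, Function.update_eq_self] at h4
    exact h4

end Density

section Arcs

open MvPolynomial

variable {k : Type*} [Field k] {F : MvPolynomial (Fin 4) k}

theorem derivative_fiberPoly {L : Type*} [CommRing L] [Algebra k L] (α β : L) :
    Polynomial.derivative (fiberPoly F α β) = fiberPoly (pderiv 3 F) α β := by
  have := derivation_aeval ((Polynomial.derivative' : Derivation L _ _).restrictScalars k)
    ![1, Polynomial.C α, Polynomial.C β, Polynomial.X] F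
  simpa [Fin.sum_univ_four, fiberPoly, Polynomial.derivative'] using this

theorem exists_powerSeries_aeval_eq_zero (hF : F.IsHomogeneous 3)
    (h1 : coeff (Finsupp.single 3 3) F = 1) {R : Type*} [CommRing R] [Nontrivial R] [Algebra k R]
    (α β : PowerSeries R) {c : R}
    (hc : aeval ![1, PowerSeries.constantCoeff α, PowerSeries.constantCoeff β, c] F = 0)
    (hu : IsUnit (aeval ![1, PowerSeries.constantCoeff α, PowerSeries.constantCoeff β, c]
      (pderiv 3 F))) :
    ∃ w : PowerSeries R, aeval ![1, α, β, w] F = 0 := by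
  let ε : PowerSeries R →ₐ[k] R := { PowerSeries.constantCoeff with
    commutes' := fun r => by
      rw [IsScalarTower.algebraMap_apply k R (PowerSeries R)]
      exact PowerSeries.constantCoeff_C _ }
  have hε : ∀ G : MvPolynomial (Fin 4) k, PowerSeries.constantCoeff
      ((fiberPoly G α β).eval (PowerSeries.C c)) =
      aeval ![1, PowerSeries.constantCoeff α, PowerSeries.constantCoeff β, c] G := by
    intro G
    rw [← Polynomial.coe_aeval_eq_eval, aeval_fiberPoly]
    exact (map_aeval_one G ε _ _ _).trans rfl
  obtain ⟨hm, -⟩ := fiberPoly_monic_natDegree hF h1 α β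
  obtain ⟨w, hw, -⟩ := HenselianRing.is_henselian
    (I := (Ideal.span {PowerSeries.X} : Ideal (PowerSeries R))) _ hm (PowerSeries.C c)
    (by rw [Ideal.mem_span_singleton, PowerSeries.X_dvd_iff, hε, hc])
    (by
      refine IsUnit.map _ ?_
      rw [derivative_fiberPoly, PowerSeries.isUnit_iff_constantCoeff, hε]
      exact hu)
  refine ⟨w, ?_⟩
  rw [Polynomial.IsRoot.def, ← Polynomial.coe_aeval_eq_eval, aeval_fiberPoly] at hw
  exact hw

theorem aeval_mapAlgHom_comp {k A B Ω σ ι : Type*} [CommRing k] [CommRing A] [Algebra k A]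
    [CommRing B] [Algebra k B] [CommRing Ω] [Algebra k Ω] {τ : ι → A →ₐ[k] B} (f : B →ₐ[k] Ω)
    (q : σ → PowerSeries A) (G : MvPolynomial (ι × σ) k) :
    PowerSeries.mapAlgHom f (aeval (fun e : ι × σ => PowerSeries.mapAlgHom (τ e.1) (q e.2)) G) =
      aeval (fun e : ι × σ => PowerSeries.mapAlgHom (f.comp (τ e.1)) (q e.2)) G := by
  rw [comp_aeval_apply]
  congr 2

/-- A polynomial condition on `[K : k]`-tuples of points which is satisfiable at all is satisfied
by the conjugates of an arc through a given nonsingular `K`-point. -/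
theorem exists_arc [Infinite k] {K Ω : Type*} [Field K] [Algebra k K] [FiniteDimensional k K]
    [Algebra.IsSeparable k K] [Field Ω] [IsAlgClosed Ω] [Algebra k Ω] (hF : F.IsHomogeneous 3)
    (h1 : coeff (Finsupp.single 3 3) F = 1)
    (hsmooth : ∀ a : Fin 4 → Ω, aeval a F = 0 → (∀ i, aeval a (pderiv i F) = 0) → a = 0)
    {p : Fin 3 → K} (hp : aeval ![1, p 0, p 1, p 2] F = 0)
    (hp' : aeval ![1, p 0, p 1, p 2] (pderiv 3 F) ≠ 0)
    {G : MvPolynomial ((K →ₐ[k] Ω) × Fin 3) k} {P : (K →ₐ[k] Ω) → Fin 3 → Ω}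
    (hP : ∀ i, aeval ![1, P i 0, P i 1, P i 2] F = 0)
    (hG : aeval (fun e : (K →ₐ[k] Ω) × Fin 3 => P e.1 e.2) G ≠ 0) :
    ∃ q : Fin 3 → PowerSeries K, aeval ![1, q 0, q 1, q 2] F = 0 ∧
      aeval (fun e : (K →ₐ[k] Ω) × Fin 3 => PowerSeries.mapAlgHom e.1 (q e.2)) G ≠ 0 := by
  classical
  by_contra! hcon
  let R := MvPolynomial (Fin 2) K
  let R' := MvPolynomial ((K →ₐ[k] Ω) × Fin 2) Ω
  let arc (i : Fin 2) : PowerSeries R :=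
    PowerSeries.C (C (p i.castSucc)) + PowerSeries.C (X i) * PowerSeries.X
  have harc : ∀ i, PowerSeries.constantCoeff (arc i) = C (p i.castSucc) := fun i => by simp [arc]
  have hC : ∀ H : MvPolynomial (Fin 4) k,
      aeval ![1, C (p 0), C (p 1), (C (p 2) : R)] H = C (aeval ![1, p 0, p 1, p 2] H) :=
    fun H => (map_aeval_one H (IsScalarTower.toAlgHom k K R) _ _ _).symm
  obtain ⟨w, hw⟩ := exists_powerSeries_aeval_eq_zero hF h1 (arc 0) (arc 1) (c := C (p 2))
    (by rw [harc, harc]; exact (hC F).trans (by rw [hp, map_zero]))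
    (by
      rw [harc, harc]
      have := (isUnit_iff_ne_zero.2 hp').map (C : K →+* R)
      rw [← hC] at this
      exact this)
  let Q : Fin 3 → PowerSeries R := ![arc 0, arc 1, w]
  let τ (i : K →ₐ[k] Ω) : R →ₐ[k] R' :=
    aevalTower ((IsScalarTower.toAlgHom k Ω R').comp i) fun l => X (i, l)
  let Γ : PowerSeries R' :=
    aeval (fun e : (K →ₐ[k] Ω) × Fin 3 => PowerSeries.mapAlgHom (τ e.1) (Q e.2)) G
  let ev (a : (K →ₐ[k] Ω) × Fin 2 → Ω) : R' →ₐ[k] Ω :=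
    (aeval a : R' →ₐ[Ω] Ω).restrictScalars k
  have hev : ∀ a i, (ev a).comp (τ i) = aevalTower i fun l => a (i, l) := by
    intro a i
    refine MvPolynomial.algHom_ext' (AlgHom.ext fun c => ?_) fun l => ?_
    · simp [τ, ev]
    · simp only [AlgHom.comp_apply, τ, ev, aevalTower_X]
      exact aeval_X _ _
  have hmap : ∀ a, PowerSeries.mapAlgHom (ev a) Γ = aeval (fun e : (K →ₐ[k] Ω) × Fin 3 =>
      PowerSeries.mapAlgHom (aevalTower e.1 fun l => a (e.1, l)) (Q e.2)) G := by
    intro a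
    rw [aeval_mapAlgHom_comp]
    simp only [hev]
  have hΓ : Γ = 0 := by
    ext1 n
    rw [map_zero]
    refine eq_zero_of_vanish_on_conjugates fun u => ?_
    let υ : R →ₐ[k] K := (aeval u : R →ₐ[K] K).restrictScalars k
    have h2 := hcon (fun l => PowerSeries.mapAlgHom υ (Q l)) (by
      have := map_aeval_one F (PowerSeries.mapAlgHom υ) (Q 0) (Q 1) (Q 2)
      exact this.symm.trans ((congrArg _ hw).trans (map_zero _)))
    have h3 := hmap fun e => e.1 (u e.2)
    have h4 : ∀ i : K →ₐ[k] Ω, ∀ f : PowerSeries R, PowerSeries.mapAlgHom i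
        (PowerSeries.mapAlgHom υ f) =
          PowerSeries.mapAlgHom (aevalTower i fun l => i (u l)) f := by
      intro i f
      have h5 : i.comp υ = aevalTower i fun l => i (u l) := by
        refine MvPolynomial.algHom_ext' (AlgHom.ext fun c => ?_) fun l => ?_ <;> simp [υ]
      rw [← h5]
      ext n
      simp [PowerSeries.mapAlgHom_apply]
    simp only [h4] at h2
    rw [h2] at h3
    have h5 := congrArg (PowerSeries.coeff n) h3
    rw [PowerSeries.mapAlgHom_apply, PowerSeries.coeff_map, map_zero] at h5
    exact h5
  let Ω' := FractionRing (PowerSeries Ω)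
  let j : PowerSeries Ω →ₐ[k] Ω' := IsScalarTower.toAlgHom k _ _
  have hj : Function.Injective j := IsFractionRing.injective (PowerSeries Ω) Ω'
  have hjΩ : ∀ c, j (PowerSeries.C c) = algebraMap Ω Ω' c := fun c =>
    (IsScalarTower.algebraMap_apply Ω (PowerSeries Ω) Ω' c).symm
  have := CubicRing.isDomain_of_smooth hF h1 hsmooth (L := Ω')
  have hfin := aeval_eq_zero_of_coordinatewise (G := G) (Ω := Ω')
    (V := {v | aeval ![1, v 0, v 1, v 2] F = 0})
    (S := fun i => Set.range fun (a : Fin 2 → Ω) l =>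
      j (PowerSeries.mapAlgHom (aevalTower i a) (Q l))) ?_ ?_
    (P := fun i l => algebraMap Ω Ω' (P i l)) ?_
  · refine hG ((algebraMap Ω Ω').injective ?_)
    rw [map_zero, ← hfin]
    exact comp_aeval_apply _ (IsScalarTower.toAlgHom k Ω Ω') G
  · intro i H hH v hv
    refine CubicRing.eq_zero_of_vanish_on_sections hF h1 (H := H) (s := fun l => Set.range
      fun a : Ω => j (PowerSeries.C (i (p l.castSucc)) + PowerSeries.C a * PowerSeries.X)) ?_ ?_ hv
    · intro l
      refine Set.infinite_range_of_injective (hj.comp fun a b hab => ?_)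
      simpa using congrArg (PowerSeries.coeff 1) hab
    · rintro _ ⟨a, rfl⟩ _ ⟨b, rfl⟩
      let φ : PowerSeries R →ₐ[k] Ω' := j.comp (PowerSeries.mapAlgHom (aevalTower i ![a, b]))
      have hφ : ∀ l, φ (arc l) = j (PowerSeries.C (i (p l.castSucc)) +
          PowerSeries.C (![a, b] l) * PowerSeries.X) := by
        intro l
        refine congrArg j (?_ : PowerSeries.mapAlgHom (aevalTower i ![a, b]) (arc l) = _)
        have h0 : (aevalTower i ![a, b] : R →ₐ[k] Ω) (C (p l.castSucc)) = i (p l.castSucc) :=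
          aevalTower_C _ _ _
        have h0' : (aevalTower i ![a, b] : R →ₐ[k] Ω) (X l) = ![a, b] l := aevalTower_X _ _ _
        rw [← h0, ← h0']
        simp [arc, PowerSeries.mapAlgHom_apply]
      have h0 : φ (arc 0) = j (PowerSeries.C (i (p (0 : Fin 2).castSucc)) +
          PowerSeries.C a * PowerSeries.X) := hφ 0
      have h0' : φ (arc 1) = j (PowerSeries.C (i (p (1 : Fin 2).castSucc)) +
          PowerSeries.C b * PowerSeries.X) := hφ 1
      refine ⟨φ w, ?_, ?_⟩
      · have h2 := map_aeval_one F φ (arc 0) (arc 1) w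
        rw [hw, map_zero, h0, h0'] at h2
        exact h2.symm
      · have h2 := hH _ ⟨![a, b], rfl⟩
        rw [← h2]
        congr 2
        ext1 l
        fin_cases l
        · exact h0.symm
        · exact h0'.symm
        · rfl
  · intro P' hP'
    choose a ha using hP'
    have h2 := hmap fun e => a e.1 e.2
    rw [hΓ, map_zero] at h2
    have h3 := congrArg j h2
    rw [map_zero, comp_aeval_apply] at h3
    rw [h3]
    congr 2
    ext1 e
    rw [← ha]
  · intro i
    have h2 := map_aeval_one F (IsScalarTower.toAlgHom k Ω Ω') (P i 0) (P i 1) (P i 2)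
    rw [hP, map_zero] at h2
    exact h2.symm

end Arcs

section Descent

open MvPolynomial

theorem exists_algHom_eq_mulVec {L Ω C ι κ : Type*} [Field L] [Field Ω] [Algebra L Ω] [CommRing C]
    [Algebra L C] [Fintype ι] [DecidableEq ι] {V : Matrix ι ι Ω} (hV : V.det ≠ 0)
    (ev : C →ₐ[L] (ι → Ω)) {M : κ → C} (hM : ⊤ ≤ Submodule.span L (Set.range M)) {E : κ → ι → L}
    (hE : ∀ e, ev (M e) = V.mulVec fun i => algebraMap L Ω (E e i)) {c : ι → κ}
    (hc : (Matrix.of fun i j => E (c j) i).det ≠ 0) :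
    Module.finrank L ev.range = Fintype.card ι ∧
      (∀ x, ∃ w ∈ Submodule.span L (Set.range (M ∘ c)), ev w = ev x) ∧
      ∀ (s : Finset κ) (g : s → L), (∀ i, ∑ e : s, E e i * g e = 0) →
        ev (∑ e : s, g e • M e) = 0 := by
  let Ψ : (ι → L) →ₗ[L] (ι → Ω) :=
    (Matrix.mulVecLin V).restrictScalars L ∘ₗ (Algebra.linearMap L Ω).compLeft ι
  have hΨ : ∀ v, Ψ v = V.mulVec fun i => algebraMap L Ω (v i) := fun v => rfl
  have hM' : ∀ e, ev (M e) = Ψ (E e) := hE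
  have hVu : IsUnit V := (Matrix.isUnit_iff_isUnit_det V).2 (isUnit_iff_ne_zero.2 hV)
  have hinj : Function.Injective Ψ := by
    intro v w h
    rw [hΨ, hΨ] at h
    have := Matrix.mulVec_injective_of_isUnit hVu h
    ext i
    exact (algebraMap L Ω).injective (congrFun this i)
  have h1 : ∀ x, ∃ v, ev x = Ψ v := by
    intro x
    have hx : x ∈ Submodule.span L (Set.range M) := hM trivial
    induction hx using Submodule.span_induction with
    | mem x h =>
      obtain ⟨e, rfl⟩ := h
      exact ⟨E e, hE e⟩
    | zero => exact ⟨0, by simp⟩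
    | add x y _ _ hx hy =>
      obtain ⟨v, hv⟩ := hx
      obtain ⟨w, hw⟩ := hy
      exact ⟨v + w, by rw [map_add, map_add, hv, hw]⟩
    | smul r x _ hx =>
      obtain ⟨v, hv⟩ := hx
      exact ⟨r • v, by rw [map_smul, map_smul, hv]⟩
  have h2 : ∀ v, ∃ w ∈ Submodule.span L (Set.range (M ∘ c)), ev w = Ψ v := by
    intro v
    obtain ⟨u, hu⟩ : ∃ u, (Matrix.of fun i j => E (c j) i).mulVec u = v :=
      Matrix.mulVec_surjective_iff_isUnit.2
        ((Matrix.isUnit_iff_isUnit_det _).2 (isUnit_iff_ne_zero.2 hc)) v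
    refine ⟨∑ i, u i • M (c i), sum_mem fun i _ =>
      Submodule.smul_mem _ _ (Submodule.subset_span ⟨i, rfl⟩), ?_⟩
    have : v = ∑ i, u i • E (c i) := by
      rw [← hu]
      ext i
      simp [Matrix.mulVec, dotProduct, mul_comm]
    rw [this, map_sum, map_sum]
    simp only [map_smul, hM']
  refine ⟨?_, fun x => ?_, fun s g hg => ?_⟩
  · have : Subalgebra.toSubmodule ev.range = LinearMap.range Ψ := by
      ext y
      constructor
      · rintro ⟨x, rfl⟩
        obtain ⟨v, hv⟩ := h1 x
        exact ⟨v, hv.symm⟩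
      · rintro ⟨v, rfl⟩
        obtain ⟨w, _, hw⟩ := h2 v
        exact ⟨w, hw⟩
    rw [← Subalgebra.finrank_toSubmodule, this, LinearMap.finrank_range_of_inj hinj]
    simp
  · obtain ⟨v, hv⟩ := h1 x
    obtain ⟨w, hw, hw'⟩ := h2 v
    exact ⟨w, hw, hw'.trans hv.symm⟩
  · have : ∑ e : s, g e • E e = 0 := by
      ext i
      rw [Pi.zero_apply, ← hg i]
      simp [Finset.sum_apply, mul_comm]
    rw [← map_zero Ψ, ← this, map_sum, map_sum]
    simp only [map_smul, hM']

/-- The coordinates of a power series with respect to a basis of the coefficient field. -/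
theorem mapAlgHom_eq_mulVec {k K Ω ι : Type*} [Field k] [Field K] [Algebra k K] [Field Ω]
    [Algebra k Ω] [Fintype ι] (b : Module.Basis ι k K) (i : K →ₐ[k] Ω) (f : PowerSeries K) :
    PowerSeries.mapAlgHom i f = ∑ j, PowerSeries.C (i (b j)) *
      PowerSeries.map (algebraMap k Ω) (PowerSeries.mk fun n => b.repr (PowerSeries.coeff n f) j) := by
  ext n
  rw [PowerSeries.mapAlgHom_apply, PowerSeries.coeff_map, map_sum]
  simp only [PowerSeries.coeff_C_mul, PowerSeries.coeff_map, PowerSeries.coeff_mk]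
  conv_lhs => rw [← b.sum_repr (PowerSeries.coeff n f)]
  simp [map_sum, Algebra.smul_def, mul_comm]

end Descent

section Curves

open MvPolynomial

theorem CubicRing.exists_curves_through_arc {k K Ω : Type*} [Field k] {F : MvPolynomial (Fin 4) k}
    (hF : F.IsHomogeneous 3) (h1 : coeff (Finsupp.single 3 3) F = 1) [Field K] [Algebra k K]
    [Field Ω] [Algebra k Ω] {k' Ω' : Type*} [Field k'] [Algebra (PowerSeries k) k']
    [Algebra k k'] [IsDomain (CubicRing F k')] [Field Ω'] [Algebra (PowerSeries Ω) Ω']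
    (hinj : Function.Injective (algebraMap (PowerSeries Ω) Ω')) [Algebra k' Ω'] [Algebra k Ω']
    [IsScalarTower k k' Ω'] [IsScalarTower k (PowerSeries Ω) Ω']
    (hcomp : ∀ f : PowerSeries k, algebraMap k' Ω' (algebraMap _ k' f) =
      algebraMap (PowerSeries Ω) Ω' (PowerSeries.map (algebraMap k Ω) f))
    [Fintype (K →ₐ[k] Ω)] [DecidableEq (K →ₐ[k] Ω)] (b : Module.Basis (K →ₐ[k] Ω) k K)
    (hb : (Matrix.of fun i j : K →ₐ[k] Ω => i (b j)).det ≠ 0)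
    {q : Fin 3 → PowerSeries K} (hq : aeval ![1, q 0, q 1, q 2] F = 0) {m a s : ℕ} (hm : 1 ≤ m)
    (G : GenericData k (K →ₐ[k] Ω) (hookIdx m a s) (expIdx (m + 1)) (boxIdx m)
      (expIdx (2 * m + 1)))
    (hT : ∀ (ν : expIdx (m + 1)) (j : hookIdx m a s),
      cubicMon (x F k) (y F k) (z F k) ν * cubicMon (x F k) (y F k) (z F k) j =
        ∑ ρ, G.T ν j ρ • cubicMon (x F k) (y F k) (z F k) ρ)
    (hJ : ∀ υ : boxIdx m, cubicMon (x F k) (y F k) (z F k) υ =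
      ∑ ρ, G.J υ ρ • cubicMon (x F k) (y F k) (z F k) ρ)
    (hG : G.det (Matrix.of fun (i : K →ₐ[k] Ω) (e : hookIdx m a s) =>
      cubicMon (PowerSeries.mapAlgHom i (q 0)) (PowerSeries.mapAlgHom i (q 1))
        (PowerSeries.mapAlgHom i (q 2)) e) ≠ 0) :
    ∃ A B : CubicRing F k', ((Module.finrank k' (CubicRing F k' ⧸ Ideal.span {A, B}) = 3 * m ^ 2 ∧
      FiniteDimensional k' (CubicRing F k' ⧸ Ideal.span {A, B})) ∧
      A ∈ monIdeal (x F k') (y F k') (hookSet a s) ∧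
      B ∈ monIdeal (x F k') (y F k') (hookSet a s)) ∧
      ∃ ev : CubicRing F k' →ₐ[k'] ((K →ₐ[k] Ω) → Ω'), ev A = 0 ∧ ev B = 0 ∧
        Module.finrank k' ev.range = Fintype.card (K →ₐ[k] Ω) ∧
        ∀ c, ∃ w ∈ monIdeal (x F k') (y F k') (hookSet a s), ev w = ev c := by
  let φ : (K →ₐ[k] Ω) → PowerSeries K →ₐ[k] Ω' := fun i =>
    (IsScalarTower.toAlgHom k (PowerSeries Ω) Ω').comp (PowerSeries.mapAlgHom i)
  let M : ℕ × ℕ × Fin 3 → PowerSeries K := cubicMon (q 0) (q 1) (q 2)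
  let E : ℕ × ℕ × Fin 3 → (K →ₐ[k] Ω) → k' := fun e j =>
    algebraMap (PowerSeries k) k' (PowerSeries.mk fun n => b.repr (PowerSeries.coeff n (M e)) j)
  let V : Matrix (K →ₐ[k] Ω) (K →ₐ[k] Ω) Ω' :=
    Matrix.of fun i j => algebraMap (PowerSeries Ω) Ω' (PowerSeries.C (i (b j)))
  have hV : V.det ≠ 0 := by
    have : V = ((algebraMap (PowerSeries Ω) Ω').comp PowerSeries.C).mapMatrix
        (Matrix.of fun i j : K →ₐ[k] Ω => i (b j)) := rfl
    rw [this, ← RingHom.map_det, RingHom.comp_apply]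
    intro h
    refine hb (PowerSeries.C_injective (hinj ?_))
    rw [h, map_zero, map_zero]
  have hφM : ∀ e i, φ i (M e) = V.mulVec (fun j => algebraMap k' Ω' (E e j)) i := by
    intro e i
    change algebraMap (PowerSeries Ω) Ω' (PowerSeries.mapAlgHom i (M e)) = _
    rw [mapAlgHom_eq_mulVec b, map_sum]
    refine Finset.sum_congr rfl fun j _ => ?_
    rw [map_mul, ← hcomp]
    rfl
  obtain ⟨ev, hx, hy, hz⟩ := exists_lift (F := F) (L := k') (S := (K →ₐ[k] Ω) → Ω')
    (fun i => φ i (q 0)) (fun i => φ i (q 1)) (fun i => φ i (q 2)) (by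
      ext i
      have h := map_aeval_one F (Pi.evalAlgHom k (fun _ : K →ₐ[k] Ω => Ω') i)
        (fun i => φ i (q 0)) (fun i => φ i (q 1)) (fun i => φ i (q 2))
      have h' := map_aeval_one F (φ i) (q 0) (q 1) (q 2)
      rw [hq, map_zero] at h'
      exact h.trans h'.symm)
  have hE : ∀ e, ev (cubicMon (x F k') (y F k') (z F k') e) =
      V.mulVec fun i => algebraMap k' Ω' (E e i) := by
    intro e
    ext i
    rw [map_cubicMon, hx, hy, hz, ← hφM]
    have h := map_cubicMon (φ i) (q 0) (q 1) (q 2) e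
    have h' := map_cubicMon (Pi.evalAlgHom k (fun _ : K →ₐ[k] Ω => Ω') i)
      (fun i => φ i (q 0)) (fun i => φ i (q 1)) (fun i => φ i (q 2)) e
    exact h'.trans h.symm
  let E₀ : Matrix (K →ₐ[k] Ω) (hookIdx m a s) k' := Matrix.of fun i e => E e i
  have hE₀ : G.det E₀ ≠ 0 := by
    intro h0
    have h2 := G.map_det (IsScalarTower.toAlgHom k k' Ω') E₀
    rw [h0, map_zero] at h2
    have h3 := G.det_mul V (E₀.map (IsScalarTower.toAlgHom k k' Ω'))
    rw [← h2, mul_zero] at h3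
    have h4 := G.map_det (IsScalarTower.toAlgHom k (PowerSeries Ω) Ω')
      (Matrix.of fun (i : K →ₐ[k] Ω) (e : hookIdx m a s) =>
      cubicMon (PowerSeries.mapAlgHom i (q 0)) (PowerSeries.mapAlgHom i (q 1))
        (PowerSeries.mapAlgHom i (q 2)) e)
    refine hG (hinj ?_)
    rw [map_zero, ← h3]
    refine h4.trans (congrArg G.det ?_)
    ext i e
    refine Eq.trans ?_ (hφM e i)
    exact congrArg (algebraMap (PowerSeries Ω) Ω')
      (map_cubicMon (PowerSeries.mapAlgHom i) (q 0) (q 1) (q 2) e).symm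
  obtain ⟨hr, hs, h0⟩ := exists_algHom_eq_mulVec (c := fun i => (G.c i : ℕ × ℕ × Fin 3)) hV ev
    (isCubicFrame (L := k') hF h1).span hE (G.minor_ne_zero hE₀)
  have hker : ∀ g : hookIdx m a s → k,
      ev (∑ e, G.kerVec g E₀ e • cubicMon (x F k') (y F k') (z F k') e) = 0 := fun g =>
    h0 _ _ fun i => congrFun (G.mulVec_kerVec g E₀) i
  refine ⟨_, _, finrank_quotient_of_det_ne_zero hF h1 hm G hT hJ E₀ hE₀ rfl rfl, ev,
    hker _, hker _, hr, fun c => ?_⟩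
  obtain ⟨w, hw, hwc⟩ := hs c
  refine ⟨w, ?_, hwc⟩
  have hle : Submodule.span k' (Set.range
      (cubicMon (x F k') (y F k') (z F k') ∘ fun i => (G.c i : ℕ × ℕ × Fin 3))) ≤
      (monIdeal (x F k') (y F k') (hookSet a s)).restrictScalars k' := by
    rw [Submodule.span_le]
    rintro _ ⟨i, rfl⟩
    exact cubicMon_mem_monIdeal (mem_hookIdx.1 (G.c i).2).2
  exact hle hw

end Curves

section Step

universe u v

open MvPolynomial

theorem CubicRing.exists_descent_step {k : Type u} [Field k] [Infinite k] [PerfectField k]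
    {F : MvPolynomial (Fin 4) k} (hF : F.IsHomogeneous 3)
    (h1 : coeff (Finsupp.single 3 3) F = 1)
    (hsmooth : ∀ a : Fin 4 → AlgebraicClosure k, aeval a F = 0 →
      (∀ i, aeval a (pderiv i F) = 0) → a = 0)
    (hno : ∀ a b c : k, aeval ![1, a, b, c] F ≠ 0)
    {K : Type v} [Field K] [Algebra k K] [FiniteDimensional k K] {p : Fin 3 → K}
    (hp : aeval ![1, p 0, p 1, p 2] F = 0) (hp' : aeval ![1, p 0, p 1, p 2] (pderiv 3 F) ≠ 0)
    {m a s : ℕ} (hm : 1 ≤ m) (ha : a = 1 ∨ a = 2) (hs : a = 2 → 2 ≤ s) (ham : a ≤ m) (hsm : s ≤ m)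
    (hd : 2 * Module.finrank k K + 6 * (s + a - 1) + 2 * (1 + a) ≤ 3 * m ^ 2 + 3 * m + 2) :
    ∃ r, ((a = 1 ∧ r + 3 * s + Module.finrank k K = 3 * m ^ 2) ∨ (a = 2 ∧ ∃ ρ, 1 ≤ ρ ∧
      r + 3 * ρ + 3 * (s + 1) + Module.finrank k K = 3 * m ^ 2)) ∧ (¬ 3 ∣ r →
      ∃ d', d' ≤ r ∧ ¬ 3 ∣ d' ∧ ∃ (L : Type u) (_ : Field L) (_ : Algebra k L),
        Module.finrank k L = d' ∧ ∃ y : Fin 4 → L, y ≠ 0 ∧ aeval y F = 0) := by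
  classical
  let Ω := AlgebraicClosure k
  let k' := FractionRing (PowerSeries k)
  let Ω' := FractionRing (PowerSeries Ω)
  have hcard : Fintype.card (K →ₐ[k] Ω) = Module.finrank k K := AlgHom.card k K Ω
  obtain ⟨G, P, hT, hJ, hP, hdet⟩ := CubicRing.exists_genericData (Ω := Ω) hF h1
    (fun α β => exists_injective_aeval_eq_zero hF h1 (hno α β)) ha hs ham hsm
    (ι := K →ₐ[k] Ω) (by rw [hcard]; exact hd)
  let 𝒢 : MvPolynomial ((K →ₐ[k] Ω) × Fin 3) k :=
    G.det (Matrix.of fun (i : K →ₐ[k] Ω) (e : hookIdx m a s) =>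
      cubicMon (X (i, 0)) (X (i, 1)) (X (i, 2)) e)
  have h𝒢 : ∀ {S : Type u} [CommRing S] [Algebra k S] (f : (K →ₐ[k] Ω) × Fin 3 → S),
      aeval f 𝒢 = G.det (Matrix.of fun (i : K →ₐ[k] Ω) (e : hookIdx m a s) =>
        cubicMon (f (i, 0)) (f (i, 1)) (f (i, 2)) e) := by
    intro S _ _ f
    refine (G.map_det (aeval f) _).trans (congrArg G.det ?_)
    ext i e
    simp [map_cubicMon]
  obtain ⟨q, hq, hqG⟩ := exists_arc (Ω := Ω) hF h1 hsmooth hp hp' (G := 𝒢)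
    (P := fun i => ![(P i).1, (P i).2.1, (P i).2.2]) hP (by rw [h𝒢]; exact hdet)
  rw [h𝒢] at hqG
  obtain ⟨b, hb⟩ := exists_basis_det_embeddings_ne_zero (k := k) (K := K) (Ω := Ω)
  let res : PowerSeries k →ₐ[k] k := { PowerSeries.constantCoeff with
    commutes' := fun r => PowerSeries.constantCoeff_C r }
  have hno' : ∀ c : k', aeval ![1, 0, 0, c] F ≠ 0 :=
    aeval_ne_zero_of_isIntegrallyClosed hF h1 res (hno 0 0)
  have hdom := isDomain_of_aeval_ne_zero hF h1 hno'
  have hinj : Function.Injective (algebraMap (PowerSeries Ω) Ω') := IsFractionRing.injective _ _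
  have hinj' : Function.Injective (algebraMap (PowerSeries k) Ω') := by
    rw [IsScalarTower.algebraMap_eq (PowerSeries k) (PowerSeries Ω) Ω']
    exact hinj.comp (PowerSeries.map_injective _ (algebraMap k Ω).injective)
  have : FaithfulSMul (PowerSeries k) Ω' := (faithfulSMul_iff_algebraMap_injective _ _).2 hinj'
  let _ : Algebra k' Ω' := FractionRing.liftAlgebra (PowerSeries k) Ω'
  have : IsScalarTower (PowerSeries k) k' Ω' := FractionRing.isScalarTower_liftAlgebra _ _
  have : IsScalarTower k k' Ω' := IsScalarTower.of_algebraMap_eq fun r => by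
    rw [IsScalarTower.algebraMap_apply k (PowerSeries k) k',
      ← IsScalarTower.algebraMap_apply (PowerSeries k) k' Ω',
      IsScalarTower.algebraMap_apply (PowerSeries k) (PowerSeries Ω) Ω',
      IsScalarTower.algebraMap_apply k (PowerSeries Ω) Ω']
    refine congrArg _ ?_
    rw [PowerSeries.algebraMap_apply, PowerSeries.algebraMap_apply]
    exact (PowerSeries.map_C (algebraMap k Ω) r).symm
  obtain ⟨A, B, ⟨⟨hAB, hfin⟩, hA, hB⟩, ev, evA, evB, hr, hev⟩ :=
    exists_curves_through_arc (k' := k') (Ω' := Ω') hF h1 hinj (fun f => by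
      rw [← IsScalarTower.algebraMap_apply (PowerSeries k) k' Ω',
        IsScalarTower.algebraMap_apply (PowerSeries k) (PowerSeries Ω) Ω']
      rfl) b hb hq hm G hT hJ hqG
  rw [hcard] at hr
  have hC := isCubicFrame (L := k') hF h1
  have hdesc : ∀ I : Ideal (CubicRing F k' ⧸ Ideal.span {A, B}), ¬ 3 ∣ Module.finrank k' I →
      ∃ d', d' ≤ Module.finrank k' I ∧ ¬ 3 ∣ d' ∧ ∃ (L : Type u) (_ : Field L) (_ : Algebra k L),
        Module.finrank k L = d' ∧ ∃ y : Fin 4 → L, y ≠ 0 ∧ aeval y F = 0 := by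
    intro I hI
    refine exists_isMaximal_aeval_eq_zero (k' := k') res PowerSeries.X
      (fun r => PowerSeries.X_dvd_iff.symm) PowerSeries.X_ne_zero
      (fun r hr => PowerSeries.isUnit_iff_constantCoeff.2 (isUnit_iff_ne_zero.2 hr)) (M := I) 3 hI hF
      (![1, Ideal.Quotient.mk _ (x F k'), Ideal.Quotient.mk _ (y F k'),
        Ideal.Quotient.mk _ (z F k')] : Fin 4 → CubicRing F k' ⧸ Ideal.span {A, B}) 0 rfl ?_
    have := map_aeval_one F ((Ideal.Quotient.mkₐ k (Ideal.span {A, B}))) (x F k') (y F k') (z F k')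
    rw [aeval_eq_zero, map_zero] at this
    exact this.symm
  rcases ha with rfl | rfl
  · obtain ⟨P, -, hP⟩ := hC.exists_residual le_rfl (Or.inr rfl) hAB hA hB ev evA evB hr hev
    exact ⟨_, Or.inl ⟨rfl, hP⟩, hdesc _⟩
  · obtain ⟨J, ρ, hρ, hJ⟩ := hC.exists_residual' (hs rfl) hAB hA hB
      (isMaximal_span_x_y hF h1 hno') ev evA evB hr hev
    exact ⟨_, Or.inr ⟨rfl, ρ, hρ, hJ⟩, hdesc _⟩

end Step

section Arithmetic

universe u v

open MvPolynomial

theorem exists_descent_parameters {d : ℕ} (hd3 : ¬ 3 ∣ d) (hd1 : d ≠ 1) (hd4 : d ≠ 4)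
    (hd10 : d ≠ 10) : ∃ m a s : ℕ, 1 ≤ m ∧ (a = 1 ∨ a = 2) ∧ (a = 2 → 2 ≤ s) ∧ a ≤ m ∧ s ≤ m ∧
      2 * d + 6 * (s + a - 1) + 2 * (1 + a) ≤ 3 * m ^ 2 + 3 * m + 2 ∧
      ∀ r, ((a = 1 ∧ r + 3 * s + d = 3 * m ^ 2) ∨ (a = 2 ∧ ∃ ρ, 1 ≤ ρ ∧
        r + 3 * ρ + 3 * (s + 1) + d = 3 * m ^ 2)) → r < d ∧ ¬ 3 ∣ r := by
  have hex : ∃ n, 2 * d ≤ 3 * ((n + 1) * (n + 2)) := ⟨d, by nlinarith⟩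
  obtain ⟨n, hn, hmin⟩ : ∃ n, 2 * d ≤ 3 * ((n + 1) * (n + 2)) ∧ 3 * (n * (n + 1)) < 2 * d := by
    refine ⟨Nat.find hex, Nat.find_spec hex, ?_⟩
    rcases h : Nat.find hex with _ | n
    · simp; omega
    · have := Nat.find_min hex (m := n) (by omega)
      exact not_le.1 this
  obtain ⟨T, hT⟩ : ∃ T, n * (n + 1) = T + T := Nat.even_mul_succ_self n
  have hsq : (n + 1) ^ 2 = 2 * T + (n + 1) := by linarith [hT, sq (n + 1), add_mul n 1 (n + 1)]
  have hup : (n + 1) * (n + 2) = 2 * T + 2 * (n + 1) := by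
    linarith [hT, add_mul n 1 (n + 2), mul_add n (n + 1) 1, mul_comm n n]
  rw [hT] at hmin
  rw [hup] at hn
  by_cases hj : d = 3 * T + 1
  · have h3 : 3 ≤ n := by
      by_contra h
      interval_cases n <;> omega
    refine ⟨n + 1, 2, n - 1, by omega, Or.inr rfl, by omega, by omega, by omega, ?_, ?_⟩
    · rw [hsq]; omega
    · rw [hsq]
      rintro r (⟨h, -⟩ | ⟨-, ρ, hρ, h⟩) <;> omega
  · refine ⟨n + 1, 1, (3 * T + 3 * n + 2 - d) / 3, by omega, Or.inl rfl, by omega, by omega,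
      by omega, ?_, ?_⟩
    · rw [hsq]; omega
    · rw [hsq]
      rintro r (⟨-, h⟩ | ⟨h, -⟩) <;> omega

theorem CubicRing.exists_lower_degree {k : Type u} [Field k] [Infinite k] [PerfectField k]
    {F : MvPolynomial (Fin 4) k} (hF : F.IsHomogeneous 3)
    (h1 : coeff (Finsupp.single 3 3) F = 1)
    (hsmooth : ∀ a : Fin 4 → AlgebraicClosure k, aeval a F = 0 →
      (∀ i, aeval a (pderiv i F) = 0) → a = 0)
    (hno : ∀ a b c : k, aeval ![1, a, b, c] F ≠ 0)
    {K : Type v} [Field K] [Algebra k K] [FiniteDimensional k K] {p : Fin 3 → K}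
    (hp : aeval ![1, p 0, p 1, p 2] F = 0) (hp' : aeval ![1, p 0, p 1, p 2] (pderiv 3 F) ≠ 0)
    (hd3 : ¬ 3 ∣ Module.finrank k K) (hd1 : Module.finrank k K ≠ 1)
    (hd4 : Module.finrank k K ≠ 4) (hd10 : Module.finrank k K ≠ 10) :
    ∃ d', d' < Module.finrank k K ∧ ¬ 3 ∣ d' ∧ ∃ (L : Type u) (_ : Field L) (_ : Algebra k L),
        Module.finrank k L = d' ∧ ∃ y : Fin 4 → L, y ≠ 0 ∧ aeval y F = 0 := by
  obtain ⟨m, a, s, hm, ha, hs, ham, hsm, hle, hr⟩ := exists_descent_parameters hd3 hd1 hd4 hd10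
  obtain ⟨r, h, hdesc⟩ := exists_descent_step hF h1 hsmooth hno hp hp' hm ha hs ham hsm hle
  obtain ⟨d', hd', h3, hL⟩ := hdesc (hr r h).2
  exact ⟨d', hd'.trans_lt (hr r h).1, h3, hL⟩

end Arithmetic

section Normalization

universe u v

open MvPolynomial

theorem aeval_single_of_isHomogeneous {k : Type*} [CommRing k] {F : MvPolynomial (Fin 4) k}
    (hF : F.IsHomogeneous 3) (i : Fin 4) :
    aeval (Pi.single i 1 : Fin 4 → k) F = coeff (Finsupp.single i 3) F := by
  rw [aeval_def, eval₂_eq', Finset.sum_eq_single (Finsupp.single i 3)]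
  · rw [Finset.prod_eq_one, mul_one]
    · rfl
    · intro j _
      by_cases h : j = i
      · subst h; simp
      · simp [Ne.symm h]
  · intro e he hne
    obtain ⟨j, hj, hej⟩ : ∃ j, j ≠ i ∧ e j ≠ 0 := by
      by_contra! hcon
      have h3 := sum_apply_of_isHomogeneous hF he
      refine hne (Finsupp.ext fun j => ?_)
      by_cases h : j = i
      · subst h
        rw [← Fin.sum_univ_four (fun i => e i),
          Finset.sum_eq_single j (fun l _ hl => hcon l hl) (by simp)] at h3
        simpa using h3
      · rw [hcon j h, Finsupp.single_apply, if_neg (Ne.symm h)]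
    rw [Finset.prod_eq_zero (Finset.mem_univ j) (by simp [hj, hej]), mul_zero]
  · intro h
    simp [notMem_support_iff.1 h]

theorem aeval_C_mul {k S σ : Type*} [CommRing k] [CommRing S] [Algebra k S] (c : k) (a : σ → S)
    (F : MvPolynomial σ k) : aeval a (C c * F) = algebraMap k S c * aeval a F := by
  rw [map_mul, aeval_C]

theorem exists_lower_degree_of_coordinates {k : Type u} [Field k] [Infinite k] [PerfectField k]
    {F : MvPolynomial (Fin 4) k} (hF : F.IsHomogeneous 3)
    (hsmooth : ∀ a : Fin 4 → AlgebraicClosure k, aeval a F = 0 →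
      (∀ i, aeval a (pderiv i F) = 0) → a = 0)
    (hno : ∀ a : Fin 4 → k, aeval a F = 0 → a = 0)
    {K : Type v} [Field K] [Algebra k K] [FiniteDimensional k K] {x : Fin 4 → K}
    (hx : aeval x F = 0) (hx0 : x 0 ≠ 0) (hx' : aeval x (pderiv 3 F) ≠ 0)
    (hd3 : ¬ 3 ∣ Module.finrank k K) (hd1 : Module.finrank k K ≠ 1)
    (hd4 : Module.finrank k K ≠ 4) (hd10 : Module.finrank k K ≠ 10) :
    ∃ d', d' < Module.finrank k K ∧ ¬ 3 ∣ d' ∧ ∃ (L : Type u) (_ : Field L) (_ : Algebra k L),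
        Module.finrank k L = d' ∧ ∃ y : Fin 4 → L, y ≠ 0 ∧ aeval y F = 0 := by
  let c := coeff (Finsupp.single 3 3) F
  have hc : c ≠ 0 := fun h => by
    have := hno _ ((aeval_single_of_isHomogeneous hF 3).trans h)
    simpa using congrFun this 3
  have hinv : ∀ {S : Type u} [Field S] [Algebra k S], algebraMap k S c⁻¹ ≠ 0 := fun {S} _ _ => by
    simpa using hc
  have hpd : ∀ i, pderiv i (C c⁻¹ * F) = C c⁻¹ * pderiv i F := fun i => pderiv_C_mul
  have hxe : (![1, (x 0)⁻¹ * x 1, (x 0)⁻¹ * x 2, (x 0)⁻¹ * x 3] : Fin 4 → K) =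
      fun i => (x 0)⁻¹ * x i := by
    ext i
    fin_cases i <;> simp [hx0]
  obtain ⟨d', hd', h3, L, _, _, hL, y, hy, hyF⟩ := CubicRing.exists_lower_degree
    (F := C c⁻¹ * F) (p := ![(x 0)⁻¹ * x 1, (x 0)⁻¹ * x 2, (x 0)⁻¹ * x 3])
    (by simpa using (isHomogeneous_C _ c⁻¹).mul hF)
    (by rw [coeff_C_mul]; exact inv_mul_cancel₀ hc)
    (fun a ha ha' => hsmooth a (by
      rw [aeval_C_mul] at ha
      exact (mul_eq_zero.1 ha).resolve_left hinv) fun i => by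
        have := ha' i
        rw [hpd, aeval_C_mul] at this
        exact (mul_eq_zero.1 this).resolve_left hinv)
    (fun a b e h => by
      rw [aeval_C_mul] at h
      have := hno _ ((mul_eq_zero.1 h).resolve_left hinv)
      simpa using congrFun this 0)
    (by
      change aeval ![1, (x 0)⁻¹ * x 1, (x 0)⁻¹ * x 2, (x 0)⁻¹ * x 3] _ = 0
      rw [hxe, aeval_C_mul, MvPolynomial.IsHomogeneous.aeval_mul hF, hx, mul_zero, mul_zero])
    (by
      change aeval ![1, (x 0)⁻¹ * x 1, (x 0)⁻¹ * x 2, (x 0)⁻¹ * x 3] _ ≠ 0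
      rw [hxe, hpd, aeval_C_mul, MvPolynomial.IsHomogeneous.aeval_mul hF.pderiv]
      exact mul_ne_zero (by simpa using hc) (mul_ne_zero (pow_ne_zero _ (inv_ne_zero hx0)) hx'))
    hd3 hd1 hd4 hd10
  refine ⟨d', hd', h3, L, _, _, hL, y, hy, ?_⟩
  rw [aeval_C_mul] at hyF
  exact (mul_eq_zero.1 hyF).resolve_left hinv

theorem exists_aeval_pderiv_ne_zero {k : Type u} [Field k] {σ : Type*} {F : MvPolynomial σ k}
    (hsmooth : ∀ a : σ → AlgebraicClosure k, aeval a F = 0 →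
      (∀ i, aeval a (pderiv i F) = 0) → a = 0)
    {K : Type v} [Field K] [Algebra k K] [Algebra.IsAlgebraic k K] {x : σ → K}
    (hx : aeval x F = 0) (hx0 : x ≠ 0) : ∃ i, aeval x (pderiv i F) ≠ 0 := by
  by_contra! h
  let φ : K →ₐ[k] AlgebraicClosure k := IsAlgClosed.lift
  have hφ : ∀ G : MvPolynomial σ k, aeval (fun i => φ (x i)) G = φ (aeval x G) := fun G =>
    (comp_aeval_apply _ φ G).symm
  have := hsmooth (fun i => φ (x i)) (by rw [hφ, hx, map_zero])
    fun i => by rw [hφ, h i, map_zero]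
  refine hx0 (funext fun i => φ.toRingHom.injective ?_)
  rw [Pi.zero_apply, map_zero]
  exact congrFun this i

theorem exists_ne_apply_ne_zero {k K : Type*} [Field k] [Field K] [Algebra k K]
    {F : MvPolynomial (Fin 4) k} (hF : F.IsHomogeneous 3)
    (hno : ∀ a : Fin 4 → k, aeval a F = 0 → a = 0) {x : Fin 4 → K} (hx : aeval x F = 0)
    (hx0 : x ≠ 0) (i : Fin 4) : ∃ j ≠ i, x j ≠ 0 := by
  by_contra! h
  have hxi : x = fun j => x i * algebraMap k K ((Pi.single i 1 : Fin 4 → k) j) := by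
    ext j
    by_cases hj : j = i
    · subst hj; simp
    · simp [hj, h j hj]
  have hi : x i ≠ 0 := fun h0 => hx0 (funext fun j => by
    by_cases hj : j = i
    · rw [hj, h0]; rfl
    · exact h j hj)
  rw [hxi, MvPolynomial.IsHomogeneous.aeval_mul hF] at hx
  have h0 := (mul_eq_zero.1 hx).resolve_left (pow_ne_zero _ hi)
  have h1 : algebraMap k K (aeval (Pi.single i 1 : Fin 4 → k) F) = 0 := by
    rw [← h0, ← aeval_algebraMap_apply]
    rfl
  have := hno _ ((map_eq_zero _).1 h1)
  simpa using congrFun this i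

theorem exists_lower_degree {k : Type u} [Field k] [Infinite k] [PerfectField k]
    {F : MvPolynomial (Fin 4) k} (hF : F.IsHomogeneous 3)
    (hsmooth : ∀ a : Fin 4 → AlgebraicClosure k, aeval a F = 0 →
      (∀ i, aeval a (pderiv i F) = 0) → a = 0)
    (hno : ∀ a : Fin 4 → k, aeval a F = 0 → a = 0)
    {K : Type v} [Field K] [Algebra k K] [FiniteDimensional k K] {x : Fin 4 → K}
    (hx : aeval x F = 0) (hx0 : x ≠ 0)
    (hd3 : ¬ 3 ∣ Module.finrank k K) (hd1 : Module.finrank k K ≠ 1)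
    (hd4 : Module.finrank k K ≠ 4) (hd10 : Module.finrank k K ≠ 10) :
    ∃ d', d' < Module.finrank k K ∧ ¬ 3 ∣ d' ∧ ∃ (L : Type u) (_ : Field L) (_ : Algebra k L),
        Module.finrank k L = d' ∧ ∃ y : Fin 4 → L, y ≠ 0 ∧ aeval y F = 0 := by
  obtain ⟨i, hi⟩ := exists_aeval_pderiv_ne_zero hsmooth hx hx0
  obtain ⟨j, hji, hj⟩ := exists_ne_apply_ne_zero hF hno hx hx0 i
  obtain ⟨τ, hτi, hτj⟩ : ∃ τ : Equiv.Perm (Fin 4), τ i = 3 ∧ τ j = 0 := by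
    have : ∀ i j : Fin 4, j ≠ i → ∃ τ : Equiv.Perm (Fin 4), τ i = 3 ∧ τ j = 0 := by decide
    exact this i j hji
  obtain ⟨d', hd', h3, L, _, _, hL, y, hy, hyF⟩ := exists_lower_degree_of_coordinates
    (F := rename τ F) (x := x ∘ τ.symm) hF.rename_isHomogeneous
    (fun a ha ha' => by
      rw [aeval_rename] at ha
      have := hsmooth _ ha fun l => by
        rw [← aeval_rename, ← pderiv_rename τ.injective]
        exact ha' _
      ext l
      simpa using congrFun this (τ.symm l))
    (fun a ha => by
      rw [aeval_rename] at ha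
      have := hno _ ha
      ext l
      simpa using congrFun this (τ.symm l))
    (by
      rw [aeval_rename, Function.comp_assoc, Equiv.symm_comp_self]
      exact hx)
    (by rwa [← hτj, Function.comp_apply, Equiv.symm_apply_apply])
    (by
      rw [← hτi, pderiv_rename τ.injective, aeval_rename, Function.comp_assoc,
        Equiv.symm_comp_self]
      exact hi)
    hd3 hd1 hd4 hd10
  refine ⟨d', hd', h3, L, _, _, hL, y ∘ τ, fun h => hy ?_, by rwa [aeval_rename] at hyF⟩
  ext l
  simpa using congrFun h (τ.symm l)

end Normalization

open MvPolynomial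

/-- **Coray's descent lemma for smooth cubic surfaces over infinite perfect fields.**
If a smooth cubic surface over an infinite perfect field `k` has a nontrivial zero in a
finite extension of degree `d` with `3 ∤ d` and `d ∉ {1, 4, 10}`, then it has a
nontrivial zero in a finite extension of some smaller degree `d'` with `3 ∤ d'`. -/
theorem coray_descent_cubic_surface {k : Type u} [Field k] [Infinite k] [PerfectField k]
    (F : MvPolynomial (Fin 4) k) (hF_ne : F ≠ 0) (hF_hom : F.IsHomogeneous 3)
    (hF_smooth : ∀ a : Fin 4 → AlgebraicClosure k,
      aeval a F = 0 → (∀ i : Fin 4, aeval a (pderiv i F) = 0) → a = 0)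
    (d : ℕ) (hd_pos : 0 < d) (hd3 : ¬ (3 ∣ d)) (hd1 : d ≠ 1) (hd4 : d ≠ 4) (hd10 : d ≠ 10)
    (K : Type v) [Field K] [Algebra k K] [FiniteDimensional k K]
    (hdeg : Module.finrank k K = d)
    (x : Fin 4 → K) (hx : x ≠ 0) (hFx : aeval x F = 0) :
    ∃ d' : ℕ, d' < d ∧ ¬ (3 ∣ d') ∧
      ∃ (L : Type u) (_ : Field L) (_ : Algebra k L) (_ : FiniteDimensional k L),
        Module.finrank k L = d' ∧ ∃ y : Fin 4 → L, y ≠ 0 ∧ aeval y F = 0 := by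
  subst hdeg
  by_cases hno : ∀ a : Fin 4 → k, aeval a F = 0 → a = 0
  · obtain ⟨d', hd', h3, L, _, _, hL, hy⟩ :=
      exists_lower_degree hF_hom hF_smooth hno hFx hx hd3 hd1 hd4 hd10
    have : FiniteDimensional k L := Module.finite_of_finrank_pos
      (by rw [hL]; exact Nat.pos_of_ne_zero fun h => h3 (h ▸ dvd_zero 3))
    exact ⟨d', hd', h3, L, _, _, this, hL, hy⟩
  · push Not at hno
    obtain ⟨a, ha, ha0⟩ := hno
    exact ⟨1, by omega, by omega, k, _, _, inferInstance, Module.finrank_self k, a, ha0, ha⟩
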